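/- Let n, r, k be positive integers with n > 36k(2k+1)(k+r)r, and let m be an integer with 0 < m < C(n,k) whose (n,k)-cascade end is at most r. Then for every family 𝓕 ⊆ ([n] choose k) with |𝓕| = m, one has ω(𝓕) ≤ ω(L_{n,k}^m). -/

import Mathlib

open Finset

/-- `ω(𝓕)`: the sum of `|A ∩ B|` over unordered pairs of distinct members of `𝓕`. -/
def omegaF (F : Finset (Finset ℕ)) : ℕ :=
  ∑ p ∈ F.sym2.filter (fun p => ¬ p.IsDiag),
    Sym2.lift ⟨fun A B => (A ∩ B).card, fun A B => by simp [Finset.inter_comm]⟩ p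

/-- `ω(𝓕, 𝓖)`: the sum of `|A ∩ B|` over all ordered pairs `(A, B) ∈ 𝓕 × 𝓖`. -/
def omegaPair (F G : Finset (Finset ℕ)) : ℕ :=
  ∑ A ∈ F, ∑ B ∈ G, (A ∩ B).card

/-- `ω(F, 𝓕)`: the sum of `|F ∩ A|` over all `A ∈ 𝓕`. -/
def omegaSet (F : Finset ℕ) (G : Finset (Finset ℕ)) : ℕ :=
  ∑ A ∈ G, (F ∩ A).card

/-- `A` precedes `B` in the lexicographic ordering: `min (A \ B) < min (B \ A)`. -/
def lexLT (A B : Finset ℕ) : Prop :=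
  (A \ B).min < (B \ A).min

/-- `L` consists of the first `m` sets of `([n] choose k)` in the lexicographic
ordering: it is an `m`-element subfamily all of whose members lexicographically
precede all non-members. -/
def IsInitSeg (n k m : ℕ) (L : Finset (Finset ℕ)) : Prop :=
  L ⊆ (Finset.Icc 1 n).powersetCard k ∧ L.card = m ∧
    ∀ A ∈ L, ∀ B ∈ (Finset.Icc 1 n).powersetCard k, B ∉ L → lexLT A B

/-- The `(n,k)`-cascade end of `m` is at most `r`: writing
`C(n,k) - m = C(n-r₁,k) + C(n-r₂,k-1) + ⋯ + C(n-rₛ,k-s+1)` in `k`-cascade form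
with `1 ≤ r₁ < ⋯ < rₛ ≤ n-1`, one has `rₛ ≤ r`. -/
def CascadeEndLe (n k m r : ℕ) : Prop :=
  ∃ (s : ℕ) (f : Fin (s + 1) → ℕ),
    s + 1 ≤ k ∧ StrictMono f ∧ 1 ≤ f 0 ∧ f (Fin.last s) ≤ n - 1 ∧
    (∀ i : Fin (s + 1), k - (i : ℕ) ≤ n - f i) ∧
    f (Fin.last s) ≤ r ∧
    n.choose k - m = ∑ i : Fin (s + 1), (n - f i).choose (k - (i : ℕ))

namespace SI

/-- weight of a set with respect to a family -/
noncomputable def wt (G : Finset (Finset ℕ)) (A : Finset ℕ) : ℝ := ∑ B ∈ G, ((A ∩ B).card : ℝ)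
/-- bilinear form -/
noncomputable def ip (G H : Finset (Finset ℕ)) : ℝ := ∑ A ∈ G, wt H A
/-- degree of a set -/
noncomputable def deg (G : Finset (Finset ℕ)) (T : Finset ℕ) : ℝ := ((G.filter (T ⊆ ·)).card : ℝ)

lemma wt_nonneg (G A) : 0 ≤ wt G A := Finset.sum_nonneg (fun _ _ => by positivity)
lemma ip_nonneg (G H) : 0 ≤ ip G H := Finset.sum_nonneg (fun _ _ => wt_nonneg _ _)
lemma deg_nonneg (G T) : 0 ≤ deg G T := by unfold deg; positivity

lemma ip_comm (G H) : ip G H = ip H G := by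
  unfold ip wt
  rw [Finset.sum_comm]
  simp only [Finset.inter_comm]

lemma wt_union {G H : Finset (Finset ℕ)} (h : Disjoint G H) (A) : wt (G ∪ H) A = wt G A + wt H A := by
  unfold wt; rw [Finset.sum_union h]

lemma ip_union_left {G H : Finset (Finset ℕ)} (h : Disjoint G H) (K) :
    ip (G ∪ H) K = ip G K + ip H K := by
  unfold ip; rw [Finset.sum_union h]

lemma ip_union_self {G H : Finset (Finset ℕ)} (h : Disjoint G H) :
    ip (G ∪ H) (G ∪ H) = ip G G + 2 * ip H G + ip H H := by
  rw [ip_union_left h, ip_comm G, ip_comm H, ip_union_left h, ip_union_left h, ip_comm G H]; ring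

lemma ip_sdiff_self {G H : Finset (Finset ℕ)} (h : H ⊆ G) :
    ip G G = ip H H + 2 * ip (G \ H) H + ip (G \ H) (G \ H) := by
  rw [← ip_union_self (Finset.disjoint_sdiff), Finset.union_sdiff_of_subset h]

lemma wt_sdiff {G H : Finset (Finset ℕ)} (h : H ⊆ G) (A) : wt G A = wt H A + wt (G \ H) A := by
  rw [← wt_union (Finset.disjoint_sdiff), Finset.union_sdiff_of_subset h]

lemma wt_mono {G H : Finset (Finset ℕ)} (h : H ⊆ G) (A) : wt H A ≤ wt G A := by
  rw [wt_sdiff h]; linarith [wt_nonneg (G \ H) A]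

lemma deg_sdiff {G H : Finset (Finset ℕ)} (h : H ⊆ G) (T) : deg G T = deg H T + deg (G \ H) T := by
  unfold deg
  rw [← Nat.cast_add, ← Finset.card_union_of_disjoint, ← Finset.filter_union,
    Finset.union_sdiff_of_subset h]
  exact Finset.disjoint_filter_filter Finset.disjoint_sdiff

lemma deg_union {G H : Finset (Finset ℕ)} (h : Disjoint G H) (T) : deg (G ∪ H) T = deg G T + deg H T := by
  unfold deg
  rw [Finset.filter_union, Finset.card_union_of_disjoint (Finset.disjoint_filter_filter h)]; push_cast; rfl

lemma deg_mono {G H : Finset (Finset ℕ)} (h : H ⊆ G) (T) : deg H T ≤ deg G T := by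
  rw [deg_sdiff h]; linarith [deg_nonneg (G \ H) T]

lemma deg_anti {G : Finset (Finset ℕ)} {T T' : Finset ℕ} (h : T ⊆ T') : deg G T' ≤ deg G T := by
  unfold deg
  exact_mod_cast Finset.card_le_card (Finset.monotone_filter_right _ (fun A _ hA => h.trans hA))

lemma deg_le_card (G T) : deg G T ≤ (G.card : ℝ) := by
  unfold deg; exact_mod_cast Finset.card_filter_le _ _

lemma deg_eq_sum (G : Finset (Finset ℕ)) (T) : deg G T = ∑ B ∈ G, (if T ⊆ B then (1:ℝ) else 0) := by
  unfold deg; rw [Finset.card_filter]; push_cast; rfl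

lemma wt_eq_sum_deg (G A) : wt G A = ∑ x ∈ A, deg G {x} := by
  unfold wt
  simp only [deg_eq_sum]
  rw [Finset.sum_comm]
  refine Finset.sum_congr rfl fun B _ => ?_
  simp only [Finset.singleton_subset_iff]
  rw [Finset.sum_ite_mem]; simp

lemma ip_eq_sum_deg {X : Finset ℕ} {G : Finset (Finset ℕ)} (hG : ∀ A ∈ G, A ⊆ X) (H) :
    ip G H = ∑ x ∈ X, deg G {x} * deg H {x} := by
  unfold ip
  simp only [wt_eq_sum_deg]
  simp only [deg_eq_sum G, Finset.sum_mul]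
  rw [Finset.sum_comm]
  refine Finset.sum_congr rfl fun A hA => ?_
  simp only [Finset.singleton_subset_iff, ite_mul, one_mul, zero_mul]
  rw [Finset.sum_ite_mem, Finset.inter_eq_right.mpr (hG A hA)]

lemma sum_deg {X : Finset ℕ} {G : Finset (Finset ℕ)} {k : ℕ} (hG : G ⊆ X.powersetCard k) :
    ∑ x ∈ X, deg G {x} = k * G.card := by
  simp only [deg_eq_sum]
  rw [Finset.sum_comm]
  have : ∀ A ∈ G, (∑ x ∈ X, if {x} ⊆ A then (1:ℝ) else 0) = k := by
    intro A hA
    have := Finset.mem_powersetCard.1 (hG hA)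
    simp only [Finset.singleton_subset_iff]
    rw [Finset.sum_ite_mem, Finset.inter_eq_right.mpr this.1]; simp [this.2]
  rw [Finset.sum_congr rfl this]; simp [mul_comm]

lemma wt_le {G : Finset (Finset ℕ)} {A : Finset ℕ} {k : ℕ} (hA : A.card = k) : wt G A ≤ k * G.card := by
  unfold wt
  calc _ ≤ ∑ B ∈ G, (k:ℝ) := Finset.sum_le_sum fun B _ => by
        exact_mod_cast hA ▸ Finset.card_le_card Finset.inter_subset_left
    _ = _ := by simp [mul_comm]

/-- exchange identity -/
lemma ip_swap {F : Finset (Finset ℕ)} {A B : Finset ℕ} (hA : A ∈ F) (hB : B ∉ F)  (hc : A.card = B.card) :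
    ip (insert B (F.erase A)) (insert B (F.erase A)) =
      ip F F + 2 * (wt F B - wt F A) + 2 * ((A \ B).card : ℝ) := by
  have hBE : B ∉ F.erase A := fun h => hB (Finset.mem_of_mem_erase h)
  have h1 : ip (insert B (F.erase A)) (insert B (F.erase A)) =
      ip (F.erase A) (F.erase A) + 2 * wt (F.erase A) B + B.card := by
    have := ip_union_self (G := F.erase A) (H := {B}) (by simpa using hBE)
    rw [Finset.union_comm, ← Finset.insert_eq] at this
    rw [this]; simp [ip, wt]
  have h2 : ip F F = ip (F.erase A) (F.erase A) + 2 * wt (F.erase A) A + A.card := by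
    have := ip_union_self (G := F.erase A) (H := {A}) (by simp)
    rw [Finset.union_comm, ← Finset.insert_eq, Finset.insert_erase hA] at this
    rw [this]; simp [ip, wt]
  have h3 : ∀ Y, wt F Y = wt (F.erase A) Y + ((Y ∩ A).card : ℝ) := by
    intro Y
    unfold wt
    rw [Finset.sum_erase_add _ _ hA]
  have h4 : ((A \ B).card : ℝ) = A.card - (B ∩ A).card := by
    rw [Finset.card_sdiff, Nat.cast_sub (Finset.card_le_card Finset.inter_subset_right)]
  rw [h1, h2, h3 A, h3 B, h4, hc]
  simp only [Finset.inter_self, hc]; ring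

/-- optimality of a family -/
def Opt (X : Finset ℕ) (k : ℕ) (F : Finset (Finset ℕ)) : Prop :=
  F ⊆ X.powersetCard k ∧ ∀ G ⊆ X.powersetCard k, G.card = F.card → ip G G ≤ ip F F

lemma Opt.threshold {X k F} (h : Opt X k F) {A B : Finset ℕ} (hA : A ∈ F) (hB : B ∉ F)
    (hBX : B ∈ X.powersetCard k) : wt F B < wt F A := by
  have hAX := Finset.mem_powersetCard.1 (h.1 hA)
  have hBX' := Finset.mem_powersetCard.1 hBX
  have hc : A.card = B.card := by rw [hAX.2, hBX'.2]
  have h1 := h.2 (insert B (F.erase A)) (by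
    intro Y hY
    rcases Finset.mem_insert.1 hY with rfl | hY
    · exact hBX
    · exact h.1 (Finset.mem_of_mem_erase hY)) (by
      rw [Finset.card_insert_of_notMem (fun h => hB (Finset.mem_of_mem_erase h)),
        Finset.card_erase_add_one hA])
  rw [ip_swap hA hB hc] at h1
  have : 0 < (A \ B).card := by
    rw [Finset.card_pos, Finset.sdiff_nonempty]
    intro hs
    exact hB (Finset.eq_of_subset_of_card_le hs hc.ge ▸ hA)
  have : (0:ℝ) < (A \ B).card := by exact_mod_cast this
  linarith

lemma exists_opt (X : Finset ℕ) (k : ℕ) (F : Finset (Finset ℕ)) (hF : F ⊆ X.powersetCard k) :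
    ∃ G, Opt X k G ∧ G.card = F.card ∧ ip F F ≤ ip G G := by
  obtain ⟨G, hG, hmax⟩ := Finset.exists_max_image ((X.powersetCard k).powersetCard F.card)
    (fun G => ip G G) ⟨F, by simp [Finset.mem_powersetCard, hF]⟩
  rw [Finset.mem_powersetCard] at hG
  refine ⟨G, ⟨hG.1, fun G' h1 h2 => hmax G' ?_⟩, hG.2, hmax F ?_⟩
  · rw [Finset.mem_powersetCard]; exact ⟨h1, h2.trans hG.2⟩
  · rw [Finset.mem_powersetCard]; exact ⟨hF, rfl⟩

end SI

namespace SI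

/-- k-subsets of X containing I and avoiding J -/
def cyl (X : Finset ℕ) (k : ℕ) (I J : Finset ℕ) : Finset (Finset ℕ) :=
  (X.powersetCard k).filter (fun A => I ⊆ A ∧ Disjoint J A)

/-- size of a cylinder -/
def cc (n k i j : ℕ) : ℕ := if i ≤ k then (n - i - j).choose (k - i) else 0

/-- size of the family of all k-sets containing a given i-set -/
noncomputable def CC (n k i : ℕ) : ℝ := (cc n k i 0 : ℝ)

lemma mem_cyl {X k I J A} : A ∈ cyl X k I J ↔ A ∈ X.powersetCard k ∧ I ⊆ A ∧ Disjoint J A := by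
  simp [cyl]

lemma cyl_sub {X k I J} : cyl X k I J ⊆ X.powersetCard k := Finset.filter_subset _ _

lemma card_cyl {X : Finset ℕ} {k : ℕ} {I J : Finset ℕ} (hI : I ⊆ X) (hJ : J ⊆ X)
    (hd : Disjoint I J) : (cyl X k I J).card = cc X.card k I.card J.card := by
  unfold cc
  split_ifs with h
  · have h1 : (((X \ I) \ J).powersetCard (k - I.card)).card =
        (X.card - I.card - J.card).choose (k - I.card) := by
      rw [Finset.card_powersetCard, Finset.card_sdiff_of_subset, Finset.card_sdiff_of_subset hI]
      intro x hx
      exact Finset.mem_sdiff.2 ⟨hJ hx, fun hx' => Finset.disjoint_left.1 hd hx' hx⟩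
    rw [← h1]
    refine Finset.card_bij' (fun A _ => A \ I) (fun B _ => B ∪ I) ?_ ?_ ?_ ?_
    · intro A hA
      obtain ⟨h1, h2, h3⟩ := mem_cyl.1 hA
      obtain ⟨h4, h5⟩ := Finset.mem_powersetCard.1 h1
      rw [Finset.mem_powersetCard, Finset.card_sdiff_of_subset h2, h5]
      refine ⟨fun x hx => ?_, rfl⟩
      have := Finset.mem_sdiff.1 hx
      exact Finset.mem_sdiff.2 ⟨Finset.mem_sdiff.2 ⟨h4 this.1, this.2⟩,
        fun h' => Finset.disjoint_left.1 h3 h' this.1⟩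
    · intro B hB
      obtain ⟨h1, h2⟩ := Finset.mem_powersetCard.1 hB
      have hBI : Disjoint B I := Finset.disjoint_left.2 fun x hx hx' =>
        (Finset.mem_sdiff.1 (Finset.mem_sdiff.1 (h1 hx)).1).2 hx'
      rw [mem_cyl, Finset.mem_powersetCard]
      refine ⟨⟨Finset.union_subset (fun x hx => (Finset.mem_sdiff.1 (Finset.mem_sdiff.1 (h1 hx)).1).1) hI, ?_⟩, Finset.subset_union_right, ?_⟩
      · rw [Finset.card_union_of_disjoint hBI, h2]; omega
      · rw [Finset.disjoint_union_right]
        exact ⟨Finset.disjoint_left.2 fun x hx hx' => (Finset.mem_sdiff.1 (h1 hx')).2 hx, hd.symm⟩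
    · intro A hA
      obtain ⟨h1, h2, h3⟩ := mem_cyl.1 hA
      exact Finset.sdiff_union_of_subset h2
    · intro B hB
      obtain ⟨h1, h2⟩ := Finset.mem_powersetCard.1 hB
      have hBI : Disjoint B I := Finset.disjoint_left.2 fun x hx hx' =>
        (Finset.mem_sdiff.1 (Finset.mem_sdiff.1 (h1 hx)).1).2 hx'
      exact Finset.union_sdiff_cancel_right hBI
  · rw [Finset.card_eq_zero, Finset.eq_empty_iff_forall_notMem]
    intro A hA
    obtain ⟨h1, h2, h3⟩ := mem_cyl.1 hA
    have := Finset.card_le_card h2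
    rw [(Finset.mem_powersetCard.1 h1).2] at this
    exact h this

lemma cc_pascal {n k i j : ℕ} (h : i + j < n) : cc n k i j = cc n k i (j+1) + cc n k (i+1) j := by
  unfold cc
  by_cases h1 : i ≤ k
  · by_cases h2 : i + 1 ≤ k
    · simp only [h1, h2, if_true]
      obtain ⟨N, hN⟩ : ∃ N, n - i - j = N + 1 := ⟨n - i - j - 1, by omega⟩
      obtain ⟨s, hs⟩ : ∃ s, k - i = s + 1 := ⟨k - i - 1, by omega⟩
      rw [hN, hs, show n - i - (j+1) = N by omega, show n - (i+1) - j = N by omega,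
        show k - (i+1) = s by omega, Nat.choose_succ_succ', add_comm]
    · simp only [h1, h2, if_true, if_false]
      rw [show k - i = 0 by omega]; simp
  · have : ¬ (i + 1 ≤ k) := by omega
    simp [h1, this]

lemma cc_anti {n k i j j' : ℕ} (h : j ≤ j') : cc n k i j' ≤ cc n k i j := by
  unfold cc
  split_ifs
  · exact Nat.choose_le_choose _ (by omega)
  · exact le_rfl

lemma cc_ge {n k i j : ℕ} (h : i + j ≤ n) : cc n k i 0 ≤ cc n k i j + j * cc n k (i+1) 0 := by
  induction j with
  | zero => simp
  | succ j ih =>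
    have h1 := ih (by omega)
    have h2 := cc_pascal (n := n) (k := k) (i := i) (j := j) (by omega)
    have h3 : cc n k (i+1) j ≤ cc n k (i+1) 0 := cc_anti (Nat.zero_le _)
    rw [add_mul]; omega

lemma cc_pos {n k i j : ℕ} (h : i ≤ k) (h2 : k + j ≤ n) : 0 < cc n k i j := by
  unfold cc; rw [if_pos h]; exact Nat.choose_pos (by omega)

lemma cc_step {n k i : ℕ} (hkn : k ≤ n) : n * cc n k (i+1) 0 ≤ k * cc n k i 0 := by
  unfold cc
  by_cases h1 : i + 1 ≤ k
  · have h2 : i ≤ k := by omega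
    simp only [h1, h2, if_true, Nat.sub_zero]
    obtain ⟨N, hN⟩ : ∃ N, n - i = N + 1 := ⟨n - i - 1, by omega⟩
    obtain ⟨s, hs⟩ : ∃ s, k - i = s + 1 := ⟨k - i - 1, by omega⟩
    rw [hN, hs, show n - (i+1) = N by omega, show k - (i+1) = s by omega]
    have h3 := Nat.add_one_mul_choose_eq N s
    have h4 : n * (s+1) ≤ k * (N+1) := by
      have e1 : n = N + 1 + i := by omega
      have e2 : k = s + 1 + i := by omega
      have e3 : s ≤ N := by omega
      rw [e1, e2]; nlinarith
    have : (N+1) * (n * N.choose s) ≤ (N+1) * (k * (N+1).choose (s+1)) := by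
      calc (N+1) * (n * N.choose s) = n * ((N+1) * N.choose s) := by ring
        _ = n * (s+1) * (N+1).choose (s+1) := by rw [h3]; ring
        _ ≤ k * (N+1) * (N+1).choose (s+1) := Nat.mul_le_mul_right _ h4
        _ = _ := by ring
    exact Nat.le_of_mul_le_mul_left this (by omega)
  · simp [h1]

lemma CC_nonneg (n k i) : 0 ≤ CC n k i := by unfold CC; positivity

lemma CC_pos {n k i : ℕ} (h : i ≤ k) (h2 : k ≤ n) : 0 < CC n k i := by
  unfold CC; exact_mod_cast cc_pos h (by simpa using h2)

lemma deg_le_CC {X : Finset ℕ} {k : ℕ} {G : Finset (Finset ℕ)} (hG : G ⊆ X.powersetCard k)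
    (T : Finset ℕ) : deg G T ≤ CC X.card k T.card := by
  by_cases hT : T ⊆ X
  · unfold CC deg
    rw [← Finset.card_empty (α := ℕ), ← card_cyl hT (Finset.empty_subset _) (by simp)]
    refine Nat.cast_le.2 (Finset.card_le_card fun A hA => ?_)
    rw [Finset.mem_filter] at hA
    exact mem_cyl.2 ⟨hG hA.1, hA.2, by simp⟩
  · have : deg G T = 0 := by
      unfold deg
      rw [Nat.cast_eq_zero, Finset.card_eq_zero, Finset.filter_eq_empty_iff]
      intro A hA h
      exact hT (h.trans (Finset.mem_powersetCard.1 (hG hA)).1)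
    rw [this]; exact CC_nonneg _ _ _

/-- numeric assumptions -/
structure Num (n k r : ℕ) : Prop where
  hk : 1 ≤ k
  hr : 1 ≤ r
  hn : 72 * k^2 * r * (k + r) < n

lemma Num.kn {n k r : ℕ} (h : Num n k r) : k + r + 10 ≤ n := by
  have h1 := h.hk; have h2 := h.hr; have h3 := h.hn
  have : 1 ≤ k^2 * r := Nat.one_le_iff_ne_zero.2 (by positivity)
  have : 72 * (k + r) ≤ 72 * k^2 * r * (k + r) := by
    calc 72 * (k+r) = 72 * 1 * (k+r) := by ring
      _ ≤ 72 * (k^2 * r) * (k + r) := by gcongr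
      _ = _ := by ring
  omega

lemma Num.kn' {n k r : ℕ} (h : Num n k r) : k ≤ n := by have := h.kn; omega

lemma Num.step {n k r : ℕ} (h : Num n k r) (i : ℕ) :
    72 * k * r * (k + r) * CC n k (i+1) ≤ CC n k i := by
  have h1 : n * cc n k (i+1) 0 ≤ k * cc n k i 0 := cc_step h.kn'
  have h2 := h.hn
  have h3 : k * (72 * k * r * (k+r) * cc n k (i+1) 0) ≤ k * cc n k i 0 := by
    refine le_trans ?_ h1
    calc k * (72 * k * r * (k+r) * cc n k (i+1) 0) = 72 * k^2 * r * (k+r) * cc n k (i+1) 0 := by ring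
      _ ≤ _ := Nat.mul_le_mul_right _ h2.le
  have := Nat.le_of_mul_le_mul_left h3 (by have := h.hk; omega)
  unfold CC; exact_mod_cast this

lemma CC_step {n k : ℕ} (h : k ≤ n) (i : ℕ) : n * CC n k (i+1) ≤ k * CC n k i := by
  unfold CC; exact_mod_cast cc_step h

lemma CC_step_pow {n k : ℕ} (hn : 0 < n) (h : k ≤ n) (i j : ℕ) :
    CC n k (i+j) ≤ CC n k i * ((k:ℝ)/n)^j := by
  induction j with
  | zero => simp
  | succ j ih =>
    have h1 := CC_step h (i+j)
    have hn' : (0:ℝ) < n := by exact_mod_cast hn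
    have : CC n k (i + j + 1) ≤ k / n * CC n k (i+j) := by
      rw [div_mul_eq_mul_div, le_div_iff₀ hn']; linarith
    calc CC n k (i + (j+1)) ≤ k / n * CC n k (i+j) := this
      _ ≤ k / n * (CC n k i * ((k:ℝ)/n)^j) := by gcongr
      _ = _ := by ring

lemma CC_anti {n k : ℕ} (h : k ≤ n) {i j : ℕ} (hij : i ≤ j) : CC n k j ≤ CC n k i := by
  obtain ⟨d, rfl⟩ := Nat.exists_eq_add_of_le hij
  induction d with
  | zero => simp
  | succ d ih =>
    have h1 := CC_step h (i+d)
    refine le_trans ?_ (ih (by omega))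
    rcases Nat.eq_zero_or_pos n with hn | hn
    · have : k = 0 := by omega
      subst this; simp [CC, cc]
      split_ifs <;> simp
    have hn' : (0:ℝ) < n := by exact_mod_cast hn
    have h2 : (k:ℝ) * CC n k (i+d) ≤ n * CC n k (i+d) := by
      have := CC_nonneg n k (i+d); gcongr
    exact le_of_mul_le_mul_left (h1.trans h2) hn'

end SI

namespace SI

noncomputable def PP (X : Finset ℕ) (i : ℕ) (G : Finset (Finset ℕ)) : ℝ :=
  ∑ T ∈ X.powersetCard i, deg G T ^ 2

lemma PP_nonneg (X i G) : 0 ≤ PP X i G := Finset.sum_nonneg fun _ _ => sq_nonneg _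

lemma sum_deg_sub {X A : Finset ℕ} {i : ℕ} (hA : A ⊆ X) (f : Finset ℕ → ℝ) :
    ∑ T ∈ X.powersetCard i, (if T ⊆ A then f T else 0) = ∑ T ∈ A.powersetCard i, f T := by
  rw [← Finset.sum_filter]
  refine Finset.sum_congr ?_ fun _ _ => rfl
  ext T
  simp only [Finset.mem_filter, Finset.mem_powersetCard]
  exact ⟨fun h => ⟨h.2, h.1.2⟩, fun h => ⟨⟨h.1.trans hA, h.2⟩, h.1⟩⟩

/-- double counting of f(T) over pairs T ⊆ A ∈ G -/
lemma sum_sum_powersetCard {X : Finset ℕ} {G : Finset (Finset ℕ)} (hG : ∀ A ∈ G, A ⊆ X) (i : ℕ)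
    (f : Finset ℕ → ℝ) :
    ∑ A ∈ G, ∑ T ∈ A.powersetCard i, f T = ∑ T ∈ X.powersetCard i, f T * deg G T := by
  have : ∀ A ∈ G, ∑ T ∈ A.powersetCard i, f T = ∑ T ∈ X.powersetCard i, (if T ⊆ A then f T else 0) :=
    fun A hA => (sum_deg_sub (hG A hA) f).symm
  rw [Finset.sum_congr rfl this, Finset.sum_comm]
  refine Finset.sum_congr rfl fun T _ => ?_
  rw [deg_eq_sum, Finset.mul_sum]
  refine Finset.sum_congr rfl fun A _ => ?_
  split_ifs <;> simp

lemma PP_eq {X : Finset ℕ} {G : Finset (Finset ℕ)} (hG : ∀ A ∈ G, A ⊆ X) (i : ℕ) :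
    PP X i G = ∑ A ∈ G, ∑ B ∈ G, ((A ∩ B).card.choose i : ℝ) := by
  unfold PP
  have h1 := sum_sum_powersetCard hG i (fun T => deg G T)
  simp only [← sq] at h1
  rw [← h1]
  refine Finset.sum_congr rfl fun A _ => ?_
  simp only [deg_eq_sum]
  rw [Finset.sum_comm]
  refine Finset.sum_congr rfl fun B _ => ?_
  rw [← Finset.sum_filter, ← Finset.card_powersetCard, Finset.sum_const, nsmul_eq_mul, mul_one]
  congr 2
  ext T
  simp only [Finset.mem_filter, Finset.mem_powersetCard, Finset.subset_inter_iff]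
  tauto

lemma geom_le {z : ℝ} (hz : 0 ≤ z) (hz2 : z ≤ 1/72) (i : ℕ) :
    ∑ j ∈ Finset.range i, z ^ j ≤ 72/71 := by
  have h := geom_sum_mul_neg z i
  have h1 : 0 ≤ z^i := pow_nonneg hz i
  by_contra hc
  push Not at hc
  nlinarith

lemma choose_bd1 {I i l : ℕ} (hl : l < i) (hI : I < i) : I.choose l ≤ i ^ (i - 1 - l) := by
  calc I.choose l ≤ (i-1).choose l := Nat.choose_le_choose _ (by omega)
    _ = (i-1).choose (i - 1 - l) := by rw [Nat.choose_symm (by omega)]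
    _ ≤ (i-1) ^ (i - 1 - l) := Nat.choose_le_pow _ _
    _ ≤ _ := Nat.pow_le_pow_left (by omega) _

lemma choose_bd2 {I i l : ℕ} (hl : l ≤ i) (hI : i ≤ I) : I.choose l ≤ i ^ (i - l) * I.choose i := by
  have h1 := Nat.choose_mul (n := I) hl
  have h2 : 1 ≤ (I - l).choose (i - l) := Nat.choose_pos (by omega)
  calc I.choose l ≤ I.choose l * (I - l).choose (i - l) := Nat.le_mul_of_pos_right _ h2
    _ = I.choose i * i.choose l := h1.symm
    _ = i.choose (i - l) * I.choose i := by rw [Nat.choose_symm hl, mul_comm]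
    _ ≤ _ := Nat.mul_le_mul_right _ (Nat.choose_le_pow _ _)

lemma sum_choose_bd {y : ℝ} {i : ℕ} (hi : 1 ≤ i) (hy : 0 ≤ y) (hyi : y * i ≤ 1/72) (I : ℕ) :
    ∑ l ∈ Finset.range (i+1), (I.choose l : ℝ) * y ^ (i - l) ≤
      (I.choose i : ℝ) + (72/71) * y + (1/71) * (I.choose i : ℝ) := by
  rw [Finset.sum_range_succ]
  simp only [Nat.sub_self, pow_zero, mul_one]
  have hz : 0 ≤ y * i := by positivity
  have hg : ∑ l ∈ Finset.range i, (y * i) ^ (i - 1 - l) ≤ 72/71 := by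
    rw [Finset.sum_range_reflect (fun j => (y*i)^j)]; exact geom_le hz hyi i
  suffices h : ∑ l ∈ Finset.range i, (I.choose l : ℝ) * y ^ (i - l) ≤
      (72/71) * y + (1/71) * (I.choose i : ℝ) by linarith
  have hpow : ∀ l ∈ Finset.range i, y ^ (i - l) = y * y ^ (i - 1 - l) := by
    intro l hl
    have := Finset.mem_range.1 hl
    rw [← pow_succ']; congr 1; omega
  rcases lt_or_ge I i with hI | hI
  · calc _ ≤ ∑ l ∈ Finset.range i, y * (y * i) ^ (i - 1 - l) := by
          refine Finset.sum_le_sum fun l hl => ?_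
          have h1 : (I.choose l : ℝ) ≤ (i:ℝ) ^ (i - 1 - l) := by
            exact_mod_cast choose_bd1 (Finset.mem_range.1 hl) hI
          rw [hpow l hl, mul_pow]
          calc _ ≤ (i:ℝ) ^ (i - 1 - l) * (y * y ^ (i - 1 - l)) := by gcongr
            _ = _ := by ring
      _ ≤ (72/71) * y := by rw [← Finset.mul_sum]; nlinarith
      _ ≤ _ := by have : (0:ℝ) ≤ (1/71) * (I.choose i : ℝ) := by positivity
                  linarith
  · calc _ ≤ ∑ l ∈ Finset.range i, ((y * i) * (I.choose i : ℝ)) * (y * i) ^ (i - 1 - l) := by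
          refine Finset.sum_le_sum fun l hl => ?_
          have h0 := Finset.mem_range.1 hl
          have h1 : (I.choose l : ℝ) ≤ (i:ℝ) ^ (i - l) * (I.choose i : ℝ) := by
            exact_mod_cast choose_bd2 h0.le hI
          calc _ ≤ (i:ℝ) ^ (i - l) * (I.choose i : ℝ) * y ^ (i - l) := by gcongr
            _ = (I.choose i : ℝ) * (y * i)^(i - l) := by rw [mul_pow]; ring
            _ = _ := by
              rw [show i - l = (i - 1 - l) + 1 by omega, pow_succ]; ring
      _ = ((y * i) * (I.choose i : ℝ)) * ∑ l ∈ Finset.range i, (y * i) ^ (i - 1 - l) := by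
          rw [Finset.mul_sum]
      _ ≤ ((1/72) * (I.choose i : ℝ)) * (72/71) := by gcongr
      _ ≤ _ := by linarith

lemma pair_bd {n k i : ℕ} (hn : 0 < n) (hkn : k ≤ n) {B B' : Finset ℕ} (hB : B.card = k) (hB' : B'.card = k) :
    ∑ T ∈ B.powersetCard i, ∑ T' ∈ B'.powersetCard i, CC n k (T ∪ T').card ≤
      CC n k i * ∑ l ∈ Finset.range (i+1), ((B ∩ B').card.choose l : ℝ) * ((k:ℝ)^3/n) ^ (i - l) := by
  have hcnt : ∀ (E R : Finset ℕ), E.card = k → R ⊆ E → R.card ≤ i →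
      (((E.powersetCard i).filter (R ⊆ ·)).card : ℝ) ≤ (k:ℝ)^(i - R.card) := by
    intro E R hE hR hRi
    have h1 := card_cyl (X := E) (k := i) (I := R) (J := ∅) hR (by simp) (by simp)
    have h2 : cyl E i R ∅ = (E.powersetCard i).filter (R ⊆ ·) := by
      unfold cyl; congr 1; ext; simp
    rw [← h2, h1]
    unfold cc
    rw [if_pos hRi, hE]
    calc (((k - R.card - (∅:Finset ℕ).card).choose (i - R.card) : ℕ) : ℝ) ≤ ((k - R.card - (∅:Finset ℕ).card : ℕ) : ℝ)^(i - R.card) := by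
          exact_mod_cast Nat.choose_le_pow _ _
      _ ≤ _ := by
          gcongr
          omega
  rw [← Finset.sum_product']
  have hmaps : ∀ p ∈ B.powersetCard i ×ˢ B'.powersetCard i,
      p.1 ∩ p.2 ∈ (Finset.range (i+1)).biUnion (fun l => (B ∩ B').powersetCard l) := by
    intro p hp
    rw [Finset.mem_product, Finset.mem_powersetCard, Finset.mem_powersetCard] at hp
    rw [Finset.mem_biUnion]
    refine ⟨(p.1 ∩ p.2).card, ?_, ?_⟩
    · rw [Finset.mem_range, Nat.lt_succ_iff, ← hp.1.2]; exact Finset.card_le_card Finset.inter_subset_left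
    · rw [Finset.mem_powersetCard]
      exact ⟨Finset.inter_subset_inter hp.1.1 hp.2.1, rfl⟩
  rw [← Finset.sum_fiberwise_of_maps_to hmaps]
  have hdisj : ∀ l ∈ Finset.range (i+1), ∀ l' ∈ Finset.range (i+1), l ≠ l' →
      Disjoint ((B ∩ B').powersetCard l) ((B ∩ B').powersetCard l') := by
    intro l _ l' _ hll
    exact Finset.pairwise_disjoint_powersetCard _ hll
  rw [Finset.sum_biUnion hdisj, Finset.mul_sum]
  refine Finset.sum_le_sum fun l hl => ?_
  have hl' : l ≤ i := Nat.lt_succ_iff.1 (Finset.mem_range.1 hl)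
  calc _ ≤ ∑ R ∈ (B ∩ B').powersetCard l, CC n k i * ((k:ℝ)^3/n) ^ (i - l) := by
        refine Finset.sum_le_sum fun R hR => ?_
        obtain ⟨hR1, hR2⟩ := Finset.mem_powersetCard.1 hR
        have hRB : R ⊆ B := hR1.trans Finset.inter_subset_left
        have hRB' : R ⊆ B' := hR1.trans Finset.inter_subset_right
        calc _ ≤ ∑ p ∈ (B.powersetCard i ×ˢ B'.powersetCard i).filter (fun p => p.1 ∩ p.2 = R),
                CC n k i * ((k:ℝ)/n) ^ (i - l) := by
              refine Finset.sum_le_sum fun p hp => ?_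
              rw [Finset.mem_filter, Finset.mem_product, Finset.mem_powersetCard, Finset.mem_powersetCard] at hp
              have h1 := Finset.card_union_add_card_inter p.1 p.2
              rw [hp.2, hR2, hp.1.1.2, hp.1.2.2] at h1
              rw [show (p.1 ∪ p.2).card = i + (i - l) by omega]
              exact CC_step_pow hn hkn i (i - l)
          _ = (((B.powersetCard i ×ˢ B'.powersetCard i).filter (fun p => p.1 ∩ p.2 = R)).card : ℝ) *
                (CC n k i * ((k:ℝ)/n) ^ (i - l)) := by rw [Finset.sum_const, nsmul_eq_mul]
          _ ≤ ((k:ℝ)^(i-l) * (k:ℝ)^(i-l)) * (CC n k i * ((k:ℝ)/n) ^ (i - l)) := by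
              have := CC_nonneg n k i
              refine mul_le_mul_of_nonneg_right ?_ (by positivity)
              have h1 := hcnt B R hB hRB (by omega)
              have h2 := hcnt B' R hB' hRB' (by omega)
              rw [hR2] at h1 h2
              calc (((B.powersetCard i ×ˢ B'.powersetCard i).filter (fun p => p.1 ∩ p.2 = R)).card : ℝ) ≤
                  (((B.powersetCard i).filter (R ⊆ ·) ×ˢ (B'.powersetCard i).filter (R ⊆ ·)).card : ℝ) := by
                    refine Nat.cast_le.2 (Finset.card_le_card fun p hp => ?_)
                    simp only [Finset.mem_filter, Finset.mem_product] at hp ⊢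
                    refine ⟨⟨hp.1.1, ?_⟩, hp.1.2, ?_⟩
                    · rw [← hp.2]; exact Finset.inter_subset_left
                    · rw [← hp.2]; exact Finset.inter_subset_right
                _ = (((B.powersetCard i).filter (R ⊆ ·)).card : ℝ) * (((B'.powersetCard i).filter (R ⊆ ·)).card : ℝ) := by
                    rw [Finset.card_product, Nat.cast_mul]
                _ ≤ _ := by gcongr
          _ = CC n k i * ((k:ℝ)^3/n) ^ (i - l) := by
              rw [div_pow, div_pow]; ring
    _ = _ := by rw [Finset.sum_const, nsmul_eq_mul, Finset.card_powersetCard]; ring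

/-- local degree sum -/
noncomputable def cs (G : Finset (Finset ℕ)) (i : ℕ) (A : Finset ℕ) : ℝ := ∑ T ∈ A.powersetCard i, deg G T

lemma sum_cs_sq {X : Finset ℕ} {k i : ℕ} {G : Finset (Finset ℕ)}
    (hG : G ⊆ X.powersetCard k) :
    ∑ A ∈ X.powersetCard k, cs G i A ^ 2 ≤
      ∑ B ∈ G, ∑ B' ∈ G, ∑ T ∈ B.powersetCard i, ∑ T' ∈ B'.powersetCard i, CC X.card k (T ∪ T').card := by
  have hsub : ∀ A ∈ G, A ⊆ X := fun A hA => (Finset.mem_powersetCard.1 (hG hA)).1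
  have h1 : ∀ A ∈ X.powersetCard k, cs G i A = ∑ B ∈ G, ∑ T ∈ B.powersetCard i, (if T ⊆ A then (1:ℝ) else 0) := by
    intro A hA
    rw [sum_sum_powersetCard hsub]
    unfold cs
    rw [← sum_deg_sub (Finset.mem_powersetCard.1 hA).1]
    refine Finset.sum_congr rfl fun T _ => ?_
    split_ifs <;> simp
  calc _ = ∑ A ∈ X.powersetCard k, ∑ B ∈ G, ∑ B' ∈ G, ∑ T ∈ B.powersetCard i, ∑ T' ∈ B'.powersetCard i,
        (if T ∪ T' ⊆ A then (1:ℝ) else 0) := by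
        refine Finset.sum_congr rfl fun A hA => ?_
        rw [h1 A hA, sq, Finset.sum_mul_sum]
        refine Finset.sum_congr rfl fun B _ => Finset.sum_congr rfl fun B' _ => ?_
        rw [Finset.sum_mul_sum]
        refine Finset.sum_congr rfl fun T _ => Finset.sum_congr rfl fun T' _ => ?_
        simp only [Finset.union_subset_iff]
        by_cases h2 : T ⊆ A <;> by_cases h3 : T' ⊆ A <;> simp [h2, h3]
    _ = ∑ B ∈ G, ∑ B' ∈ G, ∑ T ∈ B.powersetCard i, ∑ T' ∈ B'.powersetCard i, deg (X.powersetCard k) (T ∪ T') := by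
        simp only [deg_eq_sum]
        rw [Finset.sum_comm]
        refine Finset.sum_congr rfl fun B _ => ?_
        rw [Finset.sum_comm]
        refine Finset.sum_congr rfl fun B' _ => ?_
        rw [Finset.sum_comm]
        refine Finset.sum_congr rfl fun T _ => ?_
        rw [Finset.sum_comm]
    _ ≤ _ := by
        refine Finset.sum_le_sum fun B _ => Finset.sum_le_sum fun B' _ => Finset.sum_le_sum fun T _ => Finset.sum_le_sum fun T' _ => ?_
        exact deg_le_CC (Finset.Subset.refl _) _

lemma deg_all {X : Finset ℕ} {k : ℕ} {T : Finset ℕ} (hT : T ⊆ X) :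
    deg (X.powersetCard k) T = CC X.card k T.card := by
  unfold CC deg
  rw [← Finset.card_empty (α := ℕ), ← card_cyl hT (Finset.empty_subset _) (by simp)]
  congr 2
  unfold cyl; congr 1; ext; simp

/-- the key inequality at level i -/
theorem UB {X : Finset ℕ} {k r i : ℕ} (N : Num X.card k r) (hi : 1 ≤ i) (hir : i ≤ r)
    {G : Finset (Finset ℕ)} (hG : G ⊆ X.powersetCard k)
    (hg : (G.card : ℝ) ≤ (r + 1/72) * CC X.card k i) (lam : ℝ) :
    ∑ T ∈ X.powersetCard i, deg G T ^ 2 * (CC X.card k i - deg G T)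
      + 2 * lam * CC X.card k i * PP X i G - lam^2 * CC X.card k i ^ 2 * G.card ≤
    CC X.card k i * PP X i G + CC X.card k i / 60 * (G.card * CC X.card k i + PP X i G) := by
  set n := X.card with hn
  set C := CC n k i with hC
  have hC0 : 0 ≤ C := CC_nonneg _ _ _
  have hsub : ∀ A ∈ G, A ⊆ X := fun A hA => (Finset.mem_powersetCard.1 (hG hA)).1
  have hn0 : 0 < n := by have := N.kn; omega
  set y : ℝ := (k:ℝ)^3/n with hy
  have hnR : (0:ℝ) < n := by exact_mod_cast hn0
  have hkR : (1:ℝ) ≤ k := by exact_mod_cast N.hk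
  have hrR : (1:ℝ) ≤ r := by exact_mod_cast N.hr
  have hNR : (72:ℝ) * k^2 * r * (k + r) ≤ n := by exact_mod_cast N.hn.le
  have hy0 : 0 ≤ y := by positivity
  have hyr : y * r ≤ 1/72 := by
    rw [hy, div_mul_eq_mul_div, div_le_iff₀ hnR]
    have : (0:ℝ) ≤ 72 * k^2 * r * r := by positivity
    nlinarith
  have hyi : y * i ≤ 1/72 := by
    have : (i:ℝ) ≤ r := by exact_mod_cast hir
    nlinarith
  -- upper bound
  have hup : ∑ A ∈ X.powersetCard k, cs G i A ^ 2 ≤ C * (PP X i G + (72/71) * y * G.card^2 + (1/71) * PP X i G) := by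
    refine (sum_cs_sq hG).trans ?_
    calc _ ≤ ∑ B ∈ G, ∑ B' ∈ G, C * (((B ∩ B').card.choose i : ℝ) + (72/71) * y + (1/71) * ((B ∩ B').card.choose i : ℝ)) := by
          refine Finset.sum_le_sum fun B hB => Finset.sum_le_sum fun B' hB' => ?_
          refine (pair_bd hn0 N.kn' (Finset.mem_powersetCard.1 (hG hB)).2 (Finset.mem_powersetCard.1 (hG hB')).2).trans ?_
          exact mul_le_mul_of_nonneg_left (sum_choose_bd hi hy0 hyi _) hC0
      _ = _ := by
          rw [PP_eq hsub]
          simp only [← Finset.mul_sum, Finset.sum_add_distrib, Finset.sum_const, nsmul_eq_mul]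
          ring
  -- lower bound outside
  have hout : ∑ T ∈ X.powersetCard i, deg G T ^ 2 * (C - deg G T) ≤ ∑ A ∈ X.powersetCard k \ G, cs G i A ^ 2 := by
    have h1 := sum_sum_powersetCard (X := X) (G := X.powersetCard k \ G)
      (fun A hA => (Finset.mem_powersetCard.1 (Finset.mem_sdiff.1 hA).1).1) i (fun T => deg G T ^ 2)
    have h2 : ∑ T ∈ X.powersetCard i, deg G T ^ 2 * (C - deg G T) =
        ∑ T ∈ X.powersetCard i, deg G T ^ 2 * deg (X.powersetCard k \ G) T := by
      refine Finset.sum_congr rfl fun T hT => ?_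
      have h3 := deg_sdiff hG T
      obtain ⟨hT1, hT2⟩ := Finset.mem_powersetCard.1 hT
      rw [deg_all hT1, hT2] at h3
      rw [hC, hn, h3]; ring
    rw [h2, ← h1]
    refine Finset.sum_le_sum fun A _ => ?_
    unfold cs
    exact Finset.sum_sq_le_sq_sum_of_nonneg (fun T _ => deg_nonneg _ _)
  have hin : 2 * lam * C * PP X i G - lam^2 * C ^ 2 * G.card ≤ ∑ A ∈ G, cs G i A ^ 2 := by
    have h1 := sum_sum_powersetCard hsub i (fun T => deg G T)
    have h2 : ∑ A ∈ G, cs G i A = PP X i G := by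
      unfold PP; simp only [sq]; exact h1
    calc _ = ∑ A ∈ G, (2 * lam * C * cs G i A - lam^2 * C^2) := by
          rw [Finset.sum_sub_distrib, ← Finset.mul_sum, h2]; simp; ring
      _ ≤ _ := Finset.sum_le_sum fun A _ => by nlinarith [sq_nonneg (cs G i A - lam * C)]
  have hsplit := Finset.sum_sdiff (f := fun A => cs G i A ^ 2) hG
  have hP := PP_nonneg X i G
  have hg0 : (0:ℝ) ≤ G.card := by positivity
  have hyg : y * (G.card:ℝ)^2 ≤ (73/5184) * (G.card * C) := by
    have h1 : y * (r + 1/72) ≤ 73/5184 := by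
      have : y ≤ 1/72 := by nlinarith
      nlinarith
    calc y * (G.card:ℝ)^2 = y * G.card * G.card := by ring
      _ ≤ y * ((r + 1/72) * C) * G.card := by gcongr
      _ = (y * (r+1/72)) * (G.card * C) := by ring
      _ ≤ _ := by gcongr
  have h3 : (72/71) * y * (G.card:ℝ)^2 + (1/71) * PP X i G ≤ 1/60 * (G.card * C + PP X i G) := by
    have : 0 ≤ (G.card:ℝ) * C := by positivity
    nlinarith
  have h4 := mul_le_mul_of_nonneg_left h3 hC0
  nlinarith
end SI

namespace SI

lemma choose_ge (i d : ℕ) (hi : 1 ≤ i) : d + 1 ≤ (i + d).choose i := by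
  induction d with
  | zero => simp
  | succ d ih =>
    obtain ⟨j, rfl⟩ : ∃ j, i = j + 1 := ⟨i - 1, by omega⟩
    rw [← add_assoc, Nat.choose_succ_succ']
    have : 1 ≤ (j + 1 + d).choose j := Nat.choose_pos (by omega)
    omega

lemma inter_bd {t i : ℕ} (hi : 1 ≤ i) :
    (t:ℝ) + (if t + 1 < i then 1 else 0) ≤ ((i:ℝ) - 1) + (t.choose i : ℝ) := by
  have h : t + (if t + 1 < i then 1 else 0) + 1 ≤ i + t.choose i := by
    split_ifs with h
    · omega
    · rcases lt_or_ge t i with h1 | h1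
      · omega
      · have := choose_ge i (t - i) hi
        rw [show i + (t - i) = t by omega] at this
        omega
  have h2 : ((t + (if t + 1 < i then 1 else 0) + 1 : ℕ) : ℝ) ≤ ((i + t.choose i : ℕ) : ℝ) := by
    exact_mod_cast h
  push_cast at h2
  linarith

/-- number of ordered pairs with small intersection -/
noncomputable def badp (i : ℕ) (H : Finset (Finset ℕ)) : ℝ :=
  (((H ×ˢ H).filter (fun p => (p.1 ∩ p.2).card + 1 < i)).card : ℝ)

lemma ip_le_PP {X : Finset ℕ} {i : ℕ} (hi : 1 ≤ i) {H : Finset (Finset ℕ)} (hH : ∀ A ∈ H, A ⊆ X) :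
    ip H H + badp i H ≤ ((i:ℝ) - 1) * (H.card:ℝ)^2 + PP X i H := by
  have h1 : badp i H = ∑ A ∈ H, ∑ B ∈ H, (if (A ∩ B).card + 1 < i then (1:ℝ) else 0) := by
    unfold badp
    rw [Finset.card_filter, ← Finset.sum_product']; push_cast; rfl
  rw [h1, PP_eq hH]
  unfold ip wt
  rw [← Finset.sum_add_distrib]
  simp only [← Finset.sum_add_distrib]
  calc _ ≤ ∑ A ∈ H, ∑ B ∈ H, (((i:ℝ) - 1) + ((A ∩ B).card.choose i : ℝ)) :=
        Finset.sum_le_sum fun A _ => Finset.sum_le_sum fun B _ => inter_bd hi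
    _ = _ := by
      simp only [Finset.sum_add_distrib, Finset.sum_const, nsmul_eq_mul]; ring

lemma badp_nonneg (i H) : 0 ≤ badp i H := by unfold badp; positivity

lemma ip_le_PP' {X : Finset ℕ} {i : ℕ} (hi : 1 ≤ i) {H : Finset (Finset ℕ)} (hH : ∀ A ∈ H, A ⊆ X) :
    ip H H ≤ ((i:ℝ) - 1) * (H.card:ℝ)^2 + PP X i H := by
  have := ip_le_PP hi hH; have := badp_nonneg i H; linarith

open Classical in
/-- heavy i-sets -/
noncomputable def TT (X : Finset ℕ) (k i : ℕ) (H : Finset (Finset ℕ)) : Finset (Finset ℕ) :=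
  (X.powersetCard i).filter (fun T => (7/10) * CC X.card k i ≤ deg H T)

/-- sets of H containing no heavy set -/
noncomputable def OO (X : Finset ℕ) (k i : ℕ) (H : Finset (Finset ℕ)) : Finset (Finset ℕ) :=
  H.filter (fun A => ∀ T ∈ TT X k i H, ¬ T ⊆ A)

/-- sets of H containing a heavy set -/
noncomputable def NN (X : Finset ℕ) (k i : ℕ) (H : Finset (Finset ℕ)) : Finset (Finset ℕ) :=
  H \ OO X k i H

structure STH (X : Finset ℕ) (k r i q : ℕ) (H : Finset (Finset ℕ)) : Prop where
  N : Num X.card k r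
  hi : 1 ≤ i
  hir : i ≤ r
  hik : i ≤ k
  hq : 1 ≤ q
  hqr : q ≤ r
  hH : H ⊆ X.powersetCard k
  hρ : (H.card:ℝ) ≤ (q + 1/72) * CC X.card k i
  hS : ((i:ℝ) - 1) * (H.card:ℝ)^2 + (q - 1/36) * CC X.card k i ^ 2 ≤ ip H H

lemma mem_TT {X k i H T} : T ∈ TT X k i H ↔ (T ⊆ X ∧ T.card = i) ∧ (7/10) * CC X.card k i ≤ deg H T := by
  unfold TT; rw [Finset.mem_filter, Finset.mem_powersetCard]

lemma mem_NN {X k i H A} : A ∈ NN X k i H ↔ A ∈ H ∧ ∃ T ∈ TT X k i H, T ⊆ A := by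
  unfold NN OO
  simp only [Finset.mem_sdiff, Finset.mem_filter, not_and, not_forall, not_not]
  constructor
  · rintro ⟨h1, h2⟩
    obtain ⟨T, hT, h⟩ := h2 h1
    exact ⟨h1, T, hT, h⟩
  · rintro ⟨h1, T, hT, h⟩
    exact ⟨h1, fun _ => ⟨T, hT, h⟩⟩

lemma mem_OO {X k i H A} : A ∈ OO X k i H ↔ A ∈ H ∧ ∀ T ∈ TT X k i H, ¬ T ⊆ A := by
  unfold OO; rw [Finset.mem_filter]

lemma OO_sub {X k i H} : OO X k i H ⊆ H := Finset.filter_subset _ _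
lemma NN_sub {X k i H} : NN X k i H ⊆ H := Finset.sdiff_subset

namespace STH
variable {X : Finset ℕ} {k r i q : ℕ} {H : Finset (Finset ℕ)}

lemma Cpos (h : STH X k r i q H) : 0 < CC X.card k i := CC_pos h.hik h.N.kn'

lemma sub (h : STH X k r i q H) : ∀ A ∈ H, A ⊆ X := fun _ hA => (Finset.mem_powersetCard.1 (h.hH hA)).1
lemma crd (h : STH X k r i q H) : ∀ A ∈ H, A.card = k := fun _ hA => (Finset.mem_powersetCard.1 (h.hH hA)).2

lemma qR (h : STH X k r i q H) : (1:ℝ) ≤ q := by exact_mod_cast h.hq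
lemma qrR (h : STH X k r i q H) : (q:ℝ) ≤ r := by exact_mod_cast h.hqr
lemma kR (h : STH X k r i q H) : (1:ℝ) ≤ k := by exact_mod_cast h.N.hk
lemma rR (h : STH X k r i q H) : (1:ℝ) ≤ r := by exact_mod_cast h.N.hr

lemma krb (h : STH X k r i q H) : 144 * (k * r * CC X.card k (i+1)) ≤ CC X.card k i := by
  have h1 := h.N.step i
  have h2 := h.kR; have h3 := h.rR
  have h4 := CC_nonneg X.card k (i+1)
  have h5 : (2:ℝ) * (k * r * CC X.card k (i+1)) ≤ (k + r) * (k * r * CC X.card k (i+1)) := by gcongr; linarith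
  linarith

lemma kr2b (h : STH X k r i q H) : 72 * (k * r^2 * CC X.card k (i+1)) ≤ CC X.card k i := by
  have h1 := h.N.step i
  have h2 := h.kR; have h3 := h.rR
  have h4 := CC_nonneg X.card k (i+1)
  have h5 : (r:ℝ) * (k * r * CC X.card k (i+1)) ≤ (k + r) * (k * r * CC X.card k (i+1)) := by gcongr; linarith
  linarith

lemma rho_le (h : STH X k r i q H) : (H.card:ℝ) ≤ (r + 1/72) * CC X.card k i := by
  have := h.hρ; have := h.qrR; have := h.Cpos; nlinarith

lemma degle (h : STH X k r i q H) {T} (hT : T.card = i) : deg H T ≤ CC X.card k i := by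
  have := deg_le_CC h.hH T; rwa [hT] at this

lemma Ple (h : STH X k r i q H) : PP X i H ≤ (61/59) * (H.card * CC X.card k i) := by
  have hC := h.Cpos
  have h1 := UB h.N h.hi h.hir h.hH h.rho_le 1
  have h2 : 0 ≤ ∑ T ∈ X.powersetCard i, deg H T ^ 2 * (CC X.card k i - deg H T) :=
    Finset.sum_nonneg fun T hT => mul_nonneg (sq_nonneg _)
      (by have := h.degle (Finset.mem_powersetCard.1 hT).2; linarith)
  have h3 : CC X.card k i * PP X i H ≤ CC X.card k i * ((61/59) * (H.card * CC X.card k i)) := by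
    nlinarith
  exact le_of_mul_le_mul_left h3 hC

lemma Pge (h : STH X k r i q H) : (q - 1/36) * CC X.card k i ^ 2 ≤ PP X i H := by
  have h1 := ip_le_PP' h.hi h.sub; have := h.hS; linarith

lemma bad_le (h : STH X k r i q H) : badp i H ≤ (2/59 * q + 0.0422) * CC X.card k i ^ 2 := by
  have h1 := ip_le_PP h.hi h.sub; have h2 := h.hS; have h3 := h.Ple; have h4 := h.hρ; have h5 := h.Cpos
  nlinarith

lemma Q_le (h : STH X k r i q H) :
    ∑ T ∈ (X.powersetCard i) \ TT X k i H, deg H T ^ 2 ≤ (q/9 + 0.139) * CC X.card k i ^ 2 := by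
  have hC := h.Cpos
  have h1 := UB h.N h.hi h.hir h.hH h.rho_le 1
  have hsub : TT X k i H ⊆ X.powersetCard i := by unfold TT; exact Finset.filter_subset _ _
  have h2 : (3/10) * CC X.card k i * ∑ T ∈ (X.powersetCard i) \ TT X k i H, deg H T ^ 2 ≤
      ∑ T ∈ X.powersetCard i, deg H T ^ 2 * (CC X.card k i - deg H T) := by
    rw [← Finset.sum_sdiff hsub, Finset.mul_sum]
    have h3 : 0 ≤ ∑ T ∈ TT X k i H, deg H T ^ 2 * (CC X.card k i - deg H T) :=
      Finset.sum_nonneg fun T hT => mul_nonneg (sq_nonneg _)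
        (by have := h.degle (mem_TT.1 hT).1.2; linarith)
    have h4 : ∑ T ∈ (X.powersetCard i) \ TT X k i H, (3/10) * CC X.card k i * deg H T ^ 2 ≤
        ∑ T ∈ (X.powersetCard i) \ TT X k i H, deg H T ^ 2 * (CC X.card k i - deg H T) := by
      refine Finset.sum_le_sum fun T hT => ?_
      rw [Finset.mem_sdiff, mem_TT, Finset.mem_powersetCard] at hT
      have : deg H T < (7/10) * CC X.card k i := by
        by_contra hc; push Not at hc; exact hT.2 ⟨hT.1, hc⟩
      nlinarith [sq_nonneg (deg H T)]
    linarith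
  have h5 := h.Pge; have h6 := h.hρ
  have h7 : CC X.card k i * ∑ T ∈ (X.powersetCard i) \ TT X k i H, deg H T ^ 2 ≤
      CC X.card k i * ((q/9 + 0.139) * CC X.card k i ^ 2) := by
    have h8 : CC X.card k i * CC X.card k i * H.card ≤ CC X.card k i * CC X.card k i * ((q + 1/72) * CC X.card k i) := by gcongr
    have h9 : CC X.card k i * ((q - 1/36) * CC X.card k i ^ 2) ≤ CC X.card k i * PP X i H := by gcongr
    have h10 : 0 < CC X.card k i ^ 3 := by positivity
    nlinarith
  exact le_of_mul_le_mul_left h7 hC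

lemma TT_sub : TT X k i H ⊆ X.powersetCard i := by unfold TT; exact Finset.filter_subset _ _

lemma P_split : PP X i H = ∑ T ∈ (X.powersetCard i) \ TT X k i H, deg H T ^ 2 + ∑ T ∈ TT X k i H, deg H T ^ 2 := by
  unfold PP; rw [Finset.sum_sdiff TT_sub]

lemma s_ge (h : STH X k r i q H) : 8/9 * (q:ℝ) - 0.167 ≤ (TT X k i H).card := by
  have hC := h.Cpos
  have h1 := h.Pge; have h2 := h.Q_le
  rw [P_split (k := k)] at h1
  have h3 : ∑ T ∈ TT X k i H, deg H T ^ 2 ≤ (TT X k i H).card * CC X.card k i ^ 2 := by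
    calc _ ≤ ∑ T ∈ TT X k i H, CC X.card k i ^ 2 := Finset.sum_le_sum fun T hT => by
          have := h.degle (mem_TT.1 hT).1.2; have := deg_nonneg H T; gcongr
      _ = _ := by simp
  have h4 : 0 < CC X.card k i ^ 2 := by positivity
  have h5 : (8/9 * (q:ℝ) - 0.167) * CC X.card k i ^ 2 ≤ (TT X k i H).card * CC X.card k i ^ 2 := by nlinarith
  exact le_of_mul_le_mul_right h5 h4

lemma s_le (h : STH X k r i q H) : ((TT X k i H).card:ℝ) ≤ 2.2 * q := by
  have hC := h.Cpos
  have h1 := h.Ple; have h2 := h.hρ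
  rw [P_split (k := k)] at h1
  have h3 : (TT X k i H).card * (0.49 * CC X.card k i ^ 2) ≤ ∑ T ∈ TT X k i H, deg H T ^ 2 := by
    calc _ = ∑ T ∈ TT X k i H, (0.49 * CC X.card k i ^ 2) := by simp
      _ ≤ _ := Finset.sum_le_sum fun T hT => by
          have := (mem_TT.1 hT).2; nlinarith
  have h0 : 0 ≤ ∑ T ∈ (X.powersetCard i) \ TT X k i H, deg H T ^ 2 := Finset.sum_nonneg fun _ _ => sq_nonneg _
  have h4 : 0 < CC X.card k i ^ 2 := by positivity
  have hq := h.qR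
  have h5 : ((TT X k i H).card:ℝ) * CC X.card k i ^ 2 ≤ (2.2 * q) * CC X.card k i ^ 2 := by nlinarith
  exact le_of_mul_le_mul_right h5 h4

lemma sb (h : STH X k r i q H) : ((TT X k i H).card:ℝ) * k * CC X.card k (i+1) ≤ CC X.card k i * (2.2/144) := by
  have h1 := h.krb; have h2 := h.s_le; have h3 := h.qrR; have h4 := CC_nonneg X.card k (i+1)
  have h5 := h.kR
  calc _ ≤ (2.2 * r) * k * CC X.card k (i+1) := by gcongr; linarith
    _ ≤ _ := by nlinarith

end STH
end SI

namespace SI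

/-- members of H whose only heavy subset is T -/
noncomputable def HT (X : Finset ℕ) (k i : ℕ) (H : Finset (Finset ℕ)) (T : Finset ℕ) : Finset (Finset ℕ) :=
  H.filter (fun A => T ⊆ A ∧ ∀ T' ∈ TT X k i H, T' ⊆ A → T' = T)

noncomputable def BT (X : Finset ℕ) (k i : ℕ) (H : Finset (Finset ℕ)) : Finset (Finset ℕ × Finset ℕ) :=
  (TT X k i H ×ˢ TT X k i H).filter (fun p => (p.1 ∩ p.2).card + 1 < i)

lemma deg_big {X : Finset ℕ} {k i : ℕ} {G : Finset (Finset ℕ)} (hG : G ⊆ X.powersetCard k) (hk : k ≤ X.card)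
    {T : Finset ℕ} (h : i ≤ T.card) : deg G T ≤ CC X.card k i :=
  (deg_le_CC hG T).trans (CC_anti hk h)

lemma card_union_ge {T T' : Finset ℕ} {i : ℕ} (h : T.card = i) (h' : T'.card = i) (hne : T ≠ T') :
    i + 1 ≤ (T ∪ T').card := by
  by_contra hc
  have h1 : T = T ∪ T' := Finset.eq_of_subset_of_card_le Finset.subset_union_left (by omega)
  have h2 : T' = T ∪ T' := Finset.eq_of_subset_of_card_le Finset.subset_union_right (by omega)
  exact hne (h1.trans h2.symm)

namespace STH
variable {X : Finset ℕ} {k r i q : ℕ} {H : Finset (Finset ℕ)}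

lemma HT_card (h : STH X k r i q H) {T} (hT : T ∈ TT X k i H) :
    0.684 * CC X.card k i ≤ (HT X k i H T).card := by
  have h1 := (mem_TT.1 hT)
  have hsb := h.sb; have hk := h.kR; have hb := CC_nonneg X.card k (i+1)
  have h2 : deg H T ≤ (HT X k i H T).card + ∑ T' ∈ (TT X k i H).erase T, deg H (T ∪ T') := by
    unfold deg
    have : H.filter (T ⊆ ·) ⊆ HT X k i H T ∪ ((TT X k i H).erase T).biUnion (fun T' => H.filter (T ∪ T' ⊆ ·)) := by
      intro A hA
      rw [Finset.mem_filter] at hA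
      by_cases hc : ∀ T' ∈ TT X k i H, T' ⊆ A → T' = T
      · exact Finset.mem_union_left _ (Finset.mem_filter.2 ⟨hA.1, hA.2, hc⟩)
      · push Not at hc
        obtain ⟨T', hT', hs, hne⟩ := hc
        refine Finset.mem_union_right _ (Finset.mem_biUnion.2 ⟨T', Finset.mem_erase.2 ⟨hne, hT'⟩, ?_⟩)
        exact Finset.mem_filter.2 ⟨hA.1, Finset.union_subset hA.2 hs⟩
    have h3 := (Finset.card_le_card this).trans ((Finset.card_union_le _ _).trans (Nat.add_le_add_left Finset.card_biUnion_le _))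
    exact_mod_cast h3
  have h3 : ∑ T' ∈ (TT X k i H).erase T, deg H (T ∪ T') ≤ (TT X k i H).card * CC X.card k (i+1) := by
    calc _ ≤ ∑ T' ∈ (TT X k i H).erase T, CC X.card k (i+1) := Finset.sum_le_sum fun T' hT' => by
          rw [Finset.mem_erase] at hT'
          exact deg_big h.hH h.N.kn' (card_union_ge h1.1.2 (mem_TT.1 hT'.2).1.2 (Ne.symm hT'.1))
      _ ≤ _ := by
          rw [Finset.sum_const, nsmul_eq_mul]; gcongr; exact Finset.erase_subset _ _
  have h4 : ((TT X k i H).card:ℝ) * CC X.card k (i+1) ≤ ((TT X k i H).card:ℝ) * k * CC X.card k (i+1) := by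
    have : (0:ℝ) ≤ (TT X k i H).card := by positivity
    nlinarith [mul_nonneg this hb]
  have := h.Cpos
  nlinarith [h1.2]

lemma HT_le (h : STH X k r i q H) {T} (hT : T ∈ TT X k i H) : ((HT X k i H T).card:ℝ) ≤ CC X.card k i := by
  refine le_trans ?_ (h.degle (mem_TT.1 hT).1.2)
  unfold deg HT
  refine Nat.cast_le.2 (Finset.card_le_card ?_)
  intro A hA
  rw [Finset.mem_filter] at hA ⊢
  exact ⟨hA.1, hA.2.1⟩

lemma card_le_sum_insert (h : STH X k r i q H) {T S : Finset ℕ} (hT : T.card = i) (G : Finset (Finset ℕ)) (hG : G ⊆ H)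
    (hx : ∀ A ∈ G, T ⊆ A ∧ ∃ x ∈ S, x ∉ T ∧ x ∈ A) : (G.card:ℝ) ≤ S.card * CC X.card k (i+1) := by
  have : G ⊆ (S.filter (· ∉ T)).biUnion (fun x => H.filter (insert x T ⊆ ·)) := by
    intro A hA
    obtain ⟨h1, x, hxS, hxT, hxA⟩ := hx A hA
    refine Finset.mem_biUnion.2 ⟨x, Finset.mem_filter.2 ⟨hxS, hxT⟩, Finset.mem_filter.2 ⟨hG hA, ?_⟩⟩
    exact Finset.insert_subset hxA h1
  have h2 : (G.card:ℝ) ≤ ∑ x ∈ S.filter (· ∉ T), deg H (insert x T) := by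
    unfold deg
    exact_mod_cast (Finset.card_le_card this).trans Finset.card_biUnion_le
  refine h2.trans ?_
  calc _ ≤ ∑ x ∈ S.filter (· ∉ T), CC X.card k (i+1) := Finset.sum_le_sum fun x hx => by
        apply deg_big h.hH h.N.kn'
        rw [Finset.card_insert_of_notMem (Finset.mem_filter.1 hx).2, hT]
    _ ≤ _ := by
      rw [Finset.sum_const, nsmul_eq_mul]
      have := CC_nonneg X.card k (i+1)
      gcongr; exact Finset.filter_subset _ _

lemma bad_pair (h : STH X k r i q H) {T T'} (hT : T ∈ TT X k i H) (hT' : T' ∈ TT X k i H)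
    (hb : (T ∩ T').card + 1 < i) :
    0.45 * CC X.card k i ^ 2 ≤
      (((HT X k i H T ×ˢ HT X k i H T').filter (fun p => (p.1 ∩ p.2).card + 1 < i)).card : ℝ) := by
  have hC := h.Cpos
  set A1 := HT X k i H T
  set A2 := HT X k i H T'
  have c1 := h.HT_card hT; have c2 := h.HT_card hT'; have d1 := h.HT_le hT; have d2 := h.HT_le hT'
  set b := CC X.card k (i+1)
  have hb0 : 0 ≤ b := CC_nonneg _ _ _
  -- complement
  have hcomp : (A1 ×ˢ A2).filter (fun p => ¬ (p.1 ∩ p.2).card + 1 < i) ⊆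
      (A1.biUnion (fun A => (A2.filter (fun B => ∃ x ∈ A, x ∉ T' ∧ x ∈ B)).image (fun B => (A, B)))) ∪
      (A1.filter (fun A => ∃ x ∈ T', x ∉ T ∧ x ∈ A)) ×ˢ A2 := by
    rintro ⟨A, B⟩ hp
    simp only [Finset.mem_filter, Finset.mem_product] at hp
    obtain ⟨⟨hA, hB⟩, hp⟩ := hp
    have : ¬ A ∩ B ⊆ T ∩ T' := fun hs => by have := Finset.card_le_card hs; omega
    rw [Finset.not_subset] at this
    obtain ⟨x, hx, hxn⟩ := this
    rw [Finset.mem_inter] at hx hxn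
    by_cases hxT : x ∈ T'
    · apply Finset.mem_union_right
      exact Finset.mem_product.2 ⟨Finset.mem_filter.2 ⟨hA, x, hxT, fun hh => hxn ⟨hh, hxT⟩, hx.1⟩, hB⟩
    · apply Finset.mem_union_left
      refine Finset.mem_biUnion.2 ⟨A, hA, Finset.mem_image.2 ⟨B, Finset.mem_filter.2 ⟨hB, x, hx.1, hxT, hx.2⟩, rfl⟩⟩
  have hAH : A1 ⊆ H := Finset.filter_subset _ _
  have hBH : A2 ⊆ H := Finset.filter_subset _ _
  have e1 : ((A1.biUnion (fun A => (A2.filter (fun B => ∃ x ∈ A, x ∉ T' ∧ x ∈ B)).image (fun B => (A, B)))).card : ℝ) ≤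
      A1.card * (k * b) := by
    calc _ ≤ ∑ A ∈ A1, (((A2.filter (fun B => ∃ x ∈ A, x ∉ T' ∧ x ∈ B)).image (fun B => (A, B))).card : ℝ) := by
          exact_mod_cast Finset.card_biUnion_le
      _ ≤ ∑ A ∈ A1, (k * b) := Finset.sum_le_sum fun A hA => by
          have h1 : (((A2.filter (fun B => ∃ x ∈ A, x ∉ T' ∧ x ∈ B)).image (fun B => (A, B))).card : ℝ) ≤
            ((A2.filter (fun B => ∃ x ∈ A, x ∉ T' ∧ x ∈ B)).card : ℝ) := by exact_mod_cast Finset.card_image_le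
          refine h1.trans ?_
          rw [← h.crd A (hAH hA)]
          exact h.card_le_sum_insert (mem_TT.1 hT').1.2 _ ((Finset.filter_subset _ _).trans hBH)
            (fun B hB => ⟨(Finset.mem_filter.1 (Finset.mem_filter.1 hB).1).2.1, (Finset.mem_filter.1 hB).2⟩)
      _ = _ := by simp
  have e2 : (((A1.filter (fun A => ∃ x ∈ T', x ∉ T ∧ x ∈ A)) ×ˢ A2).card : ℝ) ≤ k * b * A2.card := by
    rw [Finset.card_product]; push_cast
    gcongr
    have := h.card_le_sum_insert (S := T') (mem_TT.1 hT).1.2 (A1.filter (fun A => ∃ x ∈ T', x ∉ T ∧ x ∈ A))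
      ((Finset.filter_subset _ _).trans hAH)
      (fun B hB => ⟨(Finset.mem_filter.1 (Finset.mem_filter.1 hB).1).2.1, (Finset.mem_filter.1 hB).2⟩)
    rw [(mem_TT.1 hT').1.2] at this
    refine this.trans ?_
    have : (i:ℝ) ≤ k := by exact_mod_cast h.hik
    gcongr
  have e3 := (Finset.card_le_card hcomp).trans (Finset.card_union_le _ _)
  have e4 := Finset.card_filter_add_card_filter_not (s := A1 ×ˢ A2) (fun p => (p.1 ∩ p.2).card + 1 < i)
  rw [Finset.card_product] at e4
  have e3' : (((A1 ×ˢ A2).filter (fun p => ¬ (p.1 ∩ p.2).card + 1 < i)).card : ℝ) ≤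
    A1.card * (k * b) + k * b * A2.card := by
    refine le_trans (by exact_mod_cast e3) (add_le_add e1 e2)
  have e4' : ((((A1 ×ˢ A2).filter (fun p => (p.1 ∩ p.2).card + 1 < i)).card : ℝ)) +
     (((A1 ×ˢ A2).filter (fun p => ¬ (p.1 ∩ p.2).card + 1 < i)).card : ℝ) = A1.card * A2.card := by exact_mod_cast e4
  have h5 := h.krb
  have hkb : 0 ≤ (k:ℝ) * b := by positivity
  have hr := h.rR
  have h6 : 144 * (k * b) ≤ CC X.card k i := by nlinarith
  have h7 : (A1.card:ℝ) * (k * b) + k * b * A2.card ≤ CC X.card k i * CC X.card k i / 72 := by nlinarith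
  have h8 : (0.684 * CC X.card k i) * (0.684 * CC X.card k i) ≤ A1.card * A2.card := by gcongr
  nlinarith

lemma BT_le (h : STH X k r i q H) : 0.45 * CC X.card k i ^ 2 * (BT X k i H).card ≤ badp i H := by
  have h1 : ∑ p ∈ BT X k i H, 0.45 * CC X.card k i ^ 2 ≤ ∑ p ∈ BT X k i H,
      (((HT X k i H p.1 ×ˢ HT X k i H p.2).filter (fun p => (p.1 ∩ p.2).card + 1 < i)).card : ℝ) := by
    refine Finset.sum_le_sum fun p hp => ?_
    unfold BT at hp
    rw [Finset.mem_filter, Finset.mem_product] at hp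
    exact h.bad_pair hp.1.1 hp.1.2 hp.2
  rw [Finset.sum_const, nsmul_eq_mul, mul_comm] at h1
  refine h1.trans ?_
  unfold badp
  rw [← Nat.cast_sum, ← Finset.card_biUnion]
  · norm_cast
    apply Finset.card_le_card
    intro p hp
    obtain ⟨t, ht, hp⟩ := Finset.mem_biUnion.1 hp
    rw [Finset.mem_filter, Finset.mem_product] at hp ⊢
    exact ⟨⟨Finset.filter_subset _ _ hp.1.1, Finset.filter_subset _ _ hp.1.2⟩, hp.2⟩
  · intro t ht t' ht' hne
    rw [Function.onFun, Finset.disjoint_left]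
    intro p hp hp'
    rw [Finset.mem_filter, Finset.mem_product] at hp hp'
    unfold BT at ht ht'
    simp only [Finset.coe_filter, Finset.mem_product, Set.mem_ofPred_eq] at ht ht'
    apply hne
    have a1 := (Finset.mem_filter.1 hp.1.1).2
    have a2 := (Finset.mem_filter.1 hp.1.2).2
    have a1' := (Finset.mem_filter.1 hp'.1.1).2
    have a2' := (Finset.mem_filter.1 hp'.1.2).2
    exact Prod.ext (a1'.2 _ ht.1.1 a1.1) (a2'.2 _ ht.1.2 a2.1)

lemma BT_le' (h : STH X k r i q H) : ((BT X k i H).card:ℝ) ≤ 0.0754 * q + 0.094 := by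
  have h1 := h.BT_le; have h2 := h.bad_le; have hC := h.Cpos; have hq := h.qR
  have h4 : 0 < CC X.card k i ^ 2 := by positivity
  have : ((BT X k i H).card:ℝ) * CC X.card k i ^ 2 ≤ (0.0754 * q + 0.094) * CC X.card k i ^ 2 := by nlinarith
  exact le_of_mul_le_mul_right this h4

end STH
end SI

namespace SI

lemma adj_card {T0 T1 : Finset ℕ} {i : ℕ} (h0 : T0.card = i) (h1 : T1.card = i) (hne : T0 ≠ T1)
    (h01 : i ≤ (T0 ∩ T1).card + 1) : (T0 ∩ T1).card + 1 = i := by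
  have := card_union_ge h0 h1 hne
  have := Finset.card_union_add_card_inter T0 T1
  omega

lemma adj_two {T0 T1 T : Finset ℕ} {i : ℕ} (h0 : T0.card = i) (h1 : T1.card = i) (hT : T.card = i) (hne : T0 ≠ T1)
    (h01 : i ≤ (T0 ∩ T1).card + 1) (hT0 : i ≤ (T ∩ T0).card + 1) (hT1 : i ≤ (T ∩ T1).card + 1) :
    T0 ∩ T1 ⊆ T ∨ T ⊆ T0 ∪ T1 := by
  by_contra hc
  push Not at hc
  have hz := adj_card h0 h1 hne h01
  have e1 : (T ∩ (T0 ∩ T1)).card < (T0 ∩ T1).card := by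
    apply Finset.card_lt_card
    refine ⟨Finset.inter_subset_right, fun hs => hc.1 (hs.trans Finset.inter_subset_left)⟩
  have e2 : (T ∩ (T0 ∪ T1)).card < T.card := by
    apply Finset.card_lt_card
    refine ⟨Finset.inter_subset_left, fun hs => hc.2 (hs.trans Finset.inter_subset_right)⟩
  have e3 := Finset.card_union_add_card_inter (T ∩ T0) (T ∩ T1)
  rw [← Finset.inter_union_distrib_left, ← Finset.inter_inter_distrib_left] at e3
  omega

lemma adj_three {T0 T1 T2 T : Finset ℕ} {i : ℕ} (h0 : T0.card = i) (h1 : T1.card = i) (h2 : T2.card = i)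
    (hT : T.card = i) (hne : T0 ≠ T1) (hne2 : T0 ≠ T2)
    (h01 : i ≤ (T0 ∩ T1).card + 1) (h02 : i ≤ (T0 ∩ T2).card + 1) (h12 : i ≤ (T1 ∩ T2).card + 1)
    (hT0 : i ≤ (T ∩ T0).card + 1) (hT1 : i ≤ (T ∩ T1).card + 1)
    (hT2 : i ≤ (T ∩ T2).card + 1) (hne3 : T1 ≠ T2) :
    (T0 ∩ T1 ⊆ T2 → T0 ∩ T1 ⊆ T) ∧ (¬ T0 ∩ T1 ⊆ T2 → T ⊆ T0 ∪ T1) := by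
  have z01 := adj_card h0 h1 hne h01
  have z02 := adj_card h0 h2 hne2 h02
  have z12 := adj_card h1 h2 hne3 h12
  constructor
  · intro hz
    have e02 : T0 ∩ T1 = T0 ∩ T2 := Finset.eq_of_subset_of_card_le
      (Finset.subset_inter Finset.inter_subset_left hz) (by omega)
    have e12 : T0 ∩ T1 = T1 ∩ T2 := Finset.eq_of_subset_of_card_le
      (Finset.subset_inter Finset.inter_subset_right hz) (by omega)
    rcases adj_two h0 h1 hT hne h01 hT0 hT1 with h | h
    · exact h
    rcases adj_two h0 h2 hT hne2 h02 hT0 hT2 with h' | h'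
    · rw [e02]; exact h'
    have : T ⊆ T0 := by
      intro x hx
      have a := h hx; have b := h' hx
      rw [Finset.mem_union] at a b
      rcases a with a | a
      · exact a
      rcases b with b | b
      · exact b
      have : x ∈ T1 ∩ T2 := Finset.mem_inter.2 ⟨a, b⟩
      rw [← e12] at this
      exact (Finset.mem_inter.1 this).1
    rw [Finset.eq_of_subset_of_card_le this (by omega)]
    exact Finset.inter_subset_left
  · intro hz
    rcases adj_two h0 h1 hT hne h01 hT0 hT1 with h | h
    · have h2W : T2 ⊆ T0 ∪ T1 := by
        rw [Finset.inter_comm] at h02 h12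
        rcases adj_two h0 h1 h2 hne h01 h02 h12 with h' | h'
        · exact absurd h' hz
        · exact h'
      by_contra hc
      have e2 : (T ∩ (T0 ∪ T1)).card < T.card := by
        apply Finset.card_lt_card
        refine ⟨Finset.inter_subset_left, fun hs => hc (hs.trans Finset.inter_subset_right)⟩
      have e3 : T0 ∩ T1 = T ∩ (T0 ∪ T1) := by
        apply Finset.eq_of_subset_of_card_le
        · exact Finset.subset_inter h (Finset.inter_subset_left.trans Finset.subset_union_left)
        · omega
      have e4 : T ∩ T2 ⊆ (T0 ∩ T1) ∩ T2 := by
        rw [e3]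
        exact Finset.subset_inter (Finset.inter_subset_inter_left h2W) Finset.inter_subset_right
      have e5 : ((T0 ∩ T1) ∩ T2).card < (T0 ∩ T1).card := by
        apply Finset.card_lt_card
        refine ⟨Finset.inter_subset_left, fun hs => hz (hs.trans Finset.inter_subset_right)⟩
      have := Finset.card_le_card e4
      omega
    · exact h

namespace STH
variable {X : Finset ℕ} {k r i q : ℕ} {H : Finset (Finset ℕ)}

lemma mem_BT {T T'} : (T, T') ∈ BT X k i H ↔ (T ∈ TT X k i H ∧ T' ∈ TT X k i H) ∧ (T ∩ T').card + 1 < i := by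
  unfold BT; rw [Finset.mem_filter, Finset.mem_product]

lemma BT_q (h : STH X k r i q H) (hb : (BT X k i H).Nonempty) : 12 ≤ q := by
  have h1 := h.BT_le'
  have h2 : (1:ℝ) ≤ (BT X k i H).card := by exact_mod_cast hb.card_pos
  have : (12:ℝ) ≤ q + 0.1 := by linarith
  by_contra hc
  have : (q:ℝ) ≤ 11 := by exact_mod_cast (by omega)
  linarith

lemma s_pos (h : STH X k r i q H) : 0 < (TT X k i H).card := by
  have h1 := h.s_ge; have := h.qR
  have : (0:ℝ) < (TT X k i H).card := by linarith
  exact_mod_cast this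

lemma structure_thm (h : STH X k r i q H) : (∃ Z : Finset ℕ, Z.card + 1 = i ∧ ∀ T ∈ TT X k i H, Z ⊆ T) ∨
    (3 ≤ (TT X k i H).card ∧ ∃ W : Finset ℕ, W.card = i + 1 ∧ ∀ T ∈ TT X k i H, T ⊆ W) := by
  classical
  have hsp := h.s_pos
  have cd : ∀ T ∈ TT X k i H, T.card = i := fun T hT => (mem_TT.1 hT).1.2
  -- good sets
  set Gd := (TT X k i H).filter (fun T => ∀ T' ∈ TT X k i H, i ≤ (T' ∩ T).card + 1) with hGd
  have hcov : TT X k i H ⊆ Gd ∪ (BT X k i H).image Prod.snd := by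
    intro T hT
    by_cases hg : ∀ T' ∈ TT X k i H, i ≤ (T' ∩ T).card + 1
    · exact Finset.mem_union_left _ (Finset.mem_filter.2 ⟨hT, hg⟩)
    · push Not at hg
      obtain ⟨T', hT', hlt⟩ := hg
      exact Finset.mem_union_right _ (Finset.mem_image.2 ⟨(T', T), mem_BT.2 ⟨⟨hT', hT⟩, hlt⟩, rfl⟩)
  have hcc : (TT X k i H).card ≤ Gd.card + (BT X k i H).card :=
    (Finset.card_le_card hcov).trans ((Finset.card_union_le _ _).trans (Nat.add_le_add_left Finset.card_image_le _))
  by_cases hs : 3 ≤ (TT X k i H).card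
  · have h3 : 3 ≤ Gd.card := by
      rcases (BT X k i H).eq_empty_or_nonempty with he | he
      · rw [he] at hcc; simp at hcc; omega
      · have hq := h.BT_q he
        have h1 := h.BT_le'; have h2 := h.s_ge
        have hq' : (12:ℝ) ≤ q := by exact_mod_cast hq
        have hcc' : ((TT X k i H).card:ℝ) ≤ Gd.card + (BT X k i H).card := by exact_mod_cast hcc
        have : (3:ℝ) ≤ Gd.card := by linarith
        exact_mod_cast this
    obtain ⟨T0, T1, T2, m0, m1, m2, n01, n02, n12⟩ := Finset.two_lt_card_iff.1 h3
    have g : ∀ T ∈ Gd, T ∈ TT X k i H ∧ ∀ T' ∈ TT X k i H, i ≤ (T' ∩ T).card + 1 := fun T hT => Finset.mem_filter.1 hT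
    have g0 := g _ m0; have g1 := g _ m1; have g2 := g _ m2
    have key : ∀ T ∈ TT X k i H, _ := fun T hT => adj_three (cd _ g0.1) (cd _ g1.1) (cd _ g2.1) (cd _ hT) n01 n02
      (g1.2 _ g0.1) (g2.2 _ g0.1) (g2.2 _ g1.1) (g0.2 _ hT) (g1.2 _ hT) (g2.2 _ hT) n12
    have hz := adj_card (cd _ g0.1) (cd _ g1.1) n01 (g1.2 _ g0.1)
    by_cases hc : T0 ∩ T1 ⊆ T2
    · left
      exact ⟨_, hz, fun T hT => (key T hT).1 hc⟩
    · right
      refine ⟨hs, T0 ∪ T1, ?_, fun T hT => (key T hT).2 hc⟩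
      have := Finset.card_union_add_card_inter T0 T1
      have := cd _ g0.1; have := cd _ g1.1
      omega
  · left
    have hBT : BT X k i H = ∅ := by
      by_contra hne
      have hq := h.BT_q (Finset.nonempty_iff_ne_empty.2 hne)
      have h2 := h.s_ge
      have hq' : (12:ℝ) ≤ q := by exact_mod_cast hq
      have : ((TT X k i H).card:ℝ) ≤ 2 := by exact_mod_cast (by omega)
      linarith
    obtain ⟨T0, hT0⟩ := Finset.card_pos.1 hsp
    by_cases hs1 : ∃ T1 ∈ TT X k i H, T1 ≠ T0
    · obtain ⟨T1, hT1, hne⟩ := hs1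
      have h01 : i ≤ (T0 ∩ T1).card + 1 := by
        by_contra hc
        have : (T0, T1) ∈ BT X k i H := mem_BT.2 ⟨⟨hT0, hT1⟩, by omega⟩
        rw [hBT] at this; simp at this
      refine ⟨T0 ∩ T1, adj_card (cd _ hT0) (cd _ hT1) hne.symm h01, ?_⟩
      intro T hT
      by_cases e0 : T = T0
      · rw [e0]; exact Finset.inter_subset_left
      by_cases e1 : T = T1
      · rw [e1]; exact Finset.inter_subset_right
      exfalso
      apply hs
      have : ({T, T0, T1} : Finset (Finset ℕ)) ⊆ TT X k i H := by
        intro t ht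
        simp only [Finset.mem_insert, Finset.mem_singleton] at ht
        rcases ht with rfl | rfl | rfl <;> assumption
      have h3 := Finset.card_le_card this
      rw [Finset.card_insert_of_notMem, Finset.card_insert_of_notMem] at h3
      · simpa using h3
      · simp [hne.symm]
      · simp [e0, e1]
    · push Not at hs1
      obtain ⟨Z, hZ, hc⟩ := Finset.exists_subset_card_eq (s := T0) (n := i - 1) (by have := cd _ hT0; omega)
      refine ⟨Z, by have := h.hi; omega, fun T hT => ?_⟩
      rw [hs1 T hT]; exact hZ

lemma clique (h : STH X k r i q H) {T T'} (hT : T ∈ TT X k i H) (hT' : T' ∈ TT X k i H) :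
    i ≤ (T ∩ T').card + 1 := by
  have h1 := (mem_TT.1 hT).1.2
  have h2 := (mem_TT.1 hT').1.2
  rcases h.structure_thm with ⟨Z, hZ, hc⟩ | ⟨_, W, hW, hc⟩
  · have := Finset.card_le_card (Finset.subset_inter (hc T hT) (hc T' hT')); omega
  · have := Finset.card_le_card (Finset.union_subset (hc T hT) (hc T' hT'))
    have := Finset.card_union_add_card_inter T T'
    omega

end STH
end SI

namespace SI

lemma inter_le_ind {A T : Finset ℕ} {i : ℕ} (_hi : 1 ≤ i) (hT : T.card = i) :
    ((A ∩ T).card : ℝ) ≤ ((i:ℝ) - 1) + (if T ⊆ A then 1 else 0) := by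
  have h1 : (A ∩ T).card ≤ i := hT ▸ Finset.card_le_card Finset.inter_subset_right
  split_ifs with h
  · have : ((A ∩ T).card : ℝ) ≤ i := by exact_mod_cast h1
    linarith
  · have h2 : (A ∩ T).card < T.card := Finset.card_lt_card
      ⟨Finset.inter_subset_right, fun hs => h (hs.trans Finset.inter_subset_left)⟩
    have : ((A ∩ T).card : ℝ) + 1 ≤ i := by exact_mod_cast (by omega)
    linarith

namespace STH
variable {X : Finset ℕ} {k r i q : ℕ} {H : Finset (Finset ℕ)}

lemma wt_tau (h : STH X k r i q H) {N' : Finset (Finset ℕ)} (hN : N' ⊆ H) {τ : Finset ℕ → Finset ℕ}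
    (hτ : ∀ B ∈ N', τ B ∈ TT X k i H ∧ τ B ⊆ B) {A : Finset ℕ} (hA : A.card = k) :
    wt N' A ≤ ∑ B ∈ N', ((A ∩ τ B).card : ℝ) + (TT X k i H).card * k * CC X.card k (i+1) := by
  have h1 : ∀ B ∈ N', ((A ∩ B).card : ℝ) ≤ (A ∩ τ B).card +
      ∑ x ∈ A, ∑ T ∈ TT X k i H, (if x ∉ T ∧ insert x T ⊆ B then (1:ℝ) else 0) := by
    intro B hB
    have h2 : A ∩ B ⊆ (A ∩ τ B) ∪ A.filter (fun x => x ∉ τ B ∧ x ∈ B) := by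
      intro x hx
      rw [Finset.mem_inter] at hx
      by_cases hx' : x ∈ τ B
      · exact Finset.mem_union_left _ (Finset.mem_inter.2 ⟨hx.1, hx'⟩)
      · exact Finset.mem_union_right _ (Finset.mem_filter.2 ⟨hx.1, hx', hx.2⟩)
    have h3 : ((A ∩ B).card : ℝ) ≤ (A ∩ τ B).card + (A.filter (fun x => x ∉ τ B ∧ x ∈ B)).card := by
      exact_mod_cast (Finset.card_le_card h2).trans (Finset.card_union_le _ _)
    refine h3.trans (add_le_add le_rfl ?_)
    rw [Finset.card_filter]; push_cast
    refine Finset.sum_le_sum fun x _ => ?_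
    split_ifs with hc
    · have : (1:ℝ) = (if x ∉ τ B ∧ insert x (τ B) ⊆ B then (1:ℝ) else 0) := by
        rw [if_pos ⟨hc.1, Finset.insert_subset hc.2 (hτ B hB).2⟩]
      refine this.le.trans ?_
      exact Finset.single_le_sum (f := fun T => if x ∉ T ∧ insert x T ⊆ B then (1:ℝ) else 0)
        (fun T _ => by positivity) (hτ B hB).1
    · exact Finset.sum_nonneg fun T _ => by positivity
  unfold wt
  refine (Finset.sum_le_sum h1).trans ?_
  rw [Finset.sum_add_distrib]
  refine add_le_add le_rfl ?_
  rw [Finset.sum_comm]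
  have h4 : ∀ x ∈ A, ∑ B ∈ N', ∑ T ∈ TT X k i H, (if x ∉ T ∧ insert x T ⊆ B then (1:ℝ) else 0) ≤
      (TT X k i H).card * CC X.card k (i+1) := by
    intro x _
    rw [Finset.sum_comm, ← nsmul_eq_mul]
    apply Finset.sum_le_card_nsmul
    intro T hT
    by_cases hx : x ∈ T
    · simp [hx, CC_nonneg]
    · have : ∑ B ∈ N', (if x ∉ T ∧ insert x T ⊆ B then (1:ℝ) else 0) = deg N' (insert x T) := by
        rw [deg_eq_sum]; simp [hx]
      rw [this]
      apply deg_big (hN.trans h.hH) h.N.kn'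
      rw [Finset.card_insert_of_notMem hx, (mem_TT.1 hT).1.2]
  refine (Finset.sum_le_sum h4).trans ?_
  rw [Finset.sum_const, hA, nsmul_eq_mul]
  apply le_of_eq; ring

lemma skb (h : STH X k r i q H) : (TT X k i H).card * k * CC X.card k (i+1) ≤ CC X.card k i / 60 := by
  have := h.sb; have := h.Cpos; linarith

lemma Nskb (h : STH X k r i q H) :
    H.card * ((TT X k i H).card * k * CC X.card k (i+1)) ≤ 0.031 * CC X.card k i ^ 2 := by
  have h1 := h.hρ; have h2 := h.s_le; have h3 := h.kr2b; have hC := h.Cpos; have hq := h.qR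
  have hb := CC_nonneg X.card k (i+1); have hk := h.kR; have hqr := h.qrR
  have e1 : (H.card:ℝ) ≤ 73/72 * q * CC X.card k i := by nlinarith
  calc (H.card:ℝ) * ((TT X k i H).card * k * CC X.card k (i+1))
      ≤ (73/72 * q * CC X.card k i) * ((2.2 * q) * k * CC X.card k (i+1)) := by gcongr
    _ = (73/72 * 2.2) * CC X.card k i * (k * (q * q) * CC X.card k (i+1)) := by ring
    _ ≤ (73/72 * 2.2) * CC X.card k i * (k * r^2 * CC X.card k (i+1)) := by
        gcongr; nlinarith
    _ ≤ (73/72 * 2.2) * CC X.card k i * (CC X.card k i / 72) := by gcongr; linarith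
    _ ≤ _ := by nlinarith

/-- choice of heavy set in each member of N, with preference T0 -/
lemma exists_tau (h : STH X k r i q H) (T0 : Finset ℕ) (hT0 : T0 ∈ TT X k i H) :
    ∃ τ : Finset ℕ → Finset ℕ, (∀ B ∈ NN X k i H, τ B ∈ TT X k i H ∧ τ B ⊆ B) ∧
      ∀ B, T0 ⊆ B → τ B = T0 := by
  classical
  refine ⟨fun B => if T0 ⊆ B then T0 else if hB : ∃ T ∈ TT X k i H, T ⊆ B then hB.choose else ∅, ?_, ?_⟩
  · intro B hB
    have := (mem_NN.1 hB).2
    by_cases h1 : T0 ⊆ B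
    · beta_reduce; rw [if_pos h1]; exact ⟨hT0, h1⟩
    · beta_reduce; rw [if_neg h1, dif_pos this]
      exact this.choose_spec
  · intro B hB
    simp only [hB, if_true]

lemma OO_eq : H \ NN X k i H = OO X k i H := by
  unfold NN; exact Finset.sdiff_sdiff_eq_self OO_sub

lemma card_split : ((NN X k i H).card:ℝ) + (OO X k i H).card = H.card := by
  have := Finset.card_sdiff_add_card_eq_card (OO_sub : OO X k i H ⊆ H)
  exact_mod_cast this

section
variable {τ : Finset ℕ → Finset ℕ}

lemma ipN (h : STH X k r i q H) (hτ : ∀ B ∈ NN X k i H, τ B ∈ TT X k i H ∧ τ B ⊆ B) :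
    ip (NN X k i H) (NN X k i H) ≤ ((i:ℝ)-1) * (NN X k i H).card ^ 2 + ∑ B ∈ NN X k i H, deg H (τ B)
      + 0.031 * CC X.card k i ^ 2 := by
  have h1 : ip (NN X k i H) (NN X k i H) ≤ ∑ A ∈ NN X k i H, (∑ B ∈ NN X k i H, ((A ∩ τ B).card : ℝ) + (TT X k i H).card * k * CC X.card k (i+1)) :=
    Finset.sum_le_sum fun A hA => h.wt_tau NN_sub hτ (h.crd A (NN_sub hA))
  rw [Finset.sum_add_distrib, Finset.sum_comm, Finset.sum_const, nsmul_eq_mul] at h1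
  have h2 : ∑ B ∈ NN X k i H, ∑ A ∈ NN X k i H, ((A ∩ τ B).card : ℝ) ≤
      ∑ B ∈ NN X k i H, (((i:ℝ) - 1) * (NN X k i H).card + deg H (τ B)) := by
    refine Finset.sum_le_sum fun B hB => ?_
    calc _ ≤ ∑ A ∈ NN X k i H, (((i:ℝ) - 1) + (if τ B ⊆ A then 1 else 0)) :=
          Finset.sum_le_sum fun A _ => inter_le_ind h.hi (mem_TT.1 (hτ B hB).1).1.2
      _ = ((i:ℝ) - 1) * (NN X k i H).card + deg (NN X k i H) (τ B) := by
          rw [Finset.sum_add_distrib, deg_eq_sum, Finset.sum_const, nsmul_eq_mul]; ring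
      _ ≤ _ := by have := deg_mono (NN_sub : NN X k i H ⊆ H) (τ B); linarith
  rw [Finset.sum_add_distrib, Finset.sum_const, nsmul_eq_mul] at h2
  have h3 : ((NN X k i H).card:ℝ) * ((TT X k i H).card * k * CC X.card k (i+1)) ≤ H.card * ((TT X k i H).card * k * CC X.card k (i+1)) := by
    have := CC_nonneg X.card k (i+1)
    gcongr; exact NN_sub
  have := h.Nskb
  nlinarith

lemma ipON (h : STH X k r i q H) (hτ : ∀ B ∈ NN X k i H, τ B ∈ TT X k i H ∧ τ B ⊆ B) :
    ip (OO X k i H) (NN X k i H) ≤ ((i:ℝ)-1) * ((OO X k i H).card * (NN X k i H).card)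
      + (OO X k i H).card * (CC X.card k i / 60) := by
  have h1 : ip (OO X k i H) (NN X k i H) ≤ ∑ A ∈ OO X k i H, (((i:ℝ)-1) * (NN X k i H).card + CC X.card k i / 60) := by
    refine Finset.sum_le_sum fun A hA => ?_
    refine (h.wt_tau NN_sub hτ (h.crd A (OO_sub hA))).trans (add_le_add ?_ h.skb)
    rw [mul_comm, ← nsmul_eq_mul]
    apply Finset.sum_le_card_nsmul
    intro B hB
    have h2 := inter_le_ind (A := A) h.hi (mem_TT.1 (hτ B hB).1).1.2
    rw [if_neg ((mem_OO.1 hA).2 _ (hτ B hB).1)] at h2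
    linarith
  rw [Finset.sum_const, nsmul_eq_mul] at h1
  linarith

lemma R_le_NC (h : STH X k r i q H) (hτ : ∀ B ∈ NN X k i H, τ B ∈ TT X k i H ∧ τ B ⊆ B) :
    ∑ B ∈ NN X k i H, deg H (τ B) ≤ (NN X k i H).card * CC X.card k i := by
  rw [← nsmul_eq_mul]
  exact Finset.sum_le_card_nsmul _ _ _ fun B hB => h.degle (mem_TT.1 (hτ B hB).1).1.2

lemma R_le_sq (_h : STH X k r i q H) (hτ : ∀ B ∈ NN X k i H, τ B ∈ TT X k i H ∧ τ B ⊆ B) :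
    ∑ B ∈ NN X k i H, deg H (τ B) ≤ ∑ T ∈ TT X k i H, deg H T ^ 2 := by
  rw [← Finset.sum_fiberwise_of_maps_to (t := TT X k i H) (g := τ) (fun B hB => (hτ B hB).1)]
  refine Finset.sum_le_sum fun T hT => ?_
  have h1 : ∑ B ∈ NN X k i H with τ B = T, deg H (τ B) = ∑ B ∈ NN X k i H with τ B = T, deg H T :=
    Finset.sum_congr rfl fun B hB => by rw [(Finset.mem_filter.1 hB).2]
  rw [h1, Finset.sum_const, nsmul_eq_mul, sq]
  refine mul_le_mul_of_nonneg_right ?_ (deg_nonneg _ _)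
  unfold deg
  refine Nat.cast_le.2 (Finset.card_le_card ?_)
  intro B hB
  rw [Finset.mem_filter] at hB ⊢
  exact ⟨NN_sub hB.1, hB.2 ▸ (hτ B hB.1).2⟩

end

lemma degO_le (h : STH X k r i q H) {T : Finset ℕ} (hT : T ∈ X.powersetCard i) :
    deg (OO X k i H) T ≤ 7/10 * CC X.card k i := by
  by_cases hc : T ∈ TT X k i H
  · have : deg (OO X k i H) T = 0 := by
      unfold deg
      rw [Finset.filter_false_of_mem]; simp
      intro A hA; exact (mem_OO.1 hA).2 T hc
    rw [this]; have := h.Cpos; positivity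
  · rw [mem_TT, ← Finset.mem_powersetCard] at hc
    have h1 : deg H T < 7/10 * CC X.card k i := by
      by_contra hn; push Not at hn; exact hc ⟨hT, hn⟩
    exact (deg_mono OO_sub T).trans h1.le

lemma PO_gen (h : STH X k r i q H) {c : ℝ} (hd : ∀ T ∈ X.powersetCard i, deg (OO X k i H) T ≤ c * CC X.card k i) (lam : ℝ) :
    (2 * lam - c - 1/60) * PP X i (OO X k i H) ≤ (lam^2 + 1/60) * ((OO X k i H).card * CC X.card k i) := by
  have hC := h.Cpos
  have hcard : ((OO X k i H).card:ℝ) ≤ (r + 1/72) * CC X.card k i := by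
    refine le_trans ?_ h.rho_le
    exact_mod_cast Finset.card_le_card OO_sub
  have h1 := UB h.N h.hi h.hir (OO_sub.trans h.hH) hcard lam
  have h2 : (1 - c) * CC X.card k i * PP X i (OO X k i H) ≤
      ∑ T ∈ X.powersetCard i, deg (OO X k i H) T ^ 2 * (CC X.card k i - deg (OO X k i H) T) := by
    unfold PP
    rw [Finset.mul_sum]
    refine Finset.sum_le_sum fun T hT => ?_
    have := hd T hT
    nlinarith [sq_nonneg (deg (OO X k i H) T)]
  have h3 : CC X.card k i * ((2 * lam - c - 1/60) * PP X i (OO X k i H)) ≤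
      CC X.card k i * ((lam^2 + 1/60) * ((OO X k i H).card * CC X.card k i)) := by nlinarith
  exact le_of_mul_le_mul_left h3 hC

lemma total (h : STH X k r i q H) {τ : Finset ℕ → Finset ℕ} (hτ : ∀ B ∈ NN X k i H, τ B ∈ TT X k i H ∧ τ B ⊆ B) :
    (q - 1/36 - 0.031) * CC X.card k i ^ 2 ≤ ∑ B ∈ NN X k i H, deg H (τ B)
      + (OO X k i H).card * CC X.card k i / 30 + PP X i (OO X k i H) := by
  have h1 := ip_sdiff_self (NN_sub : NN X k i H ⊆ H)
  rw [OO_eq] at h1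
  have h2 := h.ipN hτ; have h3 := h.ipON hτ
  have h4 := ip_le_PP' h.hi (fun A hA => h.sub A ((OO_sub : OO X k i H ⊆ H) hA))
  have h5 := h.hS
  rw [← card_split (X := X) (k := k) (i := i)] at h5
  nlinarith

lemma o_le (h : STH X k r i q H) : ((OO X k i H).card:ℝ) ≤ 0.325 * CC X.card k i := by
  obtain ⟨T0, hT0⟩ := Finset.card_pos.1 h.s_pos
  obtain ⟨τ, hτ, _⟩ := h.exists_tau T0 hT0
  have h1 := h.total hτ; have h2 := h.R_le_NC hτ; have h3 := h.PO_gen (fun T hT => h.degO_le hT) 0.74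
  have h4 := card_split (X := X) (k := k) (i := i) (H := H)
  have h5 := h.hρ; have hC := h.Cpos
  have h6 : PP X i (OO X k i H) ≤ 0.74 * ((OO X k i H).card * CC X.card k i) := by
    have : (0:ℝ) ≤ (OO X k i H).card * CC X.card k i := by positivity
    nlinarith
  have h7 : ((NN X k i H).card:ℝ) * CC X.card k i ≤ ((q + 1/72) * CC X.card k i - (OO X k i H).card) * CC X.card k i := by
    gcongr; linarith
  have h8 : (OO X k i H).card * CC X.card k i ≤ 0.325 * CC X.card k i * CC X.card k i := by nlinarith
  exact le_of_mul_le_mul_right h8 hC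

lemma PO_le (h : STH X k r i q H) : PP X i (OO X k i H) ≤ 0.39 * ((OO X k i H).card * CC X.card k i) := by
  have h3 := h.PO_gen (c := 0.325) (fun T _ => (deg_le_card _ T).trans h.o_le) 0.39
  have hC := h.Cpos
  have : (0:ℝ) ≤ (OO X k i H).card * CC X.card k i := by positivity
  nlinarith

lemma o_le' (h : STH X k r i q H) : ((OO X k i H).card:ℝ) ≤ 0.13 * CC X.card k i := by
  obtain ⟨T0, hT0⟩ := Finset.card_pos.1 h.s_pos
  obtain ⟨τ, hτ, _⟩ := h.exists_tau T0 hT0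
  have h1 := h.total hτ; have h2 := h.R_le_NC hτ; have h6 := h.PO_le
  have h4 := card_split (X := X) (k := k) (i := i) (H := H)
  have h5 := h.hρ; have hC := h.Cpos
  have h7 : ((NN X k i H).card:ℝ) * CC X.card k i ≤ ((q + 1/72) * CC X.card k i - (OO X k i H).card) * CC X.card k i := by
    gcongr; linarith
  have h8 : (OO X k i H).card * CC X.card k i ≤ 0.13 * CC X.card k i * CC X.card k i := by nlinarith
  exact le_of_mul_le_mul_right h8 hC

lemma R_ge (h : STH X k r i q H) {τ : Finset ℕ → Finset ℕ} (hτ : ∀ B ∈ NN X k i H, τ B ∈ TT X k i H ∧ τ B ⊆ B) :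
    (q - 0.12) * CC X.card k i ^ 2 ≤ ∑ B ∈ NN X k i H, deg H (τ B) := by
  have h1 := h.total hτ; have h6 := h.PO_le; have h7 := h.o_le'; have hC := h.Cpos
  have h8 : (OO X k i H).card * CC X.card k i ≤ 0.13 * CC X.card k i * CC X.card k i := by gcongr
  nlinarith

lemma N_ge (h : STH X k r i q H) : (q - 0.12) * CC X.card k i ≤ (NN X k i H).card := by
  obtain ⟨T0, hT0⟩ := Finset.card_pos.1 h.s_pos
  obtain ⟨τ, hτ, _⟩ := h.exists_tau T0 hT0
  have h1 := h.R_ge hτ; have h2 := h.R_le_NC hτ; have hC := h.Cpos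
  have h8 : (q - 0.12) * CC X.card k i * CC X.card k i ≤ (NN X k i H).card * CC X.card k i := by nlinarith
  exact le_of_mul_le_mul_right h8 hC

lemma sum_deg_le (h : STH X k r i q H) :
    ∑ T ∈ TT X k i H, deg H T ≤ (NN X k i H).card + (TT X k i H).card ^ 2 * CC X.card k (i+1) := by
  classical
  have h1 : ∀ T ∈ TT X k i H, deg H T = deg (NN X k i H) T := by
    intro T hT
    unfold deg; congr 2
    ext A; simp only [Finset.mem_filter, mem_NN]
    exact ⟨fun hA => ⟨⟨hA.1, T, hT, hA.2⟩, hA.2⟩, fun hA => ⟨hA.1.1, hA.2⟩⟩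
  rw [Finset.sum_congr rfl h1]
  simp only [deg_eq_sum]
  rw [Finset.sum_comm]
  have h2 : ∀ A ∈ NN X k i H, ∑ T ∈ TT X k i H, (if T ⊆ A then (1:ℝ) else 0) ≤
      1 + ∑ p ∈ (TT X k i H).offDiag, (if p.1 ∪ p.2 ⊆ A then (1:ℝ) else 0) := by
    intro A _
    rw [← Finset.sum_filter, ← Finset.sum_filter]
    simp only [Finset.sum_const, nsmul_eq_mul, mul_one]
    have : ((TT X k i H).filter (· ⊆ A)).offDiag ⊆ (TT X k i H).offDiag.filter (fun p => p.1 ∪ p.2 ⊆ A) := by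
      intro p hp
      simp only [Finset.mem_offDiag, Finset.mem_filter] at hp ⊢
      exact ⟨⟨hp.1.1, hp.2.1.1, hp.2.2⟩, Finset.union_subset hp.1.2 hp.2.1.2⟩
    have h3 := Finset.card_le_card this
    rw [Finset.offDiag_card] at h3
    set t := ((TT X k i H).filter (· ⊆ A)).card
    have h4 : t ≤ 1 + (t * t - t) := by
      rcases t with _ | _ | t
      · simp
      · simp
      · have : (t+1+1)*(t+1+1) ≥ (t+1+1) + (t+1+1) := by nlinarith
        omega
    exact_mod_cast h4.trans (Nat.add_le_add_left h3 1)
  refine (Finset.sum_le_sum h2).trans ?_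
  rw [Finset.sum_add_distrib, Finset.sum_comm]
  refine add_le_add (by simp) ?_
  have h3 : ∀ p ∈ (TT X k i H).offDiag, ∑ A ∈ NN X k i H, (if p.1 ∪ p.2 ⊆ A then (1:ℝ) else 0) ≤ CC X.card k (i+1) := by
    intro p hp
    rw [Finset.mem_offDiag] at hp
    rw [← deg_eq_sum]
    exact deg_big (NN_sub.trans h.hH) h.N.kn' (card_union_ge (mem_TT.1 hp.1).1.2 (mem_TT.1 hp.2.1).1.2 hp.2.2)
  refine (Finset.sum_le_card_nsmul _ _ _ h3).trans ?_
  rw [nsmul_eq_mul, Finset.offDiag_card]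
  have hb := CC_nonneg X.card k (i+1)
  gcongr
  rw [sq]
  exact_mod_cast Nat.sub_le _ _

lemma s_eq (h : STH X k r i q H) : (TT X k i H).card = q := by
  obtain ⟨T0, hT0⟩ := Finset.card_pos.1 h.s_pos
  obtain ⟨τ, hτ, _⟩ := h.exists_tau T0 hT0
  have h1 := h.R_ge hτ; have h2 := h.R_le_sq hτ; have hC := h.Cpos
  have h3 := h.sum_deg_le; have h4 := h.s_le; have h5 := h.kr2b; have hk := h.kR; have hqr := h.qrR; have hq := h.qR
  have hb := CC_nonneg X.card k (i+1)
  have h6 := card_split (X := X) (k := k) (i := i) (H := H)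
  have h7 := h.hρ
  have hC2 : 0 < CC X.card k i ^ 2 := by positivity
  apply le_antisymm
  · have e1 : (TT X k i H).card ^ 2 * CC X.card k (i+1) ≤ 4.84/72 * CC X.card k i := by
      calc _ ≤ (2.2 * q:ℝ)^2 * CC X.card k (i+1) := by gcongr
        _ ≤ (2.2 * r:ℝ)^2 * CC X.card k (i+1) := by gcongr
        _ = 4.84 * (1 * r^2 * CC X.card k (i+1)) := by ring
        _ ≤ 4.84 * (k * r^2 * CC X.card k (i+1)) := by gcongr
        _ ≤ _ := by linarith
    have e2 : ∑ T ∈ TT X k i H, deg H T ^ 2 ≤ ∑ T ∈ TT X k i H, (1.7 * CC X.card k i * deg H T - 0.7 * CC X.card k i ^ 2) := by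
      refine Finset.sum_le_sum fun T hT => ?_
      have a1 := (mem_TT.1 hT).2
      have a2 := h.degle (mem_TT.1 hT).1.2
      nlinarith [mul_nonneg (sub_nonneg.2 a1) (sub_nonneg.2 a2)]
    rw [Finset.sum_sub_distrib, ← Finset.mul_sum, Finset.sum_const, nsmul_eq_mul] at e2
    have ho : (0:ℝ) ≤ (OO X k i H).card := by positivity
    have e3 : ∑ T ∈ TT X k i H, deg H T ≤ (q + 0.0812) * CC X.card k i := by nlinarith
    have e4 : 1.7 * CC X.card k i * ∑ T ∈ TT X k i H, deg H T ≤ 1.7 * CC X.card k i * ((q + 0.0812) * CC X.card k i) := by gcongr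
    have e5 : ((TT X k i H).card:ℝ) * CC X.card k i ^ 2 < (q + 1) * CC X.card k i ^ 2 := by nlinarith
    have e6 := lt_of_mul_lt_mul_right e5 hC2.le
    have : (TT X k i H).card < q + 1 := by exact_mod_cast e6
    omega
  · have e1 : ∑ T ∈ TT X k i H, deg H T ^ 2 ≤ (TT X k i H).card * CC X.card k i ^ 2 := by
      rw [← nsmul_eq_mul]
      apply Finset.sum_le_card_nsmul
      intro T hT
      have := h.degle (mem_TT.1 hT).1.2; have := deg_nonneg H T; gcongr
    have e5 : (q:ℝ) * CC X.card k i ^ 2 < ((TT X k i H).card + 1) * CC X.card k i ^ 2 := by nlinarith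
    have e6 := lt_of_mul_lt_mul_right e5 hC2.le
    have : q < (TT X k i H).card + 1 := by exact_mod_cast e6
    omega

lemma full (h : STH X k r i q H) (ho : (OO X k i H).Nonempty) {T0 B : Finset ℕ} (hT0 : T0 ∈ TT X k i H)
    (hB : T0 ⊆ B) : ∑ A ∈ OO X k i H, wt H A < (OO X k i H).card * wt H B := by
  obtain ⟨τ, hτ, hτ0⟩ := h.exists_tau T0 hT0
  have hC := h.Cpos
  have hTi := (mem_TT.1 hT0).1.2
  have hTd := (mem_TT.1 hT0).2
  have hop : (0:ℝ) < (OO X k i H).card := by exact_mod_cast ho.card_pos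
  set o : ℝ := ((OO X k i H).card : ℝ) with hoo
  set ν : ℝ := ((NN X k i H).card : ℝ) with hν
  set Lam : ℝ := ∑ A ∈ OO X k i H, (((i:ℝ) - 1) - (A ∩ T0).card) with hLam
  have hLam0 : 0 ≤ Lam := Finset.sum_nonneg fun A hA => by
    have h2 := inter_le_ind (A := A) h.hi hTi
    rw [if_neg ((mem_OO.1 hA).2 _ hT0)] at h2
    linarith
  have hsplit : ∀ A, wt H A = wt (NN X k i H) A + wt (OO X k i H) A := fun A => by
    rw [wt_sdiff (NN_sub : NN X k i H ⊆ H), OO_eq]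
  have hdN : deg (NN X k i H) T0 = deg H T0 := by
    unfold deg; congr 2
    ext A; simp only [Finset.mem_filter, mem_NN]
    exact ⟨fun hA => ⟨hA.1.1, hA.2⟩, fun hA => ⟨⟨hA.1, T0, hT0, hA.2⟩, hA.2⟩⟩
  -- lower bound
  have lowN : ((i:ℝ) - 1) * ν + deg H T0 ≤ wt (NN X k i H) B := by
    have : ∀ C' ∈ NN X k i H, ((i:ℝ) - 1) + (if T0 ⊆ C' then 1 else 0) ≤ ((B ∩ C').card : ℝ) := by
      intro C' hC'
      split_ifs with hc
      · have : T0.card ≤ (B ∩ C').card := Finset.card_le_card (Finset.subset_inter hB hc)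
        have : (i:ℝ) ≤ (B ∩ C').card := by exact_mod_cast hTi ▸ this
        linarith
      · have h1 := h.clique hT0 (hτ C' hC').1
        have h2 : (T0 ∩ τ C').card ≤ (B ∩ C').card := Finset.card_le_card (Finset.inter_subset_inter hB (hτ C' hC').2)
        have : (i:ℝ) ≤ (B ∩ C').card + 1 := by exact_mod_cast (by omega)
        linarith
    have h3 := Finset.sum_le_sum this
    rw [Finset.sum_add_distrib, ← deg_eq_sum, hdN, Finset.sum_const, nsmul_eq_mul] at h3
    unfold wt; linarith
  have lowO : ((i:ℝ) - 1) * o - Lam ≤ wt (OO X k i H) B := by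
    rw [hLam, Finset.sum_sub_distrib, Finset.sum_const, nsmul_eq_mul]
    have : ∑ A ∈ OO X k i H, ((A ∩ T0).card : ℝ) ≤ wt (OO X k i H) B := by
      unfold wt
      refine Finset.sum_le_sum fun A _ => ?_
      rw [Finset.inter_comm]
      exact_mod_cast Finset.card_le_card (Finset.inter_subset_inter_right hB)
    linarith
  -- upper bound
  have upN : ∑ A ∈ OO X k i H, wt (NN X k i H) A ≤ ((i:ℝ) - 1) * (o * ν) - Lam * deg H T0 + o * (CC X.card k i / 60) := by
    have h1 : ∀ A ∈ OO X k i H, wt (NN X k i H) A ≤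
        (((i:ℝ) - 1) * ν - (((i:ℝ) - 1) - (A ∩ T0).card) * deg H T0) + CC X.card k i / 60 := by
      intro A hA
      refine (h.wt_tau NN_sub hτ (h.crd A (OO_sub hA))).trans (add_le_add ?_ h.skb)
      have h2 : ∀ C' ∈ NN X k i H, ((A ∩ τ C').card : ℝ) ≤
          ((i:ℝ) - 1) - (((i:ℝ) - 1) - (A ∩ T0).card) * (if T0 ⊆ C' then 1 else 0) := by
        intro C' hC'
        split_ifs with hc
        · rw [hτ0 C' hc]; linarith
        · have h2 := inter_le_ind (A := A) h.hi (mem_TT.1 (hτ C' hC').1).1.2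
          rw [if_neg ((mem_OO.1 hA).2 _ (hτ C' hC').1)] at h2
          linarith
      have h3 := Finset.sum_le_sum h2
      rw [Finset.sum_sub_distrib, ← Finset.mul_sum, ← deg_eq_sum, hdN, Finset.sum_const, nsmul_eq_mul] at h3
      linarith
    have h3 := Finset.sum_le_sum h1
    rw [Finset.sum_add_distrib, Finset.sum_sub_distrib, Finset.sum_const, Finset.sum_const, nsmul_eq_mul, nsmul_eq_mul,
      ← Finset.sum_mul (f := fun A : Finset ℕ => (((i:ℝ) - 1) - ((A ∩ T0).card : ℝ)))] at h3
    rw [← hLam, ← hoo] at h3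
    linarith
  have upO : ∑ A ∈ OO X k i H, wt (OO X k i H) A ≤ ((i:ℝ) - 1) * o^2 + 0.39 * (o * CC X.card k i) := by
    have h4 := ip_le_PP' h.hi (fun A hA => h.sub A ((OO_sub : OO X k i H ⊆ H) hA))
    have := h.PO_le
    unfold ip at h4; linarith
  simp only [hsplit]
  rw [Finset.sum_add_distrib]
  have ho' := h.o_le
  have k1 : o * (((i:ℝ) - 1) * ν + deg H T0 + (((i:ℝ) - 1) * o - Lam)) ≤ o * (wt (NN X k i H) B + wt (OO X k i H) B) := by
    gcongr
  have k2 : o * (7/10 * CC X.card k i) ≤ o * deg H T0 := by gcongr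
  have k3 : o * Lam ≤ deg H T0 * Lam := by gcongr; linarith
  have k4 : 0 < o * CC X.card k i := by positivity
  nlinarith

end STH
end SI

namespace SI

/-- sizes with their extremal value -/
inductive Good : ℕ → ℕ → ℕ → ℕ → ℝ → Prop
  | zero (n k r : ℕ) : Good n k 0 r 0
  | star {n k m r : ℕ} {V : ℝ} (hk : 1 ≤ k) (h : Good n k m r V) :
      Good (n+1) k (cc (n+1) k 1 0 + m) (r+1)
        ((cc (n+1) k 1 0 : ℝ)^2 + n * CC (n+1) k 2 ^ 2 + 2 * (CC (n+1) k 2 * (k * m)) + V)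
  | link {n k m r : ℕ} {V : ℝ} (hm : m < n.choose k) (h : Good n k m r V) :
      Good (n+1) (k+1) m (r+1) ((m:ℝ)^2 + V)

lemma choose_cc {n k : ℕ} (hk : 1 ≤ k) : (n+1).choose k = cc (n+1) k 1 0 + n.choose k := by
  obtain ⟨j, rfl⟩ : ∃ j, k = j + 1 := ⟨k - 1, by omega⟩
  rw [Nat.choose_succ_succ']; simp [cc]

lemma casc (r : ℕ) : ∀ (n k s : ℕ) (f : ℕ → ℕ), (∀ i < s, f i < f (i+1)) → 1 ≤ f 0 → f s ≤ r → f s ≤ n - 1 →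
    s + 1 ≤ k → (∀ i ≤ s, k - i ≤ n - f i) →
    ∃ m V, m + ∑ i ∈ Finset.range (s+1), (n - f i).choose (k - i) = n.choose k ∧ Good n k m r V := by
  induction r with
  | zero =>
    intro n k s f hf h1 hr
    have : ∀ i ≤ s, 1 ≤ f i := by
      intro i hi
      induction i with
      | zero => exact h1
      | succ i ih => have := hf i (by omega); omega
    have := this s le_rfl
    omega
  | succ r ih =>
    intro n k s f hf h1 hr hn hk hc
    have hpos : ∀ i ≤ s, 1 ≤ f i := by
      intro i hi
      induction i with
      | zero => exact h1
      | succ i ih => have := hf i (by omega); omega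
    have hs := hpos s le_rfl
    obtain ⟨N, rfl⟩ : ∃ N, n = N + 1 := ⟨n - 1, by omega⟩
    by_cases h2 : 2 ≤ f 0
    · have hge : ∀ i ≤ s, 2 ≤ f i := by
        intro i hi
        induction i with
        | zero => exact h2
        | succ i ih => have := hf i (by omega); omega
      obtain ⟨m, V, hm, hg⟩ := ih N k s (fun i => f i - 1)
        (fun i hi => by have := hf i hi; have := hge i (by omega); show f i - 1 < f (i+1) - 1; omega) (by show 1 ≤ f 0 - 1; omega)
        (by show f s - 1 ≤ r; omega) (by show f s - 1 ≤ N - 1; omega) hk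
        (fun i hi => by have := hc i hi; have := hge i hi; show k - i ≤ N - (f i - 1); omega)
      refine ⟨_, _, ?_, Good.star (by omega) hg⟩
      rw [choose_cc (by omega), ← hm, add_assoc]
      congr 2
      refine Finset.sum_congr rfl fun i hi => ?_
      have := hge i (by have := Finset.mem_range.1 hi; omega)
      rw [show N + 1 - f i = N - (f i - 1) by omega]
    · have h0 : f 0 = 1 := by omega
      rcases Nat.eq_zero_or_pos s with rfl | hsp
      · refine ⟨_, _, ?_, Good.star (by omega) (Good.zero N k r)⟩
        rw [choose_cc (by omega)]; simp [h0]
      · obtain ⟨t, rfl⟩ : ∃ t, s = t + 1 := ⟨s - 1, by omega⟩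
        obtain ⟨K, rfl⟩ : ∃ K, k = K + 1 := ⟨k - 1, by omega⟩
        have hge : ∀ i ≤ t, 2 ≤ f (i+1) := by
          intro i hi
          have := hf i (by omega); have := hpos i (by omega); omega
        obtain ⟨m, V, hm, hg⟩ := ih N K t (fun i => f (i+1) - 1)
          (fun i hi => by have := hf (i+1) (by omega); have := hge i (by omega); show f (i+1) - 1 < f (i+1+1) - 1; omega)
          (by have := hge 0 (by omega); show 1 ≤ f (0+1) - 1; omega)
          (by show f (t+1) - 1 ≤ r; omega) (by show f (t+1) - 1 ≤ N - 1; omega) (by omega)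
          (fun i hi => by have := hc (i+1) (by omega); have := hge i hi; show K - i ≤ N - (f (i+1) - 1); omega)
        have hlt : m < N.choose K := by
          rw [← hm]
          have : 0 < ∑ i ∈ Finset.range (t+1), (N - (f (i+1) - 1)).choose (K - i) := by
            apply Finset.sum_pos' (fun _ _ => Nat.zero_le _)
            refine ⟨0, by simp, Nat.choose_pos ?_⟩
            have := hc 1 (by omega); have := hge 0 (by omega); simp at *; omega
          omega
        refine ⟨_, _, ?_, Good.link hlt hg⟩
        rw [Finset.sum_range_succ', Nat.choose_succ_succ', ← hm]
        have : ∑ i ∈ Finset.range (t+1), (N + 1 - f (i+1)).choose (K + 1 - (i+1)) =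
            ∑ i ∈ Finset.range (t+1), (N - (f (i+1) - 1)).choose (K - i) := by
          refine Finset.sum_congr rfl fun i hi => ?_
          have := hge i (by have := Finset.mem_range.1 hi; omega)
          rw [show N + 1 - f (i+1) = N - (f (i+1) - 1) by omega, show K + 1 - (i+1) = K - i by omega]
        rw [this, h0]; simp [add_assoc]

lemma good_of_cascade {n k m r : ℕ} (hm : m < n.choose k) (h : CascadeEndLe n k m r) : ∃ V, Good n k m r V := by
  obtain ⟨s, f, h1, h2, h3, h4, h5, h6, h7⟩ := h
  obtain ⟨m', V, hm', hg⟩ := casc r n k s (fun i => if h : i < s + 1 then f ⟨i, h⟩ else 0)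
    (fun i hi => by
      rw [dif_pos (by omega), dif_pos (by omega)]; apply h2; simp [Fin.lt_def])
    (by simpa using h3) (by rw [dif_pos (by omega)]; exact h6) (by rw [dif_pos (by omega)]; exact h4) h1
    (fun i hi => by rw [dif_pos (by omega)]; exact h5 ⟨i, by omega⟩)
  have : ∑ i ∈ Finset.range (s+1), (n - (if h : i < s + 1 then f ⟨i, h⟩ else 0)).choose (k - i) = n.choose k - m := by
    rw [h7, Finset.sum_range]; exact Finset.sum_congr rfl fun i _ => by rw [dif_pos i.2]
  have e : m' = m := by rw [this] at hm'; omega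
  exact ⟨V, e ▸ hg⟩

/-! stars -/

lemma star_deg_self {X : Finset ℕ} {k : ℕ} {x : ℕ} (hx : x ∈ X) : deg (cyl X k {x} ∅) {x} = cc X.card k 1 0 := by
  have h1 := card_cyl (k := k) (I := {x}) (J := ∅) (Finset.singleton_subset_iff.2 hx) (Finset.empty_subset _) (by simp)
  simp only [Finset.card_singleton, Finset.card_empty] at h1
  unfold deg
  rw [Finset.filter_true_of_mem, h1]
  intro A hA; exact (mem_cyl.1 hA).2.1

lemma star_deg_ne {X : Finset ℕ} {k : ℕ} {x y : ℕ} (hx : x ∈ X) (hy : y ∈ X) (hne : y ≠ x) :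
    deg (cyl X k {x} ∅) {y} = CC X.card k 2 := by
  have h1 := card_cyl (k := k) (I := {x, y}) (J := ∅) (by intro z; simp; rintro (rfl | rfl) <;> assumption) (Finset.empty_subset _) (by simp)
  rw [Finset.card_pair hne.symm, Finset.card_empty] at h1
  unfold deg CC
  rw [← h1]
  congr 2
  ext A
  simp only [Finset.mem_filter, mem_cyl, Finset.insert_subset_iff, Finset.singleton_subset_iff]
  tauto

lemma ip_star_self {X : Finset ℕ} {k : ℕ} {x : ℕ} (hx : x ∈ X) :
    ip (cyl X k {x} ∅) (cyl X k {x} ∅) = (cc X.card k 1 0 : ℝ)^2 + (X.card - 1 : ℝ) * CC X.card k 2 ^ 2 := by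
  rw [ip_eq_sum_deg (X := X) (fun A hA => (Finset.mem_powersetCard.1 (cyl_sub hA)).1), ← Finset.add_sum_erase _ _ hx,
    star_deg_self hx]
  have : ∀ y ∈ X.erase x, deg (cyl X k {x} ∅) {y} * deg (cyl X k {x} ∅) {y} = CC X.card k 2 ^ 2 := fun y hy => by
    rw [star_deg_ne hx (Finset.mem_of_mem_erase hy) (Finset.ne_of_mem_erase hy)]; ring
  rw [Finset.sum_congr rfl this, Finset.sum_const, nsmul_eq_mul, Finset.card_erase_of_mem hx]
  have : 1 ≤ X.card := Finset.card_pos.2 ⟨x, hx⟩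
  push_cast [this]; ring

lemma ip_star_union {X : Finset ℕ} {k : ℕ} {x : ℕ} (hx : x ∈ X) {G : Finset (Finset ℕ)}
    (hG : G ⊆ (X.erase x).powersetCard k) :
    ip (cyl X k {x} ∅ ∪ G) (cyl X k {x} ∅ ∪ G) = (cc X.card k 1 0 : ℝ)^2 + (X.card - 1 : ℝ) * CC X.card k 2 ^ 2 +
      2 * (CC X.card k 2 * (k * G.card)) + ip G G := by
  have hd : Disjoint (cyl X k {x} ∅) G := by
    rw [Finset.disjoint_left]
    intro A hA hA'
    have h1 := (mem_cyl.1 hA).2.1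
    have h2 := (Finset.mem_powersetCard.1 (hG hA')).1 (h1 (Finset.mem_singleton_self x))
    simp at h2
  rw [ip_union_self hd, ip_star_self hx]
  have : ip G (cyl X k {x} ∅) = CC X.card k 2 * (k * G.card) := by
    unfold ip
    have : ∀ A ∈ G, wt (cyl X k {x} ∅) A = k * CC X.card k 2 := by
      intro A hA
      have h2 := Finset.mem_powersetCard.1 (hG hA)
      rw [wt_eq_sum_deg]
      have : ∀ y ∈ A, deg (cyl X k {x} ∅) {y} = CC X.card k 2 := fun y hy => by
        have := h2.1 hy
        rw [Finset.mem_erase] at this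
        exact star_deg_ne hx this.2 this.1
      rw [Finset.sum_congr rfl this, Finset.sum_const, h2.2, nsmul_eq_mul]
    rw [Finset.sum_congr rfl this, Finset.sum_const, nsmul_eq_mul]; ring
  rw [this]

/-- link of x -/
def lnk (x : ℕ) (G : Finset (Finset ℕ)) : Finset (Finset ℕ) := G.image (fun A => A.erase x)

lemma lnk_inj {x : ℕ} {G : Finset (Finset ℕ)} (h : ∀ A ∈ G, x ∈ A) : Set.InjOn (fun A : Finset ℕ => A.erase x) G := by
  intro A hA B hB hAB
  have : insert x (A.erase x) = insert x (B.erase x) := by simp only at hAB; rw [hAB]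
  rwa [Finset.insert_erase (h A hA), Finset.insert_erase (h B hB)] at this

lemma lnk_card {x : ℕ} {G : Finset (Finset ℕ)} (h : ∀ A ∈ G, x ∈ A) : (lnk x G).card = G.card :=
  Finset.card_image_of_injOn (lnk_inj h)

lemma lnk_sub {X : Finset ℕ} {k : ℕ} {x : ℕ} {G : Finset (Finset ℕ)} (hG : G ⊆ X.powersetCard (k+1)) (h : ∀ A ∈ G, x ∈ A) :
    lnk x G ⊆ (X.erase x).powersetCard k := by
  intro B hB
  obtain ⟨A, hA, rfl⟩ := Finset.mem_image.1 hB
  have h1 := Finset.mem_powersetCard.1 (hG hA)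
  rw [Finset.mem_powersetCard]
  exact ⟨Finset.erase_subset_erase x h1.1, by rw [Finset.card_erase_of_mem (h A hA), h1.2]; rfl⟩

lemma ip_lnk {x : ℕ} {G : Finset (Finset ℕ)} (h : ∀ A ∈ G, x ∈ A) :
    ip G G = (G.card:ℝ)^2 + ip (lnk x G) (lnk x G) := by
  unfold ip wt lnk
  rw [Finset.sum_image (lnk_inj h)]
  have : ∀ A ∈ G, ∑ B ∈ G, ((A ∩ B).card : ℝ) = G.card + ∑ B ∈ G.image (fun A => A.erase x), ((A.erase x ∩ B).card : ℝ) := by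
    intro A hA
    rw [Finset.sum_image (lnk_inj h)]
    have : ∀ B ∈ G, ((A ∩ B).card : ℝ) = 1 + ((A.erase x ∩ B.erase x).card : ℝ) := by
      intro B hB
      have he : A.erase x ∩ B.erase x = (A ∩ B).erase x := by ext y; simp only [Finset.mem_inter, Finset.mem_erase]; tauto
      rw [he]
      have hx : x ∈ A ∩ B := Finset.mem_inter.2 ⟨h A hA, h B hB⟩
      rw [← Finset.card_erase_add_one hx]; push_cast; ring
    rw [Finset.sum_congr rfl this, Finset.sum_add_distrib]; simp
  rw [Finset.sum_congr rfl this, Finset.sum_add_distrib]; simp [sq]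

/-! lexicographic value -/

lemma lexLT_asymm {A B : Finset ℕ} (h : lexLT A B) : ¬ lexLT B A := by
  unfold lexLT at *; exact lt_asymm h

lemma lexLT_min {X : Finset ℕ} {x : ℕ} (hmin : ∀ y ∈ X, x ≤ y) {A B : Finset ℕ} (hB : B ⊆ X)
    (hxA : x ∈ A) (hxB : x ∉ B) : lexLT A B := by
  unfold lexLT
  have h1 : (A \ B).min ≤ x := Finset.min_le (Finset.mem_sdiff.2 ⟨hxA, hxB⟩)
  refine lt_of_le_of_lt h1 ?_
  rcases (B \ A).eq_empty_or_nonempty with h0 | h0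
  · rw [h0, Finset.min_empty]; exact WithTop.coe_lt_top x
  rw [← Finset.coe_min' h0]
  obtain ⟨b, hbe⟩ : ∃ b, b = (B \ A).min' h0 := ⟨_, rfl⟩
  have hb := (B \ A).min'_mem h0
  rw [← hbe] at hb ⊢
  rw [Finset.mem_sdiff] at hb
  have h2 := hmin b (hB hb.1)
  have : x ≠ b := fun e => hxB (e ▸ hb.1)
  exact WithTop.coe_lt_coe.2 (lt_of_le_of_ne h2 this)

lemma lex_value {n k m r : ℕ} {V : ℝ} (hg : Good n k m r V) : ∀ (X : Finset ℕ) (L : Finset (Finset ℕ)), X.card = n →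
    L ⊆ X.powersetCard k → L.card = m → (∀ A ∈ L, ∀ B ∈ X.powersetCard k, B ∉ L → lexLT A B) → ip L L = V := by
  induction hg with
  | zero n k r =>
    intro X L _ _ hc _
    rw [Finset.card_eq_zero] at hc; subst hc; simp [ip]
  | @star n k m r V hk hg ih =>
    intro X L hX hL hc hlex
    have hne : X.Nonempty := Finset.card_pos.1 (by omega)
    set x := X.min' hne
    have hxX : x ∈ X := X.min'_mem hne
    have hmin : ∀ y ∈ X, x ≤ y := fun y hy => X.min'_le y hy
    have hsc : (cyl X k {x} ∅).card = cc (n+1) k 1 0 := by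
      rw [card_cyl (Finset.singleton_subset_iff.2 hxX) (Finset.empty_subset _) (by simp), hX]; simp
    have hstar : cyl X k {x} ∅ ⊆ L := by
      by_contra hcon
      rw [Finset.not_subset] at hcon
      obtain ⟨A, hA, hAL⟩ := hcon
      have hLs : L ⊆ (cyl X k {x} ∅).erase A := by
        intro B hB
        rw [Finset.mem_erase]
        refine ⟨fun e => hAL (e ▸ hB), ?_⟩
        rw [mem_cyl]
        refine ⟨hL hB, ?_, by simp⟩
        rw [Finset.singleton_subset_iff]
        by_contra hxB
        exact lexLT_asymm (hlex B hB A (cyl_sub hA) hAL) (lexLT_min hmin (Finset.mem_powersetCard.1 (hL hB)).1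
          ((mem_cyl.1 hA).2.1 (Finset.mem_singleton_self x)) hxB)
      have := Finset.card_le_card hLs
      rw [Finset.card_erase_of_mem hA, hsc, hc] at this
      have : 0 < (cyl X k {x} ∅).card := Finset.card_pos.2 ⟨A, hA⟩
      omega
    have hL' : L \ cyl X k {x} ∅ ⊆ (X.erase x).powersetCard k := by
      intro A hA
      rw [Finset.mem_sdiff, mem_cyl] at hA
      have h1 := hL hA.1
      have h2 := Finset.mem_powersetCard.1 h1
      rw [Finset.mem_powersetCard]
      refine ⟨fun y hy => Finset.mem_erase.2 ⟨?_, h2.1 hy⟩, h2.2⟩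
      rintro rfl
      exact hA.2 ⟨h1, Finset.singleton_subset_iff.2 hy, by simp⟩
    have hcard : (L \ cyl X k {x} ∅).card = m := by
      rw [Finset.card_sdiff_of_subset hstar, hc, hsc]; omega
    have := ih (X.erase x) (L \ cyl X k {x} ∅) (by rw [Finset.card_erase_of_mem hxX, hX]; rfl) hL' hcard (by
      intro A hA B hB hBL
      have hxB : x ∉ B := fun hx => by
        have := (Finset.mem_powersetCard.1 hB).1 hx; simp at this
      refine hlex A (Finset.mem_sdiff.1 hA).1 B ?_ ?_
      · exact Finset.powersetCard_mono (Finset.erase_subset _ _) hB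
      · intro h
        apply hBL
        rw [Finset.mem_sdiff, mem_cyl]
        exact ⟨h, fun hh => hxB (hh.2.1 (Finset.mem_singleton_self x))⟩)
    rw [← Finset.union_sdiff_of_subset hstar, ip_star_union hxX hL', this, hcard, hX]
    push_cast; ring
  | @link n k m r V hm hg ih =>
    intro X L hX hL hc hlex
    have hne : X.Nonempty := Finset.card_pos.1 (by omega)
    set x := X.min' hne
    have hxX : x ∈ X := X.min'_mem hne
    have hmin : ∀ y ∈ X, x ≤ y := fun y hy => X.min'_le y hy
    have hsc : (cyl X (k+1) {x} ∅).card = n.choose k := by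
      rw [card_cyl (Finset.singleton_subset_iff.2 hxX) (Finset.empty_subset _) (by simp), hX]; simp [cc]
    have hLx : ∀ A ∈ L, x ∈ A := by
      have : ¬ cyl X (k+1) {x} ∅ ⊆ L := fun h => by
        have := Finset.card_le_card h; omega
      rw [Finset.not_subset] at this
      obtain ⟨A, hA, hAL⟩ := this
      intro B hB
      by_contra hxB
      exact lexLT_asymm (hlex B hB A (cyl_sub hA) hAL) (lexLT_min hmin (Finset.mem_powersetCard.1 (hL hB)).1
          ((mem_cyl.1 hA).2.1 (Finset.mem_singleton_self x)) hxB)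
    have := ih (X.erase x) (lnk x L) (by rw [Finset.card_erase_of_mem hxX, hX]; rfl) (lnk_sub hL hLx)
      (by rw [lnk_card hLx, hc]) (by
      intro A' hA' B' hB' hBL
      obtain ⟨A, hA, rfl⟩ := Finset.mem_image.1 hA'
      have hxB : x ∉ B' := fun hx => by
        have := (Finset.mem_powersetCard.1 hB').1 hx; simp at this
      have hB2 := Finset.mem_powersetCard.1 hB'
      have hl := hlex A hA (insert x B') (by
        rw [Finset.mem_powersetCard]
        refine ⟨Finset.insert_subset hxX (hB2.1.trans (Finset.erase_subset _ _)), ?_⟩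
        rw [Finset.card_insert_of_notMem hxB, hB2.2]) (fun hin => hBL (by
          refine Finset.mem_image.2 ⟨_, hin, ?_⟩
          exact Finset.erase_insert hxB))
      unfold lexLT at *
      have hxA := hLx A hA
      have e1 : A.erase x \ B' = A \ insert x B' := by ext y; simp only [Finset.mem_sdiff, Finset.mem_erase, Finset.mem_insert]; tauto
      have e2 : B' \ A.erase x = insert x B' \ A := by
        ext y; simp only [Finset.mem_sdiff, Finset.mem_erase, Finset.mem_insert]
        by_cases hy : y = x
        · subst hy; simp [hxA, hxB]
        · simp [hy]
      rw [e1, e2]; exact hl)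
    rw [ip_lnk hLx, this, hc]

lemma two_omega {F : Finset (Finset ℕ)} {k : ℕ} (hF : ∀ A ∈ F, A.card = k) : ip F F = 2 * (omegaF F : ℝ) + k * F.card := by
  induction F using Finset.induction_on with
  | empty => simp [ip, omegaF]
  | @insert A F hA ih =>
    have h1 : omegaF (insert A F) = omegaF F + ∑ B ∈ F, (A ∩ B).card := by
      unfold omegaF
      rw [Finset.sym2_insert, Finset.filter_union, Finset.sum_union]
      · rw [add_comm]; congr 1
        rw [Finset.image_insert, Finset.filter_insert, if_neg (by simp)]
        rw [Finset.filter_true_of_mem, Finset.sum_image]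
        · simp
        · intro a _ b _ hab
          have hab2 : a = b ∨ A = b ∧ a = A := by simpa using hab
          rcases hab2 with h | ⟨h, h'⟩
          · exact h
          · exact h'.trans h
        · intro p hp
          obtain ⟨B, hB, rfl⟩ := Finset.mem_image.1 hp
          simp only [Sym2.mk_isDiag_iff]
          rintro rfl; exact hA hB
      · rw [Finset.disjoint_left]
        intro p hp hp'
        rw [Finset.mem_filter] at hp hp'
        obtain ⟨B, hB, rfl⟩ := Finset.mem_image.1 hp.1
        have := hp'.1
        rw [Finset.mk_mem_sym2_iff] at this
        exact hA this.1
    have h2 := ih (fun B hB => hF B (Finset.mem_insert_of_mem hB))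
    have hd : Disjoint F {A} := by simpa using hA
    have h3 : insert A F = F ∪ {A} := by ext; simp [or_comm]
    have h4 : ip (insert A F) (insert A F) = ip F F + 2 * wt F A + k := by
      rw [h3, ip_union_self hd]
      simp [ip, wt, hF A (Finset.mem_insert_self _ _)]
    rw [h4, h1, h2, Finset.card_insert_of_notMem hA]
    unfold wt; push_cast; ring

end SI

namespace SI

lemma cc_shift (n k e j : ℕ) : cc (n+1) (k+1) (e+1) j = cc n k e j := by
  unfold cc
  by_cases h : e ≤ k
  · rw [if_pos (by omega), if_pos h]; congr 1 <;> omega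
  · rw [if_neg (by omega), if_neg h]

lemma cc_n (n k j : ℕ) (i : ℕ) : cc (n+1) k i (j+1) = cc n k i j := by
  unfold cc
  congr 2; omega

lemma cc_mono_n (n k i : ℕ) : cc n k i 0 ≤ cc (n+1) k i 0 := by
  unfold cc
  split_ifs
  · exact Nat.choose_le_choose _ (by omega)
  · exact le_rfl

lemma good_le {n k m r : ℕ} {V : ℝ} (h : Good n k m r V) : m ≤ r * cc n k 1 0 := by
  induction h with
  | zero => simp
  | @star n k m r V hk h ih =>
    have := cc_mono_n n k 1
    calc _ ≤ cc (n+1) k 1 0 + r * cc (n+1) k 1 0 := by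
          have := Nat.mul_le_mul_left r this; omega
      _ = _ := by ring
  | @link n k m r V hm h ih =>
    rw [show cc (n+1) (k+1) 1 0 = n.choose k by simp [cc]]
    nlinarith

lemma good_lt {n k m r : ℕ} {V : ℝ} (h : Good n k m r V) (hm : m < cc n k 1 0) : m ≤ r * cc n k 2 0 := by
  cases h with
  | zero => simp
  | star hk h => omega
  | @link n k m r V hm h =>
    have := good_le h
    rw [show cc (n+1) (k+1) 2 0 = cc n k 1 0 from cc_shift n k 1 0]
    nlinarith

lemma DL {n k m r : ℕ} {V : ℝ} (h : Good n k m r V) (hn : k + r < n) (hm0 : 0 < m) :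
    ∃ e q ρ V', 1 ≤ q ∧ e + q ≤ r ∧ e + 1 ≤ k ∧ m + cc n k e q = cc n k e 0 + ρ ∧
      Good (n - e - q) (k - e) ρ (r - e - q) V' ∧ ρ < cc n k (e+1) q ∧ (1 ≤ e ↔ m < cc n k 1 0) := by
  induction h with
  | zero => omega
  | @star n k m r V hk h ih =>
    have e0 : cc (n+1) k 0 0 = cc (n+1) k 0 1 + cc (n+1) k 1 0 := cc_pascal (by omega)
    rcases Nat.eq_zero_or_pos m with rfl | hm
    · refine ⟨0, 1, 0, 0, le_rfl, by omega, by omega, by omega, Good.zero _ _ _, cc_pos (by omega) (by omega), by omega⟩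
    · obtain ⟨e, q, ρ, V', h1, h2, h3, h4, h5, h6, h7⟩ := ih (by omega) hm
      rcases Nat.eq_zero_or_pos e with rfl | he
      · refine ⟨0, q+1, ρ, V', by omega, by omega, by omega, ?_, ?_, ?_, by omega⟩
        · rw [cc_n] at *; omega
        · convert h5 using 1 <;> omega
        · rw [cc_n]; exact h6
      · refine ⟨0, 1, m, V, by omega, by omega, by omega, ?_, h, ?_, by omega⟩
        · omega
        · rw [cc_n]; exact h7.1 he
  | @link n k m r V hm h ih =>
    obtain ⟨e, q, ρ, V', h1, h2, h3, h4, h5, h6, h7⟩ := ih (by omega) hm0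
    refine ⟨e+1, q, ρ, V', h1, by omega, by omega, ?_, ?_, ?_, ?_⟩
    · rw [cc_shift, cc_shift]; exact h4
    · convert h5 using 1 <;> omega
    · rw [cc_shift]; exact h6
    · rw [show cc (n+1) (k+1) 1 0 = n.choose k by simp [cc]]; omega

/-! cylinder weights -/

lemma deg_cyl_out {X : Finset ℕ} {k : ℕ} {I J : Finset ℕ} (hI : I ⊆ X) (hJ : J ⊆ X) (hd : Disjoint I J) {x : ℕ} (hx : x ∈ X)
    (hxI : x ∉ I) (hxJ : x ∉ J) : deg (cyl X k I J) {x} = cc X.card k (I.card+1) J.card := by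
  have h1 := card_cyl (k := k) (I := insert x I) (J := J) (Finset.insert_subset hx hI) hJ (by
    rw [Finset.disjoint_insert_left]; exact ⟨hxJ, hd⟩)
  rw [Finset.card_insert_of_notMem hxI] at h1
  unfold deg
  rw [← h1]
  congr 2
  ext A
  simp only [Finset.mem_filter, mem_cyl, Finset.insert_subset_iff, Finset.singleton_subset_iff]
  tauto

lemma deg_cyl_in {X : Finset ℕ} {k : ℕ} {I J : Finset ℕ} (hI : I ⊆ X) (hJ : J ⊆ X) (hd : Disjoint I J) {x : ℕ}
    (hxI : x ∈ I) : deg (cyl X k I J) {x} = cc X.card k I.card J.card := by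
  rw [← card_cyl (k := k) hI hJ hd]
  unfold deg
  rw [Finset.filter_true_of_mem]
  intro A hA; rw [Finset.singleton_subset_iff]; exact (mem_cyl.1 hA).2.1 hxI

lemma deg_cyl_av {X : Finset ℕ} {k : ℕ} {I J : Finset ℕ} {x : ℕ}
    (hxJ : x ∈ J) : deg (cyl X k I J) {x} = 0 := by
  unfold deg
  rw [Finset.filter_false_of_mem]; · simp
  intro A hA; rw [Finset.singleton_subset_iff]
  intro h
  exact Finset.disjoint_left.1 (mem_cyl.1 hA).2.2 hxJ h

lemma wt_cyl {X : Finset ℕ} {k : ℕ} {I J : Finset ℕ} (hI : I ⊆ X) (hJ : J ⊆ X) (hd : Disjoint I J) {A : Finset ℕ} (hA : A ⊆ X) :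
    wt (cyl X k I J) A = (A ∩ I).card * (cc X.card k I.card J.card : ℝ) +
      (A \ (I ∪ J)).card * (cc X.card k (I.card+1) J.card : ℝ) := by
  rw [wt_eq_sum_deg]
  have h : A = (A ∩ I) ∪ ((A ∩ J) ∪ (A \ (I ∪ J))) := by ext x; simp only [Finset.mem_union, Finset.mem_inter, Finset.mem_sdiff]; tauto
  have e : ∑ x ∈ A, deg (cyl X k I J) {x} = ∑ x ∈ (A ∩ I) ∪ ((A ∩ J) ∪ (A \ (I ∪ J))), deg (cyl X k I J) {x} := by rw [← h]
  rw [e, Finset.sum_union, Finset.sum_union]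
  · rw [Finset.sum_congr rfl (fun x hx => deg_cyl_in hI hJ hd (Finset.mem_inter.1 hx).2),
      Finset.sum_congr rfl (fun x hx => deg_cyl_av (k := k) (Finset.mem_inter.1 hx).2),
      Finset.sum_congr rfl (fun x hx => deg_cyl_out hI hJ hd (hA (Finset.mem_sdiff.1 hx).1)
        (fun h => (Finset.mem_sdiff.1 hx).2 (Finset.mem_union_left _ h)) (fun h => (Finset.mem_sdiff.1 hx).2 (Finset.mem_union_right _ h)))]
    simp [Finset.sum_const]
  · rw [Finset.disjoint_left]; intro x; simp only [Finset.mem_union, Finset.mem_inter, Finset.mem_sdiff]; tauto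
  · rw [Finset.disjoint_left]; intro x hx
    have := Finset.disjoint_left.1 hd (Finset.mem_inter.1 hx).2
    simp only [Finset.mem_union, Finset.mem_inter, Finset.mem_sdiff]; simp only [Finset.mem_inter] at hx; tauto

end SI

namespace SI

lemma cc_sum {n k i j q : ℕ} (h : i + j + q ≤ n) :
    cc n k i j = cc n k i (j+q) + ∑ l ∈ range q, cc n k (i+1) (j+l) := by
  induction q with
  | zero => simp
  | succ q ih =>
    rw [ih (by omega), Finset.sum_range_succ, cc_pascal (i := i) (j := j+q) (by omega)]
    rw [show j + q + 1 = j + (q+1) by omega]; omega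

lemma cc_id {n k i j : ℕ} (h : i + j ≤ n) : ((n:ℝ) - i - j) * cc n k (i+1) j = (k - i) * cc n k i j := by
  unfold cc
  by_cases h1 : i + 1 ≤ k
  · rw [if_pos h1, if_pos (by omega)]
    obtain ⟨d, rfl⟩ : ∃ d, k = i + 1 + d := ⟨k - (i+1), by omega⟩
    obtain ⟨N, rfl⟩ : ∃ N, n = i + j + N := ⟨n - (i+j), by omega⟩
    rw [show i + j + N - (i+1) - j = N - 1 by omega, show i + 1 + d - (i+1) = d by omega,
      show i + j + N - i - j = N by omega, show i + 1 + d - i = d + 1 by omega]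
    rcases Nat.eq_zero_or_pos N with rfl | hN
    · push_cast; simp
    · obtain ⟨M, rfl⟩ : ∃ M, N = M + 1 := ⟨N - 1, by omega⟩
      have := Nat.add_one_mul_choose_eq M d
      have h2 : ((M:ℝ)+1) * M.choose d = (M+1).choose (d+1) * (d+1) := by exact_mod_cast this
      push_cast
      linear_combination h2
  · rw [if_neg h1]
    split_ifs with h2
    · have : k = i := by omega
      subst this; simp
    · simp

/-- numeric bounds for a union of q petals -/
lemma pet_bounds {n k i j q : ℕ} (h : i + j + q ≤ n) (h' : i + 1 + j + q ≤ n) :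
    (cc n k i j : ℝ) - cc n k i (j+q) ≤ q * cc n k (i+1) j ∧
    q * (cc n k (i+1) j : ℝ) - q * (q-1) / 2 * cc n k (i+2) j ≤ (cc n k i j : ℝ) - cc n k i (j+q) := by
  have e : (cc n k i j : ℝ) - cc n k i (j+q) = ∑ l ∈ range q, (cc n k (i+1) (j+l) : ℝ) := by
    have := cc_sum (k := k) h
    rw [this]; push_cast; ring
  rw [e]
  have hl : ∀ l ∈ range q, (cc n k (i+1) (j+l):ℝ) ≤ cc n k (i+1) j := fun l _ => by exact_mod_cast cc_anti (by omega)
  have hg : ∀ l ∈ range q, (cc n k (i+1) j:ℝ) - l * cc n k (i+2) j ≤ cc n k (i+1) (j+l) := fun l hl => by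
    have hl := Finset.mem_range.1 hl
    have := cc_sum (n := n) (k := k) (i := i+1) (j := j) (q := l) (by omega)
    have h2 : ∑ x ∈ range l, cc n k (i+1+1) (j+x) ≤ l * cc n k (i+2) j := by
      calc _ ≤ ∑ x ∈ range l, cc n k (i+2) j := Finset.sum_le_sum fun x _ => cc_anti (n := n) (k := k) (i := i+2) (Nat.le_add_right j x)
        _ = _ := by simp
    have h3 : (cc n k (i+1) j : ℝ) ≤ cc n k (i+1) (j+l) + l * cc n k (i+2) j := by
      rw [this]; push_cast; 
      have : ((∑ x ∈ range l, cc n k (i+1+1) (j+x) : ℕ) : ℝ) ≤ l * cc n k (i+2) j := by exact_mod_cast h2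
      push_cast at this; linarith
    linarith
  constructor
  · calc _ ≤ ∑ l ∈ range q, (cc n k (i+1) j : ℝ) := Finset.sum_le_sum hl
      _ = _ := by simp
  · calc _ = ∑ l ∈ range q, ((cc n k (i+1) j : ℝ) - l * cc n k (i+2) j) := by
          rw [Finset.sum_sub_distrib, ← Finset.sum_mul]
          have : (∑ l ∈ range q, (l:ℝ)) = q * (q-1) / 2 := by
            clear hl hg e h h'
            induction q with
            | zero => simp
            | succ q ih => rw [Finset.sum_range_succ, ih]; push_cast; ring
          rw [this]; simp
      _ ≤ _ := Finset.sum_le_sum hg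

/-- union of petals around Z -/
def pet (X : Finset ℕ) (k : ℕ) (Z Av P : Finset ℕ) : Finset (Finset ℕ) := cyl X k Z Av \ cyl X k Z (Av ∪ P)

lemma mem_pet {X k Z Av P A} : A ∈ pet X k Z Av P ↔ A ∈ X.powersetCard k ∧ Z ⊆ A ∧ Disjoint Av A ∧ ∃ p ∈ P, p ∈ A := by
  unfold pet
  rw [Finset.mem_sdiff, mem_cyl, mem_cyl, Finset.disjoint_union_left, Finset.not_disjoint_iff.symm]
  tauto

lemma cyl_anti {X k Z Av Av'} (h : Av ⊆ Av') : cyl X k Z Av' ⊆ cyl X k Z Av := by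
  intro A; rw [mem_cyl, mem_cyl]; rintro ⟨h1, h2, h3⟩; exact ⟨h1, h2, h3.mono_left h⟩

lemma cyl_mono {X k Z Z' Av} (h : Z ⊆ Z') : cyl X k Z' Av ⊆ cyl X k Z Av := by
  intro A; rw [mem_cyl, mem_cyl]; rintro ⟨h1, h2, h3⟩; exact ⟨h1, h.trans h2, h3⟩

/-- data for a comparison family -/
structure Cmp (X : Finset ℕ) (Z Av P : Finset ℕ) (p : ℕ) : Prop where
  hZ : Z ⊆ X
  hA : Av ⊆ X
  hP : P ⊆ X
  hp : p ∈ X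
  pZ : p ∉ Z
  pA : p ∉ Av
  pP : p ∉ P
  dZA : Disjoint Z Av
  dZP : Disjoint Z P
  dAP : Disjoint Av P

variable {X : Finset ℕ} {k : ℕ} {Z Av P : Finset ℕ} {p : ℕ}

/-- the new petal -/
def npet (X : Finset ℕ) (k : ℕ) (Z Av P : Finset ℕ) (p : ℕ) := cyl X k (insert p Z) (Av ∪ P)

lemma Cmp.avp (c : Cmp X Z Av P p) : (Av ∪ P).card = Av.card + P.card := Finset.card_union_of_disjoint c.dAP
lemma Cmp.sAP (c : Cmp X Z Av P p) : Av ∪ P ⊆ X := Finset.union_subset c.hA c.hP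
lemma Cmp.dZAP (c : Cmp X Z Av P p) : Disjoint Z (Av ∪ P) := Finset.disjoint_union_right.2 ⟨c.dZA, c.dZP⟩

lemma Cmp.card_npet (c : Cmp X Z Av P p) : (npet X k Z Av P p).card = cc X.card k (Z.card+1) (Av.card + P.card) := by
  unfold npet
  rw [card_cyl (Finset.insert_subset c.hp c.hZ) c.sAP, c.avp, Finset.card_insert_of_notMem c.pZ]
  rw [Finset.disjoint_insert_left]; exact ⟨by rw [Finset.mem_union]; exact fun h => h.elim c.pA c.pP, c.dZAP⟩

lemma pet_card (hZ : Z ⊆ X) (hA : Av ⊆ X) (hP : P ⊆ X) (dZA : Disjoint Z Av) (dZP : Disjoint Z P) (dAP : Disjoint Av P) :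
    (pet X k Z Av P).card + cc X.card k Z.card (Av.card + P.card) = cc X.card k Z.card Av.card := by
  unfold pet
  have h := card_cyl (X := X) (k := k) hZ hA dZA
  have h' := card_cyl (X := X) (k := k) hZ (Finset.union_subset hA hP) (Finset.disjoint_union_right.2 ⟨dZA, dZP⟩)
  rw [Finset.card_union_of_disjoint dAP] at h'
  rw [← h', ← h]
  exact Finset.card_sdiff_add_card_eq_card (cyl_anti Finset.subset_union_left)

lemma Cmp.card_pet (c : Cmp X Z Av P p) :
    (pet X k Z Av P).card + cc X.card k Z.card (Av.card + P.card) = cc X.card k Z.card Av.card :=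
  pet_card c.hZ c.hA c.hP c.dZA c.dZP c.dAP

lemma Cmp.disj : Disjoint (pet X k Z Av P) (npet X k Z Av P p) := by
  rw [Finset.disjoint_left]; intro A hA hB
  unfold pet at hA
  exact (Finset.mem_sdiff.1 hA).2 (cyl_mono (Finset.subset_insert _ _) hB)

lemma Cmp.exists (G0 : Finset (Finset ℕ)) (h0 : pet X k Z Av P ⊆ G0) (h1 : G0 ⊆ pet X k Z Av P ∪ npet X k Z Av P p) {s : ℕ} (hs : G0.card ≤ s)
    (hs' : s ≤ (pet X k Z Av P).card + (npet X k Z Av P p).card) :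
    ∃ G, G0 ⊆ G ∧ G ⊆ pet X k Z Av P ∪ npet X k Z Av P p ∧ G.card = s := by
  obtain ⟨G, a, b, c⟩ := Finset.exists_subsuperset_card_eq h1 hs (by rwa [Finset.card_union_of_disjoint Cmp.disj])
  exact ⟨G, a, b, c⟩

section

lemma Cmp.sub_cyl {G : Finset (Finset ℕ)} (h2 : G ⊆ pet X k Z Av P ∪ npet X k Z Av P p) : G ⊆ cyl X k Z Av := by
  intro A hA
  rcases Finset.mem_union.1 (h2 hA) with h | h
  · exact (Finset.mem_sdiff.1 h).1
  · exact cyl_anti Finset.subset_union_left (cyl_mono (Finset.subset_insert _ _) h)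

lemma Cmp.degZ {G : Finset (Finset ℕ)} (h2 : G ⊆ pet X k Z Av P ∪ npet X k Z Av P p) {x : ℕ} (hx : x ∈ Z) : deg G {x} = G.card := by
  unfold deg; rw [Finset.filter_true_of_mem]
  intro A hA; rw [Finset.singleton_subset_iff]; exact (mem_cyl.1 (Cmp.sub_cyl h2 hA)).2.1 hx

lemma Cmp.degA {G : Finset (Finset ℕ)} (h2 : G ⊆ pet X k Z Av P ∪ npet X k Z Av P p) {x : ℕ} (hx : x ∈ Av) : deg G {x} = 0 := by
  unfold deg; rw [Finset.filter_false_of_mem]; · simp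
  intro A hA; rw [Finset.singleton_subset_iff]
  exact Finset.disjoint_left.1 (mem_cyl.1 (Cmp.sub_cyl h2 hA)).2.2 hx


lemma Cmp.degP (c : Cmp X Z Av P p) {G : Finset (Finset ℕ)} (h1 : pet X k Z Av P ⊆ G) (h2 : G ⊆ pet X k Z Av P ∪ npet X k Z Av P p) {x : ℕ} (hx : x ∈ P) : deg G {x} = cc X.card k (Z.card+1) Av.card := by
  have hxZ : x ∉ Z := fun h => Finset.disjoint_left.1 c.dZP h hx
  rw [← Finset.card_insert_of_notMem hxZ, ← card_cyl (X := X) (Finset.insert_subset (c.hP hx) c.hZ) c.hA (by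
    rw [Finset.disjoint_insert_left]; exact ⟨fun h => Finset.disjoint_left.1 c.dAP h hx, c.dZA⟩)]
  unfold deg
  congr 2
  ext A
  rw [Finset.mem_filter, mem_cyl, Finset.insert_subset_iff, Finset.singleton_subset_iff]
  constructor
  · rintro ⟨hA, hxA⟩
    have := mem_cyl.1 (Cmp.sub_cyl h2 hA)
    exact ⟨this.1, ⟨hxA, this.2.1⟩, this.2.2⟩
  · rintro ⟨a, ⟨b, c'⟩, d⟩
    exact ⟨h1 (mem_pet.2 ⟨a, c', d, x, hx, b⟩), b⟩

lemma Cmp.ip_eq (c : Cmp X Z Av P p) {G : Finset (Finset ℕ)} (h1 : pet X k Z Av P ⊆ G) (h2 : G ⊆ pet X k Z Av P ∪ npet X k Z Av P p) (hk : G ⊆ X.powersetCard k) : ip G G = Z.card * (G.card:ℝ)^2 + P.card * (cc X.card k (Z.card+1) Av.card : ℝ)^2 +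
      ∑ x ∈ X \ (Z ∪ (Av ∪ P)), deg G {x} ^ 2 ∧
    ∑ x ∈ X \ (Z ∪ (Av ∪ P)), deg G {x} = (k - Z.card) * (G.card:ℝ) - P.card * (cc X.card k (Z.card+1) Av.card : ℝ) := by
  have hs : Z ∪ (Av ∪ P) ⊆ X := Finset.union_subset c.hZ c.sAP
  have key : ∀ f : ℕ → ℝ, ∑ x ∈ X, f x = ∑ x ∈ Z, f x + ∑ x ∈ Av, f x + ∑ x ∈ P, f x + ∑ x ∈ X \ (Z ∪ (Av ∪ P)), f x := by
    intro f
    rw [← Finset.sum_sdiff hs, Finset.sum_union c.dZAP, Finset.sum_union c.dAP]; ring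
  constructor
  · rw [ip_eq_sum_deg (fun A hA => (Finset.mem_powersetCard.1 (hk hA)).1), key]
    rw [Finset.sum_congr rfl (fun x hx => by rw [Cmp.degZ h2 hx]), 
      Finset.sum_congr (s₁ := Av) rfl (fun x hx => by rw [Cmp.degA h2 hx]),
      Finset.sum_congr (s₁ := P) rfl (fun x hx => by rw [c.degP h1 h2 hx])]
    simp only [Finset.sum_const, nsmul_eq_mul, sq]; ring
  · have := sum_deg hk
    rw [key, Finset.sum_congr rfl (fun x hx => by rw [Cmp.degZ h2 hx]), 
      Finset.sum_congr (s₁ := Av) rfl (fun x hx => by rw [Cmp.degA h2 hx]),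
      Finset.sum_congr (s₁ := P) rfl (fun x hx => by rw [c.degP h1 h2 hx])] at this
    simp only [Finset.sum_const, nsmul_eq_mul] at this
    linarith

lemma Cmp.card_rest (c : Cmp X Z Av P p) {G : Finset (Finset ℕ)} (h1 : pet X k Z Av P ⊆ G) (h2 : G ⊆ pet X k Z Av P ∪ npet X k Z Av P p) : ((X \ (Z ∪ (Av ∪ P))).card : ℝ) = X.card - Z.card - Av.card - P.card := by
  have hs : Z ∪ (Av ∪ P) ⊆ X := Finset.union_subset c.hZ c.sAP
  have := Finset.card_sdiff_add_card_eq_card hs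
  rw [Finset.card_union_of_disjoint c.dZAP, c.avp] at this
  have h : (((X \ (Z ∪ (Av ∪ P))).card + (Z.card + (Av.card + P.card)) : ℕ) : ℝ) = X.card := by rw [this]
  push_cast at h; linarith

/-- lower bound by Cauchy-Schwarz -/
lemma Cmp.ip_ge (c : Cmp X Z Av P p) {G : Finset (Finset ℕ)} (h1 : pet X k Z Av P ⊆ G) (h2 : G ⊆ pet X k Z Av P ∪ npet X k Z Av P p) (hk : G ⊆ X.powersetCard k) :
    ∃ Rr : ℝ, 0 ≤ Rr ∧ ip G G = Z.card * (G.card:ℝ)^2 + P.card * (cc X.card k (Z.card+1) Av.card : ℝ)^2 + Rr ∧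
    ((k - Z.card) * (G.card:ℝ) - P.card * (cc X.card k (Z.card+1) Av.card : ℝ))^2 ≤
      (X.card - Z.card - Av.card - P.card) * Rr := by
  obtain ⟨e1, e2⟩ := c.ip_eq h1 h2 hk
  refine ⟨_, Finset.sum_nonneg fun _ _ => sq_nonneg _, e1, ?_⟩
  rw [← e2, ← c.card_rest h1 h2]
  exact sq_sum_le_card_mul_sum_sq

/-- weights of sets of the outer petals -/
lemma Cmp.wt_eq (c : Cmp X Z Av P p) {G : Finset (Finset ℕ)} (h1 : pet X k Z Av P ⊆ G) (h2 : G ⊆ pet X k Z Av P ∪ npet X k Z Av P p) {B : Finset ℕ} (hZB : Z ⊆ B) : wt G B = Z.card * (G.card:ℝ) + ∑ x ∈ B \ Z, deg G {x} := by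
  rw [wt_eq_sum_deg, ← Finset.sum_sdiff hZB, Finset.sum_congr (s₁ := Z) rfl (fun x hx => Cmp.degZ h2 hx)]
  simp; ring

lemma Cmp.deg_ge (c : Cmp X Z Av P p) {G : Finset (Finset ℕ)} (h1 : pet X k Z Av P ⊆ G) (h2 : G ⊆ pet X k Z Av P ∪ npet X k Z Av P p) {x : ℕ} (hx : x ∈ X) (hxZ : x ∉ Z) (hxA : x ∉ Av ∪ P) :
    (cc X.card k (Z.card+1) Av.card : ℝ) - cc X.card k (Z.card+1) (Av.card + P.card) ≤ deg G {x} ∧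
    deg G {x} ≤ (cc X.card k (Z.card+1) Av.card : ℝ) - cc X.card k (Z.card+1) (Av.card + P.card) + (G.card - (pet X k Z Av P).card) := by
  have e : deg (pet X k Z Av P) {x} = (cc X.card k (Z.card+1) Av.card : ℝ) - cc X.card k (Z.card+1) (Av.card + P.card) := by
    have := deg_sdiff (G := cyl X k Z Av) (H := cyl X k Z (Av ∪ P)) (cyl_anti Finset.subset_union_left) {x}
    rw [deg_cyl_out c.hZ c.hA c.dZA hx hxZ (fun h => hxA (Finset.mem_union_left _ h)),
      deg_cyl_out c.hZ c.sAP c.dZAP hx hxZ hxA, c.avp] at this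
    unfold pet; linarith
  rw [← e]
  refine ⟨deg_mono h1 _, ?_⟩
  rw [deg_sdiff h1]
  have := deg_le_card (G \ pet X k Z Av P) {x}
  have h3 : ((G \ pet X k Z Av P).card : ℝ) = G.card - (pet X k Z Av P).card := by
    rw [Finset.card_sdiff_of_subset h1, Nat.cast_sub (Finset.card_le_card h1)]
  linarith

end

end SI

namespace SI

structure MH (X W U Av : Finset ℕ) : Prop where
  hW : W ⊆ X
  hU : U ⊆ W
  hA : Av ⊆ X
  dWA : Disjoint W Av

/-- the exceptional family -/
def MM (X : Finset ℕ) (k : ℕ) (W U Av : Finset ℕ) (ε : ℕ) : Finset (Finset ℕ) :=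
  (U.biUnion fun u => cyl X k (W.erase u) (insert u Av)) ∪ (if ε = 1 then cyl X k W Av else ∅)

lemma mem_MM {X k W U Av ε A} : A ∈ MM X k W U Av ε ↔
    (∃ u ∈ U, A ∈ cyl X k (W.erase u) (insert u Av)) ∨ (ε = 1 ∧ A ∈ cyl X k W Av) := by
  unfold MM
  rw [Finset.mem_union, Finset.mem_biUnion]
  split_ifs with h <;> simp [h]

lemma MM_sub {X k W U Av ε} : MM X k W U Av ε ⊆ X.powersetCard k := by
  intro A hA
  rcases mem_MM.1 hA with ⟨u, _, h⟩ | ⟨_, h⟩ <;> exact (mem_cyl.1 h).1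

lemma deg_biUnion {U : Finset ℕ} {f : ℕ → Finset (Finset ℕ)} (hd : ∀ u ∈ U, ∀ v ∈ U, u ≠ v → Disjoint (f u) (f v)) (T : Finset ℕ) :
    deg (U.biUnion f) T = ∑ u ∈ U, deg (f u) T := by
  unfold deg
  rw [Finset.filter_biUnion, Finset.card_biUnion]
  · push_cast; rfl
  · intro u hu v hv huv
    exact Finset.disjoint_filter_filter (hd u hu v hv huv)

namespace MH
variable {X W U Av : Finset ℕ} {k ε : ℕ}

lemma dj (c : MH X W U Av) : ∀ u ∈ U, ∀ v ∈ U, u ≠ v →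
    Disjoint (cyl X k (W.erase u) (insert u Av)) (cyl X k (W.erase v) (insert v Av)) := by
  intro u hu v hv huv
  rw [Finset.disjoint_left]; intro A hA hB
  have h1 := (mem_cyl.1 hA).2.1 (Finset.mem_erase.2 ⟨huv.symm, c.hU hv⟩)
  exact Finset.disjoint_left.1 (mem_cyl.1 hB).2.2 (Finset.mem_insert_self _ _) h1

lemma dj2 (c : MH X W U Av) : Disjoint (U.biUnion fun u => cyl X k (W.erase u) (insert u Av)) (if ε = 1 then cyl X k W Av else ∅) := by
  split_ifs
  · rw [Finset.disjoint_left]; intro A hA hB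
    obtain ⟨u, hu, h⟩ := Finset.mem_biUnion.1 hA
    exact Finset.disjoint_left.1 (mem_cyl.1 h).2.2 (Finset.mem_insert_self _ _) ((mem_cyl.1 hB).2.1 (c.hU hu))
  · simp

lemma deg_MM (c : MH X W U Av) (hε : ε ≤ 1) (T : Finset ℕ) : deg (MM X k W U Av ε) T =
    ∑ u ∈ U, deg (cyl X k (W.erase u) (insert u Av)) T + ε * deg (cyl X k W Av) T := by
  unfold MM
  rw [deg_union c.dj2, deg_biUnion c.dj]
  congr 1
  split_ifs with h
  · rw [h]; simp
  · have : ε = 0 := by omega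
    rw [this]; simp [deg]

lemma uA (c : MH X W U Av) {u} (hu : u ∈ U) : u ∉ Av := Finset.disjoint_left.1 c.dWA (c.hU hu)
lemma s1 (c : MH X W U Av) {u : ℕ} : W.erase u ⊆ X := (Finset.erase_subset _ _).trans c.hW
lemma s2 (c : MH X W U Av) {u} (hu : u ∈ U) : insert u Av ⊆ X := Finset.insert_subset (c.hW (c.hU hu)) c.hA
lemma d1 (c : MH X W U Av) {u} : Disjoint (W.erase u) (insert u Av) := by
  rw [Finset.disjoint_insert_right]; exact ⟨Finset.notMem_erase _ _, c.dWA.mono_left (Finset.erase_subset _ _)⟩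

lemma card_MM (c : MH X W U Av) {i : ℕ} (hi : W.card = i + 1) (hε : ε ≤ 1) : ((MM X k W U Av ε).card : ℝ) =
    U.card * cc X.card k i (Av.card+1) + ε * cc X.card k (i+1) Av.card := by
  have h := c.deg_MM (k := k) hε ∅
  have e : ∀ G : Finset (Finset ℕ), deg G ∅ = G.card := fun G => by simp [deg]
  simp only [e] at h
  rw [h, card_cyl c.hW c.hA c.dWA, hi]
  congr 1
  rw [Finset.sum_congr rfl (fun u hu => by
    rw [card_cyl c.s1 (c.s2 hu) c.d1, Finset.card_insert_of_notMem (c.uA hu), Finset.card_erase_of_mem (c.hU hu), hi, Nat.add_sub_cancel])]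
  simp

lemma deg_W (c : MH X W U Av) (hε : ε ≤ 1) {w : ℕ} (hw : w ∈ W) (hwU : w ∉ U) : deg (MM X k W U Av ε) {w} = (MM X k W U Av ε).card := by
  unfold deg; rw [Finset.filter_true_of_mem]
  intro A hA; rw [Finset.singleton_subset_iff]
  rcases mem_MM.1 hA with ⟨u, hu, h⟩ | ⟨_, h⟩
  · exact (mem_cyl.1 h).2.1 (Finset.mem_erase.2 ⟨fun h => hwU (h ▸ hu), hw⟩)
  · exact (mem_cyl.1 h).2.1 hw

lemma deg_U (c : MH X W U Av) {i : ℕ} (hi : W.card = i + 1) (hε : ε ≤ 1) {v : ℕ} (hv : v ∈ U) :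
    deg (MM X k W U Av ε) {v} = (MM X k W U Av ε).card - cc X.card k i (Av.card+1) := by
  rw [c.card_MM hi hε, c.deg_MM hε, deg_cyl_in c.hW c.hA c.dWA (c.hU hv), hi, ← Finset.add_sum_erase _ _ hv,
    deg_cyl_av (Finset.mem_insert_self _ _),
    Finset.sum_congr rfl (fun u hu => by
    rw [deg_cyl_in c.s1 (c.s2 (Finset.mem_of_mem_erase hu)) c.d1 (Finset.mem_erase.2 ⟨(Finset.ne_of_mem_erase hu).symm, c.hU hv⟩), Finset.card_insert_of_notMem (c.uA (Finset.mem_of_mem_erase hu)), Finset.card_erase_of_mem (c.hU (Finset.mem_of_mem_erase hu)), hi, Nat.add_sub_cancel])]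
  rw [Finset.sum_const, Finset.card_erase_of_mem hv, nsmul_eq_mul, Nat.cast_sub (Finset.card_pos.2 ⟨v, hv⟩)]
  push_cast; ring

lemma deg_A (c : MH X W U Av) (hε : ε ≤ 1) {x : ℕ} (hx : x ∈ Av) : deg (MM X k W U Av ε) {x} = 0 := by
  rw [c.deg_MM hε, deg_cyl_av hx, Finset.sum_eq_zero]; · simp
  intro u _; exact deg_cyl_av (Finset.mem_insert_of_mem hx)

lemma deg_G (c : MH X W U Av) {i : ℕ} (hi : W.card = i + 1) (hε : ε ≤ 1) {x : ℕ} (hx : x ∈ X) (hxW : x ∉ W) (hxA : x ∉ Av) :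
    deg (MM X k W U Av ε) {x} = U.card * cc X.card k (i+1) (Av.card+1) + ε * cc X.card k (i+2) Av.card := by
  rw [c.deg_MM hε, deg_cyl_out c.hW c.hA c.dWA hx hxW hxA, hi]
  congr 1
  rw [Finset.sum_congr rfl (fun u hu => by
    rw [deg_cyl_out c.s1 (c.s2 hu) c.d1 hx (fun h => hxW (Finset.mem_of_mem_erase h)) (by
      rw [Finset.mem_insert, not_or]; exact ⟨fun h => hxW (h ▸ c.hU hu), hxA⟩), Finset.card_insert_of_notMem (c.uA hu), Finset.card_erase_of_mem (c.hU hu), hi, Nat.add_sub_cancel])]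
  simp

lemma ip_MM (c : MH X W U Av) {i : ℕ} (hi : W.card = i + 1) (hε : ε ≤ 1) (M X0 dg : ℝ) (hM : M = (MM X k W U Av ε).card)
    (hX0 : X0 = cc X.card k i (Av.card+1)) (hdg : dg = U.card * cc X.card k (i+1) (Av.card+1) + ε * cc X.card k (i+2) Av.card) :
    ip (MM X k W U Av ε) (MM X k W U Av ε) = ((i:ℝ) + 1 - U.card) * M^2 + U.card * (M - X0)^2 +
      ((X.card:ℝ) - Av.card - i - 1) * dg^2 := by
  have hs : W ∪ Av ⊆ X := Finset.union_subset c.hW c.hA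
  rw [ip_eq_sum_deg (fun A hA => (Finset.mem_powersetCard.1 (MM_sub hA)).1), ← Finset.sum_sdiff hs, Finset.sum_union c.dWA,
    ← Finset.sum_sdiff c.hU]
  rw [Finset.sum_congr (s₁ := X \ (W ∪ Av)) (g := fun _ => dg * dg) rfl (fun x hx => by
    have := Finset.mem_sdiff.1 hx
    rw [Finset.mem_union, not_or] at this
    rw [c.deg_G hi hε this.1 this.2.1 this.2.2, ← hdg]),
    Finset.sum_congr (s₁ := W \ U) rfl (fun x hx => by
      rw [c.deg_W hε (Finset.mem_sdiff.1 hx).1 (Finset.mem_sdiff.1 hx).2, ← hM]),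
    Finset.sum_congr (s₁ := U) rfl (fun x hx => by rw [c.deg_U hi hε hx, ← hM, ← hX0]),
    Finset.sum_congr (s₁ := Av) rfl (fun x hx => by rw [c.deg_A hε hx])]
  simp only [Finset.sum_const, nsmul_eq_mul]
  have e1 : ((X \ (W ∪ Av)).card : ℝ) = X.card - Av.card - i - 1 := by
    rw [Finset.card_sdiff_of_subset hs, Nat.cast_sub (Finset.card_le_card hs), Finset.card_union_of_disjoint c.dWA, hi]; push_cast; ring
  have e2 : ((W \ U).card : ℝ) = i + 1 - U.card := by
    rw [Finset.card_sdiff_of_subset c.hU, Nat.cast_sub (Finset.card_le_card c.hU), hi]; push_cast; ring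
  rw [e1, e2]; ring

/-- weight of a set in the exceptional family -/
lemma wt_MM (c : MH X W U Av) {i : ℕ} (hi : W.card = i + 1) (hε : ε ≤ 1) (M X0 dg : ℝ) (hM : M = (MM X k W U Av ε).card)
    (hX0 : X0 = cc X.card k i (Av.card+1)) (hdg : dg = U.card * cc X.card k (i+1) (Av.card+1) + ε * cc X.card k (i+2) Av.card)
    {A : Finset ℕ} (hA : A ∈ X.powersetCard k) :
    wt (MM X k W U Av ε) A ≤ (i + 1 - U.card - ((W \ U) \ A).card) * M + (U.card - (U \ A).card) * (M - X0) +
      ((k:ℝ) - i - 1 + ((W \ U) \ A).card + (U \ A).card) * dg := by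
  have hA' := Finset.mem_powersetCard.1 hA
  rw [wt_eq_sum_deg]
  have hAs : A = ((W \ U) ∩ A ∪ U ∩ A) ∪ A \ W := by
    ext x; simp only [Finset.mem_union, Finset.mem_inter, Finset.mem_sdiff]
    have := @c.hU x; tauto
  have c1 : (((W \ U) ∩ A).card : ℝ) = i + 1 - U.card - ((W \ U) \ A).card := by
    have := Finset.card_inter_add_card_sdiff (W \ U) A
    have h2 := Finset.card_sdiff_add_card_eq_card c.hU
    rw [hi] at h2
    have h3 : ((((W \ U) ∩ A).card + ((W \ U) \ A).card + U.card : ℕ) : ℝ) = i + 1 := by rw [this, h2]; push_cast; ring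
    push_cast at h3; linarith
  have c2 : ((U ∩ A).card : ℝ) = U.card - (U \ A).card := by
    have := Finset.card_inter_add_card_sdiff U A
    have h3 : (((U ∩ A).card + (U \ A).card : ℕ) : ℝ) = U.card := by rw [this]
    push_cast at h3; linarith
  have dd1 : Disjoint ((W \ U) ∩ A) (U ∩ A) := by
    rw [Finset.disjoint_left]; intro x; simp only [Finset.mem_inter, Finset.mem_sdiff]; tauto
  have dd2 : Disjoint ((W \ U) ∩ A ∪ U ∩ A) (A \ W) := by
    rw [Finset.disjoint_left]; intro x; simp only [Finset.mem_union, Finset.mem_inter, Finset.mem_sdiff]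
    have := @c.hU x; tauto
  have c3 : ((A \ W).card : ℝ) = (k:ℝ) - i - 1 + ((W \ U) \ A).card + (U \ A).card := by
    have := congrArg Finset.card hAs
    rw [Finset.card_union_of_disjoint dd2, Finset.card_union_of_disjoint dd1, hA'.2] at this
    have h3 : (k:ℝ) = ((W \ U) ∩ A).card + (U ∩ A).card + (A \ W).card := by exact_mod_cast this
    rw [c1, c2] at h3; linarith
  conv_lhs => rw [hAs]
  rw [Finset.sum_union dd2, Finset.sum_union dd1]
  rw [Finset.sum_congr (s₁ := (W \ U) ∩ A) rfl (fun x hx => by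
      rw [c.deg_W hε (Finset.mem_sdiff.1 (Finset.mem_inter.1 hx).1).1 (Finset.mem_sdiff.1 (Finset.mem_inter.1 hx).1).2, ← hM]),
    Finset.sum_congr (s₁ := U ∩ A) rfl (fun x hx => by rw [c.deg_U hi hε (Finset.mem_inter.1 hx).1, ← hM, ← hX0])]
  have hdg0 : 0 ≤ dg := by rw [hdg]; exact add_nonneg (mul_nonneg (Nat.cast_nonneg _) (Nat.cast_nonneg _)) (mul_nonneg (Nat.cast_nonneg _) (Nat.cast_nonneg _))
  have h4 : ∑ x ∈ A \ W, deg (MM X k W U Av ε) {x} ≤ ∑ x ∈ A \ W, dg := by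
    refine Finset.sum_le_sum fun x hx => ?_
    have hx' := Finset.mem_sdiff.1 hx
    by_cases hxA : x ∈ Av
    · rw [c.deg_A hε hxA]; exact hdg0
    · rw [c.deg_G hi hε (hA'.1 hx'.1) hx'.2 hxA, hdg]
  rw [Finset.sum_const, nsmul_eq_mul, c3] at h4
  rw [Finset.sum_const, Finset.sum_const, nsmul_eq_mul, nsmul_eq_mul, c1, c2]; linarith
end MH
end SI

namespace SI

lemma ex_num1 {n k z q av av' ε : ℕ} (ha : av' + ε = av + 1) (hε : ε ≤ 1) (hq : 1 ≤ q) (hn : z + 2 + av' + q + 1 ≤ n) :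
    (cc n k z av' : ℝ) - cc n k z (av' + q) ≤ q * cc n k (z+1) (av+1) + ε * cc n k (z+2) av ∧
    (q * cc n k (z+1) (av+1) + ε * cc n k (z+2) av : ℝ) ≤ q * cc n k (z+1) av' := by
  have hq' : (1:ℝ) ≤ q := by exact_mod_cast hq
  have p1 := cc_pascal (n := n) (k := k) (i := z) (j := av') (by omega)
  have p1' : (cc n k z av' : ℝ) = cc n k z (av'+1) + cc n k (z+1) av' := by exact_mod_cast p1
  have p2 := (pet_bounds (n := n) (k := k) (i := z) (j := av'+1) (q := q - 1) (by omega) (by omega)).1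
  rw [show av' + 1 + (q-1) = av' + q by omega, Nat.cast_sub hq] at p2
  push_cast at p2
  have a1 : (cc n k (z+1) (av'+1) : ℝ) ≤ cc n k (z+1) av' := by exact_mod_cast cc_anti (Nat.le_succ _)
  have p3 := cc_pascal (n := n) (k := k) (i := z+1) (j := av') (by omega)
  have p3' : (cc n k (z+1) av' : ℝ) = cc n k (z+1) (av'+1) + cc n k (z+2) av' := by exact_mod_cast p3
  have nn : (0:ℝ) ≤ cc n k (z+2) av' := by positivity
  rcases (show ε = 0 ∨ ε = 1 by omega) with rfl | rfl
  · have : av' = av + 1 := by omega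
    subst this
    constructor
    · push_cast; nlinarith
    · push_cast; nlinarith
  · have : av' = av := by omega
    subst this
    constructor
    · push_cast; nlinarith
    · push_cast; nlinarith

/-- algebraic comparison of the exact values -/
lemma ex_alg {ε q i V M X0 Y0 dg R A2 κ : ℝ} (hε : ε = 0 ∨ ε = 1) (hM : M = q * X0 + ε * Y0) (hq : 2 ≤ q) (hV : q < V) (hR : 0 ≤ R)
    (hA : V * dg = A2) (hA2 : A2 = κ * M - ε * Y0)
    (hRR : (κ * M - ε * (q - 1) * Y0)^2 ≤ (V + 1 + ε - q) * R) :
    (i + 1 - q) * M^2 + q * (M - X0)^2 + V * dg^2 ≤ (i - 1) * M^2 + q * (X0 + ε * Y0)^2 + R := by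
  have e : V * (V * dg^2) = A2^2 := by rw [← hA]; ring
  have hV0 : 0 < V := by linarith
  rcases hε with rfl | rfl
  · have h1 : V * (V * dg^2) ≤ V * R := by rw [e, hA2]; nlinarith
    have h2 := le_of_mul_le_mul_left h1 hV0
    subst hM; nlinarith
  · have hd : 0 < V - (q - 2) := by linarith
    have h1 : V * (V - (q-2)) * (V * dg^2) ≤ V * (V - (q-2)) * ((q-2) * Y0^2 + R) := by
      have h3 : V * (V - (q-2)) * (V * dg^2) = (V - (q-2)) * A2^2 := by rw [← e]; ring
      have h4 : (A2 - (q-2) * Y0)^2 ≤ (V - (q-2)) * R := by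
        rw [hA2]; calc _ = (κ * M - 1 * (q - 1) * Y0)^2 := by ring
          _ ≤ _ := hRR
          _ = _ := by ring
      have h5 := mul_le_mul_of_nonneg_left h4 hV0.le
      have h6 : 0 ≤ (q-2) * (V * Y0 - A2)^2 := mul_nonneg (by linarith) (sq_nonneg _)
      rw [h3]; nlinarith
    have h2 := le_of_mul_le_mul_left h1 (mul_pos hV0 hd)
    subst hM; nlinarith

structure EXH (X : Finset ℕ) (k r i q ε : ℕ) (H : Finset (Finset ℕ)) (W U Av Z Av' P : Finset ℕ) (p : ℕ) : Prop where
  st : STH X k r i q H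
  m : MH X W U Av
  cm : Cmp X Z Av' P p
  hε : ε ≤ 1
  hW : W.card = i + 1
  hU : U.card = q
  q2 : 2 ≤ q
  zc : Z.card + 1 = i
  pc : P.card = q
  av : Av'.card + ε = Av.card + 1
  bud : i + q + Av'.card ≤ r + 1
  rho1 : (pet X k Z Av' P).card ≤ H.card
  rho2 : (H.card : ℝ) ≤ (pet X k Z Av' P).card + r * CC X.card k (i+1)

namespace EXH
variable {X : Finset ℕ} {k r i q ε : ℕ} {H : Finset (Finset ℕ)} {W U Av Z Av' P : Finset ℕ} {p : ℕ}

lemma big (h : EXH X k r i q ε H W U Av Z Av' P p) : i + q + Av'.card + 9 ≤ X.card := by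
  have := h.st.N.kn; have := h.bud; have := h.st.N.hk; omega

lemma zr (h : EXH X k r i q ε H W U Av Z Av' P p) : (Z.card : ℝ) = i - 1 := by
  have : ((Z.card + 1 : ℕ) : ℝ) = i := by rw [h.zc]
  push_cast at this; linarith

lemma petR (h : EXH X k r i q ε H W U Av Z Av' P p) : ((pet X k Z Av' P).card : ℝ) =
    cc X.card k Z.card Av'.card - cc X.card k Z.card (Av'.card + q) := by
  have := h.cm.card_pet (k := k)
  rw [h.pc] at this
  have h2 : (((pet X k Z Av' P).card + cc X.card k Z.card (Av'.card + q) : ℕ) : ℝ) = cc X.card k Z.card Av'.card := by rw [this]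
  push_cast at h2; linarith

lemma MR (h : EXH X k r i q ε H W U Av Z Av' P p) : ((MM X k W U Av ε).card : ℝ) =
    q * cc X.card k i (Av.card+1) + ε * cc X.card k (i+1) Av.card := by
  rw [h.m.card_MM h.hW h.hε, h.hU]

lemma pet_le (h : EXH X k r i q ε H W U Av Z Av' P p) : (pet X k Z Av' P).card ≤ (MM X k W U Av ε).card := by
  have h1 := h.big; have := h.zc
  have := (ex_num1 (k := k) (z := Z.card) h.av h.hε h.st.hq (n := X.card) (by omega)).1
  rw [← h.petR, show Z.card + 2 = i + 1 by omega, h.zc, ← h.MR] at this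
  exact_mod_cast this

lemma bb (h : EXH X k r i q ε H W U Av Z Av' P p) (j : ℕ) : (cc X.card k (i+1) j : ℝ) ≤ CC X.card k (i+1) := by
  unfold CC; exact_mod_cast cc_anti (Nat.zero_le _)

lemma kr2 (h : EXH X k r i q ε H W U Av Z Av' P p) : (r:ℝ)^2 * CC X.card k (i+1) ≤ CC X.card k i / 72 ∧ 
    (k:ℝ) * (r^2 * CC X.card k (i+1)) ≤ CC X.card k i / 72 ∧ (r:ℝ) * CC X.card k (i+1) ≤ (r:ℝ)^2 * CC X.card k (i+1) := by
  have h1 := h.st.kr2b; have h2 := h.st.kR; have h3 := h.st.rR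
  have h4 := CC_nonneg X.card k (i+1)
  have h5 : (0:ℝ) ≤ r^2 * CC X.card k (i+1) := by positivity
  have h6 : (1:ℝ) * (r^2 * CC X.card k (i+1)) ≤ k * (r^2 * CC X.card k (i+1)) := mul_le_mul_of_nonneg_right h2 h5
  refine ⟨by nlinarith, by nlinarith, ?_⟩
  apply mul_le_mul_of_nonneg_right _ h4; nlinarith

lemma M_le (h : EXH X k r i q ε H W U Av Z Av' P p) : ((MM X k W U Av ε).card : ℝ) ≤ (pet X k Z Av' P).card + r^2 / 2 * CC X.card k (i+1) := by
  have h1 := h.big; have := h.zc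
  have h2 := (ex_num1 (k := k) (z := Z.card) h.av h.hε h.st.hq (n := X.card) (by omega)).2
  have h3 := (pet_bounds (n := X.card) (k := k) (i := Z.card) (j := Av'.card) (q := q) (by omega) (by omega)).2
  rw [← h.petR] at h3
  rw [show Z.card + 2 = i + 1 by omega, h.zc, ← h.MR] at h2
  rw [show Z.card + 2 = i + 1 by omega, h.zc] at h3
  have h4 := h.bb Av'.card
  have hq := h.st.qR; have hqr := h.st.qrR
  have h5 : (q:ℝ) * (q-1)/2 * cc X.card k (i+1) Av'.card ≤ r^2/2 * CC X.card k (i+1) := by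
    apply mul_le_mul _ h4 (by positivity) (by positivity); nlinarith
  linarith

lemma npetR (h : EXH X k r i q ε H W U Av Z Av' P p) : (r:ℝ)^2 * CC X.card k (i+1) ≤ (npet X k Z Av' P p).card := by
  rw [h.cm.card_npet, h.zc, h.pc]
  have h1 := h.big; have h2 := h.bud; have h3 := h.st.hi
  have h4 := cc_ge (n := X.card) (k := k) (i := i) (j := Av'.card + q) (by omega)
  have h5 : CC X.card k i ≤ cc X.card k i (Av'.card + q) + (Av'.card + q : ℕ) * CC X.card k (i+1) := by
    unfold CC; exact_mod_cast h4
  have h6 : ((Av'.card + q : ℕ):ℝ) ≤ r := by exact_mod_cast (by omega : Av'.card + q ≤ r)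
  have h7 := mul_le_mul_of_nonneg_right h6 (CC_nonneg X.card k (i+1))
  obtain ⟨a, b, c⟩ := h.kr2
  have := h.st.Cpos
  linarith

lemma rho3 (h : EXH X k r i q ε H W U Av Z Av' P p) : H.card ≤ (pet X k Z Av' P).card + (npet X k Z Av' P p).card := by
  have h1 := h.npetR; have h2 := h.rho2; have h3 := h.kr2.2.2
  exact_mod_cast (by linarith : (H.card : ℝ) ≤ (pet X k Z Av' P).card + (npet X k Z Av' P p).card)

lemma M3 (h : EXH X k r i q ε H W U Av Z Av' P p) : (MM X k W U Av ε).card ≤ (pet X k Z Av' P).card + (npet X k Z Av' P p).card := by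
  have h1 := h.npetR; have h2 := h.M_le
  have h4 := CC_nonneg X.card k (i+1)
  have h5 : (0:ℝ) ≤ r^2 * CC X.card k (i+1) := by positivity
  exact_mod_cast (by linarith : ((MM X k W U Av ε).card : ℝ) ≤ (pet X k Z Av' P).card + (npet X k Z Av' P p).card)

lemma pnsub : pet X k Z Av' P ∪ npet X k Z Av' P p ⊆ X.powersetCard k := by
  apply Finset.union_subset
  · exact Finset.sdiff_subset.trans cyl_sub
  · exact cyl_sub

/-- comparison of exact values -/
lemma cmp_exact (h : EXH X k r i q ε H W U Av Z Av' P p) {G : Finset (Finset ℕ)} (h1 : pet X k Z Av' P ⊆ G)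
    (h2 : G ⊆ pet X k Z Av' P ∪ npet X k Z Av' P p) (hG : G.card = (MM X k W U Av ε).card) :
    ip (MM X k W U Av ε) (MM X k W U Av ε) ≤ ip G G := by
  have hb := h.big; have hz := h.zc
  have hzR := h.zr
  have hav2 := h.av; have hε2 := h.hε
  obtain ⟨R, hR, e, hRR⟩ := h.cm.ip_ge h1 h2 (h2.trans pnsub)
  have hav : (Av'.card : ℝ) + ε = Av.card + 1 := by exact_mod_cast h.av
  have hMR := h.MR
  have hεc : (ε:ℝ) = 0 ∨ (ε:ℝ) = 1 := by
    rcases (show ε = 0 ∨ ε = 1 by have := h.hε; omega) with h | h <;> simp [h]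
  have ea : (cc X.card k i Av'.card : ℝ) = cc X.card k i (Av.card+1) + ε * cc X.card k (i+1) Av.card := by
    have := h.av
    rcases (show ε = 0 ∨ ε = 1 by have := h.hε; omega) with h0 | h0
    · rw [h0, show Av'.card = Av.card + 1 by omega]; simp
    · rw [h0, show Av'.card = Av.card by omega, cc_pascal (i := i) (j := Av.card) (by omega)]; push_cast; ring
  rw [e, h.m.ip_MM h.hW h.hε _ _ _ rfl rfl rfl, hzR, h.pc, h.hU, hz, ea, hG]
  rw [hzR, h.pc, hz, ea, hG] at hRR
  set M : ℝ := ((MM X k W U Av ε).card : ℝ)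
  set X0 : ℝ := (cc X.card k i (Av.card+1) : ℝ)
  set Y0 : ℝ := (cc X.card k (i+1) Av.card : ℝ)
  have i1 := cc_id (n := X.card) (k := k) (i := i) (j := Av.card+1) (by omega)
  have i2 := cc_id (n := X.card) (k := k) (i := i+1) (j := Av.card) (by omega)
  push_cast at i1 i2
  have hbR : (i:ℝ) + q + Av'.card + 9 ≤ X.card := by exact_mod_cast hb
  refine ex_alg (κ := k - i) (A2 := (k - i) * M - ε * Y0) hεc hMR (by exact_mod_cast h.q2) ?_ hR ?_ rfl ?_
  · rcases hεc with h | h <;> rw [h] at hav <;> linarith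
  · rw [hMR]
    have i1' : ((X.card:ℝ) - Av.card - i - 1) * cc X.card k (i+1) (Av.card+1) = (k - i) * X0 := by rw [← i1]; ring
    have i2' : ((X.card:ℝ) - Av.card - i - 1) * cc X.card k (i+2) Av.card = (k - i - 1) * Y0 := by
      rw [show ((k:ℝ) - i - 1) = (k - (i+1)) by ring, ← i2]; ring
    linear_combination (q:ℝ) * i1' + ε * i2'
  · calc _ = ((↑k - (↑i - 1)) * M - q * (X0 + ε * Y0)) ^ 2 := by rw [hMR]; ring
      _ ≤ _ := hRR
      _ = _ := by rw [show (Av'.card:ℝ) = Av.card + 1 - ε by linarith]; ring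


lemma mem_erase_sub (h : EXH X k r i q ε H W U Av Z Av' P p) {A} (hA : A ∈ MM X k W U Av ε) : ∃ u ∈ U, W.erase u ⊆ A := by
  rcases mem_MM.1 hA with ⟨u, hu, h'⟩ | ⟨_, h'⟩
  · exact ⟨u, hu, (mem_cyl.1 h').2.1⟩
  · obtain ⟨u, hu⟩ := Finset.card_pos.1 (show 0 < U.card by rw [h.hU]; have := h.q2; omega)
    exact ⟨u, hu, (Finset.erase_subset _ _).trans (mem_cyl.1 h').2.1⟩

lemma inter_ge (h : EXH X k r i q ε H W U Av Z Av' P p) {A B} (hA : A ∈ MM X k W U Av ε) (hB : B ∈ MM X k W U Av ε) :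
    i ≤ (A ∩ B).card + 1 := by
  obtain ⟨u, hu, h1⟩ := h.mem_erase_sub hA
  obtain ⟨v, hv, h2⟩ := h.mem_erase_sub hB
  have h3 : (W.erase u).erase v ⊆ A ∩ B := by
    intro x hx
    simp only [Finset.mem_erase] at hx
    exact Finset.mem_inter.2 ⟨h1 (Finset.mem_erase.2 hx.2), h2 (Finset.mem_erase.2 ⟨hx.1, hx.2.2⟩)⟩
  have h4 := Finset.card_le_card h3
  have h5 := Finset.pred_card_le_card_erase (s := W.erase u) (a := v)
  have h6 := Finset.pred_card_le_card_erase (s := W) (a := u)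
  have := h.hW; omega

lemma wt_ge {i : ℕ} {H : Finset (Finset ℕ)} {A T : Finset ℕ} (hA : ∀ B ∈ H, i ≤ (A ∩ B).card + 1) (hT : T ⊆ A) (hTi : T.card = i) :
    ((i:ℝ) - 1) * H.card + deg H T ≤ wt H A := by
  rw [deg_eq_sum]; unfold wt
  have : ((i:ℝ) - 1) * H.card = ∑ B ∈ H, ((i:ℝ) - 1) := by rw [Finset.sum_const, nsmul_eq_mul]; ring
  rw [this, ← Finset.sum_add_distrib]
  refine Finset.sum_le_sum fun B hB => ?_
  split_ifs with h
  · have : i ≤ (A ∩ B).card := hTi ▸ Finset.card_le_card (Finset.subset_inter hT h)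
    have : (i:ℝ) ≤ (A ∩ B).card := by exact_mod_cast this
    linarith
  · have : (i:ℝ) ≤ (A ∩ B).card + 1 := by exact_mod_cast hA B hB
    linarith

lemma ip_ge {c : ℝ} {E : Finset (Finset ℕ)} (h : ∀ A ∈ E, ∀ B ∈ E, c ≤ ((A ∩ B).card : ℝ)) : c * (E.card:ℝ)^2 ≤ ip E E := by
  unfold ip wt
  calc c * (E.card:ℝ)^2 = ∑ A ∈ E, ∑ B ∈ E, c := by simp; ring
    _ ≤ _ := Finset.sum_le_sum fun A hA => Finset.sum_le_sum fun B hB => h A hA B hB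

lemma case_empty (h : EXH X k r i q ε H W U Av Z Av' P p) (hHM : H ⊆ MM X k W U Av ε)
    (hT : ∀ u ∈ U, (7/10) * CC X.card k i ≤ deg H (W.erase u)) :
    ∃ G, pet X k Z Av' P ⊆ G ∧ G ⊆ pet X k Z Av' P ∪ npet X k Z Av' P p ∧ G.card = H.card ∧ ip H H ≤ ip G G := by
  obtain ⟨Hs, a1, a2, a3⟩ := Cmp.exists (k := k) (X := X) (Z := Z) (Av := Av') (P := P) (p := p) _ subset_rfl Finset.subset_union_left h.rho1 h.rho3
  obtain ⟨G, b1, b2, b3⟩ := Cmp.exists Hs a1 a2 (s := (MM X k W U Av ε).card) (by rw [a3]; exact Finset.card_le_card hHM) h.M3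
  refine ⟨Hs, a1, a2, a3, ?_⟩
  have ex := h.cmp_exact (a1.trans b1) b2 b3
  have e1 := ip_sdiff_self hHM
  have e2 := ip_sdiff_self b1
  have hC := h.st.Cpos
  set x : ℝ := (MM X k W U Av ε).card - H.card with hx
  have x0 : 0 ≤ x := by
    have : (H.card : ℝ) ≤ (MM X k W U Av ε).card := by exact_mod_cast Finset.card_le_card hHM
    linarith
  have cx1 : (((MM X k W U Av ε) \ H).card : ℝ) = x := by
    rw [Finset.card_sdiff_of_subset hHM, Nat.cast_sub (Finset.card_le_card hHM)]
  have cx2 : ((G \ Hs).card : ℝ) = x := by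
    rw [Finset.card_sdiff_of_subset b1, Nat.cast_sub (Finset.card_le_card b1), b3, a3]
  have i1 : x * ((i - 1) * H.card + 7/10 * CC X.card k i) ≤ ip (MM X k W U Av ε \ H) H := by
    rw [← cx1]; unfold ip
    rw [← nsmul_eq_mul]
    refine Finset.card_nsmul_le_sum _ _ _ fun A hA => ?_
    have hA := (Finset.mem_sdiff.1 hA).1
    obtain ⟨u, hu, hs⟩ := h.mem_erase_sub hA
    have := wt_ge (i := i) (H := H) (A := A) (T := W.erase u) (fun B hB => h.inter_ge hA (hHM hB)) hs (by
      rw [Finset.card_erase_of_mem (h.m.hU hu), h.hW]; omega)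
    linarith [hT u hu]
  have i2 := ip_nonneg (MM X k W U Av ε \ H) (MM X k W U Av ε \ H)
  have kb := h.st.krb
  have bnn := CC_nonneg X.card k (i+1)
  have qr := h.st.qrR
  have hb := h.big; have hz := h.zc
  have i3 : ip (G \ Hs) Hs ≤ x * ((i - 1) * H.card + 1/72 * CC X.card k i) := by
    rw [← cx2]; unfold ip
    rw [← nsmul_eq_mul]
    refine Finset.sum_le_card_nsmul _ _ _ fun B hB => ?_
    have hB' := Finset.mem_sdiff.1 hB
    have hBn : B ∈ npet X k Z Av' P p := by
      rcases Finset.mem_union.1 (b2 hB'.1) with h' | h'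
      · exact absurd (a1 h') hB'.2
      · exact h'
    have hBc := mem_cyl.1 hBn
    have hBX := Finset.mem_powersetCard.1 hBc.1
    have hZB : Z ⊆ B := (Finset.subset_insert _ _).trans hBc.2.1
    rw [h.cm.wt_eq a1 a2 hZB, h.zr, a3]
    have hd : ∀ y ∈ B \ Z, deg Hs {y} ≤ 2 * (r * CC X.card k (i+1)) := by
      intro y hy
      have hy := Finset.mem_sdiff.1 hy
      have := (h.cm.deg_ge a1 a2 (hBX.1 hy.1) hy.2 (Finset.disjoint_right.1 hBc.2.2 hy.1)).2
      have h3 := (pet_bounds (n := X.card) (k := k) (i := Z.card+1) (j := Av'.card) (q := q) (by omega) (by omega)).1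
      rw [h.pc, a3] at this
      rw [show Z.card + 1 + 1 = i + 1 by omega] at h3
      have h5 := h.bb Av'.card
      have h6 := mul_le_mul qr h5 (by positivity) (by positivity)
      have := h.rho2
      linarith
    have h7 := Finset.sum_le_card_nsmul _ _ _ hd
    rw [nsmul_eq_mul] at h7
    have h8 : ((B \ Z).card : ℝ) ≤ k := by exact_mod_cast hBX.2 ▸ Finset.card_le_card Finset.sdiff_subset
    have h9 := mul_le_mul_of_nonneg_right h8 (show 0 ≤ 2 * ((r:ℝ) * CC X.card k (i+1)) by positivity)
    linarith
  have i4 : ip (G \ Hs) (G \ Hs) ≤ x * (k * x) := by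
    nth_rewrite 1 [← cx2]
    rw [← nsmul_eq_mul]
    refine Finset.sum_le_card_nsmul _ _ _ fun B hB => ?_
    rw [← cx2]
    exact wt_le (Finset.mem_powersetCard.1 (pnsub (b2 (Finset.mem_sdiff.1 hB).1))).2
  have i5 : k * x ≤ 1/72 * CC X.card k i := by
    have h1 := h.M_le
    have h2 : ((pet X k Z Av' P).card : ℝ) ≤ H.card := by exact_mod_cast h.rho1
    have h3 := h.kr2.2.1
    have h4 : x ≤ r^2 * CC X.card k (i+1) := by
      have : (0:ℝ) ≤ r^2 * CC X.card k (i+1) := by positivity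
      linarith
    have := mul_le_mul_of_nonneg_left h4 (Nat.cast_nonneg (α := ℝ) k)
    linarith
  have i6 := mul_le_mul_of_nonneg_left i5 x0
  have i7 := mul_nonneg x0 hC.le
  linarith

end EXH
end SI

namespace SI

lemma PP_le {X : Finset ℕ} {k r i : ℕ} (N : Num X.card k r) (hi : 1 ≤ i) (hir : i ≤ r)
    {G : Finset (Finset ℕ)} (hG : G ⊆ X.powersetCard k) (hg : (G.card : ℝ) ≤ r * CC X.card k i) :
    PP X i G ≤ 61/59 * (G.card * CC X.card k i) := by
  have hC := CC_nonneg X.card k i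
  have h := UB N hi hir hG (by linarith) 1
  have h0 : 0 ≤ ∑ T ∈ X.powersetCard i, deg G T ^ 2 * (CC X.card k i - deg G T) := by
    refine Finset.sum_nonneg fun T hT => mul_nonneg (sq_nonneg _) ?_
    have := deg_le_CC hG T
    rw [(Finset.mem_powersetCard.1 hT).2] at this; linarith
  rcases hC.eq_or_lt with h1 | h1
  · rw [← h1] at hg
    have : G = ∅ := by
      rw [← Finset.card_eq_zero]
      have : (G.card : ℝ) ≤ 0 := by linarith
      exact_mod_cast le_antisymm this (Nat.cast_nonneg _)
    subst this
    unfold PP deg; simp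
  · have h2 : CC X.card k i * (59/60 * PP X i G) ≤ CC X.card k i * (61/60 * (G.card * CC X.card k i)) := by nlinarith
    have := le_of_mul_le_mul_left h2 h1
    linarith

lemma ab_alg {α β q : ℕ} {M X0 dg d C : ℝ} (h : 1 ≤ α ∨ 2 ≤ β) (hq : 2 ≤ q) (hM : q * X0 ≤ M) (hdg : dg ≤ C/10) (hX : 9/10 * C ≤ X0)
    (hX2 : X0 ≤ C) (hC : 0 < C) (hd : 0 ≤ d) (h2 : q = 2 → 2 ≤ β → 9/10 * C ≤ d) :
    0 ≤ ((α:ℝ) - 1) * M + β * (M - X0) - (α + β - 1) * dg + d := by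
  have hq' : (2:ℝ) ≤ q := by exact_mod_cast hq
  have hX0 : 0 ≤ X0 := by linarith
  have f1 : 0 ≤ M - X0 - dg := by nlinarith
  have f2 : 0 ≤ M - dg := by linarith
  have hβ : (0:ℝ) ≤ β := by positivity
  by_cases hα : 1 ≤ α
  · have hα' : (1:ℝ) ≤ α := by exact_mod_cast hα
    have g1 := mul_nonneg (sub_nonneg.2 hα') f2
    have g2 := mul_nonneg hβ f1
    linarith
  · have hα' : α = 0 := by omega
    subst hα'
    have hb : 2 ≤ β := by omega
    have hb' : (2:ℝ) ≤ β := by exact_mod_cast hb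
    have g1 : M - X0 - dg ≤ (β - 1) * (M - X0 - dg) := by nlinarith
    by_cases h3 : q = 2
    · have := h2 h3 hb
      subst h3; push_cast at *; linarith
    · have h4 : (3:ℝ) ≤ q := by exact_mod_cast (by omega : 3 ≤ q)
      have : 3 * X0 ≤ M := by nlinarith
      push_cast at *; linarith

namespace EXH
variable {X : Finset ℕ} {k r i q ε : ℕ} {H : Finset (Finset ℕ)} {W U Av Z Av' P : Finset ℕ} {p : ℕ}

set_option maxHeartbeats 1000000 in
lemma num_final (h : EXH X k r i q ε H W U Av Z Av' P p) {lam dg : ℝ}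
    (hdg : dg = q * cc X.card k (i+1) (Av.card+1) + ε * cc X.card k (i+2) Av.card)
    (hlam : lam = (cc X.card k (Z.card+1) Av'.card : ℝ) - cc X.card k (Z.card+1) (Av'.card + q)) :
    2 * (ε * cc X.card k (i+1) Av.card) + 2 * ((k - i) * dg) + 61/59 * CC X.card k (i+1) ≤ 2 * ((k - i + 1) * lam) ∧ dg ≤ CC X.card k i / 10 := by
  have hb := h.big; have hz := h.zc; have hbud := h.bud; have hi := h.st.hi
  have h3 := (pet_bounds (n := X.card) (k := k) (i := Z.card+1) (j := Av'.card) (q := q) (by omega) (by omega)).2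
  rw [← hlam, show Z.card + 1 + 1 = i + 1 by omega, show Z.card + 1 + 2 = i + 2 by omega] at h3
  set b' : ℝ := (cc X.card k (i+1) Av'.card : ℝ) with hb'
  set c : ℝ := CC X.card k (i+2) with hc
  have c0 : 0 ≤ c := CC_nonneg _ _ _
  have hk := h.st.kR; have hr := h.st.rR; have hq := h.st.qR; have hqr := h.st.qrR
  have q2 : (2:ℝ) ≤ q := by exact_mod_cast h.q2
  have hcc : ∀ j, (cc X.card k (i+2) j : ℝ) ≤ c := fun j => by rw [hc]; unfold CC; exact_mod_cast cc_anti (Nat.zero_le _)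
  have hst := h.st.N.step (i+1)
  rw [show i + 1 + 1 = i + 2 by omega, ← hc] at hst
  have kc : (k:ℝ) * r^2 * c ≤ CC X.card k (i+1) / 72 := by
    have : 72 * (k * (r:ℝ)^2 * c) ≤ 72 * k * r * (k + r) * c := by
      have : 0 ≤ (k:ℝ) * r * k * c := by positivity
      nlinarith
    linarith
  have rc : (r:ℝ) * c ≤ k * r^2 * c := by
    have : (0:ℝ) ≤ r * c := by positivity
    have h1 : (1:ℝ) ≤ k * r := by nlinarith
    calc (r:ℝ) * c = 1 * (r * c) := by ring
      _ ≤ (k * r) * (r * c) := mul_le_mul_of_nonneg_right h1 this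
      _ = _ := by ring
  have b1 : CC X.card k (i+1) - r * c ≤ b' := by
    have h4 := cc_ge (n := X.card) (k := k) (i := i+1) (j := Av'.card) (by omega)
    have h5 : CC X.card k (i+1) ≤ b' + Av'.card * c := by
      rw [hb', hc]; unfold CC; exact_mod_cast h4
    have h6 : (Av'.card : ℝ) ≤ r := by exact_mod_cast (by omega : Av'.card ≤ r)
    have := mul_le_mul_of_nonneg_right h6 c0
    linarith
  have b0 : 0 ≤ b' := by positivity
  have ki : (i:ℝ) ≤ k := by exact_mod_cast h.st.hik
  have i1 : (1:ℝ) ≤ i := by exact_mod_cast hi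
  have hav := h.av
  have key : ε * (cc X.card k (i+1) Av.card : ℝ) ≤ b' ∧ dg ≤ q * b' + c := by
    rcases (show ε = 0 ∨ ε = 1 by have := h.hε; omega) with h0 | h0
    · rw [hdg, h0, hb', show Av'.card = Av.card + 1 by omega]
      refine ⟨by simp, by simp [c0]⟩
    · rw [hdg, h0, hb', show Av'.card = Av.card by omega]
      refine ⟨by simp, ?_⟩
      have : (cc X.card k (i+1) (Av.card+1) : ℝ) ≤ cc X.card k (i+1) Av.card := by exact_mod_cast cc_anti (Nat.le_succ _)
      have := hcc Av.card
      push_cast; nlinarith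
  have B0 := CC_nonneg X.card k (i+1)
  constructor
  · have l1 : q * b' - q^2/2 * c ≤ lam := by
      have := hcc Av'.card
      have h7 : (q:ℝ) * (q-1)/2 * cc X.card k (i+2) Av'.card ≤ q^2/2 * c := by
        apply mul_le_mul _ this (by positivity) (by positivity); nlinarith
      linarith
    have l2 := mul_le_mul_of_nonneg_left l1 (show (0:ℝ) ≤ k - i + 1 by linarith)
    have l3 := mul_le_mul_of_nonneg_left key.2 (show (0:ℝ) ≤ k - i by linarith)
    have l4 : ((k:ℝ) - i + 1) * (q^2 * c) ≤ k * (r^2 * c) := by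
      apply mul_le_mul (by linarith) _ (by positivity) (by linarith)
      apply mul_le_mul_of_nonneg_right _ c0; nlinarith
    have l5 : ((k:ℝ) - i) * c ≤ k * (r^2 * c) := by
      apply mul_le_mul (by linarith) _ c0 (by linarith)
      have h1 : (1:ℝ) ≤ r^2 := by nlinarith only [hr]
      have := mul_le_mul_of_nonneg_right h1 c0
      linarith
    have l6 : 2 * b' ≤ q * b' := mul_le_mul_of_nonneg_right q2 b0
    have := key.1
    linarith
  · have := h.bb Av'.card
    have h8 : (q:ℝ) * b' ≤ r * CC X.card k (i+1) := mul_le_mul hqr this b0 (by linarith)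
    have h9 : c ≤ r * c := by
      have := mul_le_mul_of_nonneg_right hr c0
      linarith
    obtain ⟨h10, h11, h12⟩ := h.kr2
    have h13 := mul_le_mul_of_nonneg_right hr B0
    have h14 := key.2
    have h15 := h.st.Cpos
    linarith

lemma X0_bd (h : EXH X k r i q ε H W U Av Z Av' P p) : 9/10 * CC X.card k i ≤ cc X.card k i (Av.card+1) ∧ (cc X.card k i (Av.card+1) : ℝ) ≤ CC X.card k i := by
  have hb := h.big; have hbud := h.bud; have hi := h.st.hi; have hav := h.av; have := h.hε; have := h.q2
  have h4 := cc_ge (n := X.card) (k := k) (i := i) (j := Av.card + 1) (by omega)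
  have h5 : CC X.card k i ≤ cc X.card k i (Av.card + 1) + (Av.card + 1 : ℕ) * CC X.card k (i+1) := by
    unfold CC; exact_mod_cast h4
  have h6 : ((Av.card + 1 : ℕ):ℝ) ≤ r := by exact_mod_cast (by omega : Av.card + 1 ≤ r)
  have h7 := mul_le_mul_of_nonneg_right h6 (CC_nonneg X.card k (i+1))
  obtain ⟨h10, h11, h12⟩ := h.kr2; have := h.st.Cpos
  refine ⟨by linarith, ?_⟩
  unfold CC; exact_mod_cast cc_anti (Nat.zero_le _)

lemma case_full (h : EXH X k r i q ε H W U Av Z Av' P p) (hMH : MM X k W U Av ε ⊆ H) (dfc : Finset ℕ → ℝ)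
    (hd0 : ∀ A ∈ H, 0 ≤ dfc A) (hO : ∀ A ∈ H \ MM X k W U Av ε, ∀ u ∈ U, ¬ W.erase u ⊆ A)
    (hd2 : q = 2 → ∀ A ∈ H \ MM X k W U Av ε, 2 ≤ (U \ A).card → 9/10 * CC X.card k i ≤ dfc A) :
    ∃ G, pet X k Z Av' P ⊆ G ∧ G ⊆ pet X k Z Av' P ∪ npet X k Z Av' P p ∧ G.card = H.card ∧ 
      ip H H - 2 * ∑ A ∈ H, dfc A ≤ ip G G := by
  obtain ⟨G, a1, a2, a3⟩ := Cmp.exists (k := k) (X := X) (Z := Z) (Av := Av') (P := P) (p := p) _ subset_rfl Finset.subset_union_left h.pet_le h.M3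
  obtain ⟨Hs, b1, b2, b3⟩ := Cmp.exists G a1 a2 (s := H.card) (by rw [a3]; exact Finset.card_le_card hMH) h.rho3
  refine ⟨Hs, a1.trans b1, b2, b3, ?_⟩
  have ex := h.cmp_exact a1 a2 a3
  have e1 := ip_sdiff_self hMH
  have e2 := ip_sdiff_self b1
  have hC := h.st.Cpos
  set M : ℝ := ((MM X k W U Av ε).card : ℝ) with hM
  set x : ℝ := H.card - M with hx
  have x0 : 0 ≤ x := by
    have : (MM X k W U Av ε).card ≤ (H.card : ℝ) := by exact_mod_cast Finset.card_le_card hMH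
    linarith
  have cx1 : ((H \ (MM X k W U Av ε)).card : ℝ) = x := by
    rw [Finset.card_sdiff_of_subset hMH, Nat.cast_sub (Finset.card_le_card hMH)]
  have cx2 : ((Hs \ G).card : ℝ) = x := by
    rw [Finset.card_sdiff_of_subset b1, Nat.cast_sub (Finset.card_le_card b1), b3, a3]
  obtain ⟨dg, hdg⟩ : ∃ dg : ℝ, dg = U.card * cc X.card k (i+1) (Av.card+1) + ε * cc X.card k (i+2) Av.card := ⟨_, rfl⟩
  have hdg' := hdg; rw [h.hU] at hdg'
  obtain ⟨lam, hlam⟩ : ∃ lam : ℝ, lam = (cc X.card k (Z.card+1) Av'.card : ℝ) - cc X.card k (Z.card+1) (Av'.card + q) := ⟨_, rfl⟩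
  obtain ⟨nf, dgC⟩ := h.num_final hdg' hlam
  have hMR := h.MR
  rw [← hM] at hMR
  obtain ⟨hX1, hX2⟩ := h.X0_bd
  have w1 : ∀ A ∈ H \ MM X k W U Av ε, wt (MM X k W U Av ε) A - dfc A ≤ (i - 1) * M + ε * cc X.card k (i+1) Av.card + (k - i) * dg := by
    intro A hA
    have hAH := (Finset.mem_sdiff.1 hA).1
    have hw := h.m.wt_MM (k := k) h.hW h.hε _ _ dg hM rfl hdg (h.st.hH hAH)
    have hab : 1 ≤ ((W \ U) \ A).card ∨ 2 ≤ (U \ A).card := by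
      by_contra hcon
      push Not at hcon
      have hc1 : (W \ U) \ A = ∅ := by rw [← Finset.card_eq_zero]; omega
      have hWU : ∀ w ∈ W, w ∉ U → w ∈ A := fun w hw hu => by
        by_contra hwA
        have : w ∈ (W \ U) \ A := by simp [hw, hu, hwA]
        rw [hc1] at this; simp at this
      obtain ⟨u, hu, hu2⟩ : ∃ u ∈ U, U \ A ⊆ {u} := by
        rcases (U \ A).eq_empty_or_nonempty with h0 | ⟨u, hu⟩
        · obtain ⟨u, hu⟩ := Finset.card_pos.1 (show 0 < U.card by rw [h.hU]; have := h.q2; omega)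
          exact ⟨u, hu, by rw [h0]; simp⟩
        · refine ⟨u, (Finset.mem_sdiff.1 hu).1, fun v hv => ?_⟩
          rw [Finset.mem_singleton]
          exact Finset.card_le_one.1 (by omega) v hv u hu
      refine hO A hA u hu fun w hw => ?_
      obtain ⟨h1, h2⟩ := Finset.mem_erase.1 hw
      by_cases hwU : w ∈ U
      · by_contra hwA
        exact h1 (Finset.mem_singleton.1 (hu2 (Finset.mem_sdiff.2 ⟨hwU, hwA⟩)))
      · exact hWU w h2 hwU
    have hal := ab_alg (C := CC X.card k i) (M := M) (X0 := cc X.card k i (Av.card+1)) (dg := dg) (d := dfc A) hab h.q2 (by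
      rw [hMR]; have : (0:ℝ) ≤ ε * cc X.card k (i+1) Av.card := by positivity
      linarith) dgC hX1 hX2 hC (hd0 A hAH) (fun e => hd2 e A hA)
    rw [h.hU] at hw
    set α : ℝ := (((W \ U) \ A).card : ℝ)
    set β : ℝ := ((U \ A).card : ℝ)
    have e3 : ((i:ℝ) + 1 - q - α) * M + (q - β) * (M - cc X.card k i (Av.card+1)) = (i - α) * M + ε * cc X.card k (i+1) Av.card - β * (M - cc X.card k i (Av.card+1)) := by
      rw [hMR]; ring
    rw [e3] at hw; linarith
  have w2 : ip (H \ MM X k W U Av ε) (MM X k W U Av ε) - ∑ A ∈ H, dfc A ≤ x * ((i - 1) * M + ε * cc X.card k (i+1) Av.card + (k - i) * dg) := by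
    have h1 : ∑ A ∈ H \ MM X k W U Av ε, dfc A ≤ ∑ A ∈ H, dfc A := 
      Finset.sum_le_sum_of_subset_of_nonneg Finset.sdiff_subset fun A hA _ => hd0 A hA
    have h2 := Finset.sum_le_card_nsmul _ _ _ w1
    rw [nsmul_eq_mul, cx1, Finset.sum_sub_distrib] at h2
    unfold ip; linarith
  have ho : x ≤ r * CC X.card k (i+1) := by
    have h1 := h.rho2
    have h2 : ((pet X k Z Av' P).card : ℝ) ≤ M := by rw [hM]; exact_mod_cast h.pet_le
    linarith
  have w3 : ip (H \ MM X k W U Av ε) (H \ MM X k W U Av ε) ≤ i * x^2 + 61/59 * (x * CC X.card k (i+1)) := by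
    have hs : H \ MM X k W U Av ε ⊆ X.powersetCard k := Finset.sdiff_subset.trans h.st.hH
    have h1 := ip_le_PP' (X := X) (i := i+1) (by omega) (H := H \ MM X k W U Av ε) (fun A hA => (Finset.mem_powersetCard.1 (hs hA)).1)
    have h2 := PP_le (i := i+1) h.st.N (by omega) (by have := h.bud; have := h.q2; omega) hs (by rw [cx1]; exact ho)
    rw [cx1] at h1 h2
    push_cast at h1; linarith
  have hEn : ∀ B ∈ Hs \ G, B ∈ npet X k Z Av' P p := fun B hB => by
    have hB' := Finset.mem_sdiff.1 hB
    rcases Finset.mem_union.1 (b2 hB'.1) with h' | h'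
    · exact absurd (a1 h') hB'.2
    · exact h'
  have w4 : x * ((i - 1) * M + (k - i + 1) * lam) ≤ ip (Hs \ G) G := by
    rw [← cx2]; unfold ip
    rw [← nsmul_eq_mul]
    refine Finset.card_nsmul_le_sum _ _ _ fun B hB => ?_
    have hBc := mem_cyl.1 (hEn B hB)
    have hBX := Finset.mem_powersetCard.1 hBc.1
    have hZB : Z ⊆ B := (Finset.subset_insert _ _).trans hBc.2.1
    rw [h.cm.wt_eq a1 a2 hZB, h.zr, a3]
    have hd : ∀ y ∈ B \ Z, lam ≤ deg G {y} := by
      intro y hy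
      have hy := Finset.mem_sdiff.1 hy
      have := (h.cm.deg_ge a1 a2 (hBX.1 hy.1) hy.2 (Finset.disjoint_right.1 hBc.2.2 hy.1)).1
      rw [h.pc, ← hlam] at this; exact this
    have h7 := Finset.card_nsmul_le_sum _ _ _ hd
    rw [nsmul_eq_mul, Finset.card_sdiff_of_subset hZB, Nat.cast_sub (Finset.card_le_card hZB), hBX.2, h.zr] at h7
    linarith
  have w5 : i * x^2 ≤ ip (Hs \ G) (Hs \ G) := by
    rw [← cx2]
    refine ip_ge fun A hA B hB => ?_
    have h1 := (mem_cyl.1 (hEn A hA)).2.1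
    have h2 := (mem_cyl.1 (hEn B hB)).2.1
    have := Finset.card_le_card (Finset.subset_inter h1 h2)
    rw [Finset.card_insert_of_notMem h.cm.pZ, h.zc] at this
    exact_mod_cast this
  have w6 := mul_le_mul_of_nonneg_left nf x0
  linarith

end EXH
end SI

namespace SI

lemma Num.big {n k r : ℕ} (h : Num n k r) : 72 * (k + r) ≤ n := by
  have h1 := h.hk; have h2 := h.hr; have h3 := h.hn
  have : 1 ≤ k^2 * r := Nat.one_le_iff_ne_zero.2 (by positivity)
  calc 72 * (k+r) = 72 * 1 * (k+r) := by ring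
    _ ≤ 72 * (k^2 * r) * (k+r) := by gcongr
    _ = 72 * k^2 * r * (k+r) := by ring
    _ ≤ n := h3.le

/-- typical sets -/
def TI (Z0 Av D A : Finset ℕ) : Prop := Z0 ⊆ A ∧ Disjoint Av A ∧ (D \ A).card = min 1 D.card

lemma TI_of {Z0 Av D Y A : Finset ℕ} (hY : Y ⊆ D) (hYc : Y.card = min 1 D.card) (h1 : Z0 ∪ (D \ Y) ⊆ A) (h2 : Disjoint (Av ∪ Y) A) :
    TI Z0 Av D A := by
  rw [Finset.disjoint_union_left] at h2
  refine ⟨Finset.subset_union_left.trans h1, h2.1, ?_⟩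
  rw [← hYc]; congr 1
  ext x
  rw [Finset.mem_sdiff]
  constructor
  · rintro ⟨a, b⟩; by_contra hx
    exact b (h1 (Finset.mem_union_right _ (Finset.mem_sdiff.2 ⟨a, hx⟩)))
  · intro hx; exact ⟨hY hx, Finset.disjoint_left.1 h2.2 hx⟩

structure Stt (X : Finset ℕ) (k r : ℕ) (F Lf : Finset (Finset ℕ)) (Z0 Av D K : Finset ℕ) (κ0 c0 : ℕ) (ls : ℝ) : Prop where
  N : Num X.card k r
  opt : Opt X k F
  Lsub : Lf ⊆ F
  Z0X : Z0 ⊆ X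
  AvX : Av ⊆ X
  DX : D ⊆ X
  dZA : Disjoint Z0 Av
  dZD : Disjoint Z0 D
  dAD : Disjoint Av D
  Kc : K.card ≤ k + r
  hc0 : c0 + min 1 D.card = Z0.card + D.card
  s1 : ∀ A ∈ X.powersetCard k, TI Z0 Av D A → A ∉ Lf ∧ wt Lf A = ls
  s2 : ∀ A ∈ X.powersetCard k, A ∉ Lf → TI Z0 Av D A ∨ (κ0 + 2 ≤ (A ∩ K).card ∧ wt Lf A + 9/10 * CC X.card k (c0+2) ≤ ls) ∨
    wt Lf A + 1/2 * CC X.card k (c0+1) ≤ ls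
  s3 : ∀ T : Finset ℕ, TI Z0 Av D T → (T ∩ K).card ≤ κ0
  s4 : ∀ A ∈ X.powersetCard k, A ∉ Lf → Z0 ⊆ A → (D \ A).card ≤ 1 → TI Z0 Av D A
  com : ∀ Zc : Finset ℕ, Z0 ⊆ Zc → (D \ Zc).card ≤ 1 → 1 ≤ Zc.card → ∃ x ∈ Zc, ∀ A ∈ Lf, x ∈ A
  star : ∀ G ⊆ X.powersetCard k, G.card = F.card → ∀ x, (∀ A ∈ G, x ∈ A) → ip G G < ip F F

structure Stg (X : Finset ℕ) (k r : ℕ) (F Lf : Finset (Finset ℕ)) (Z0 Av D K : Finset ℕ) (κ0 c0 : ℕ) (ls : ℝ) (z q av : ℕ) : Prop where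
  t : Stt X k r F Lf Z0 Av D K κ0 c0 ls
  hz : c0 + 1 ≤ z
  hzk : z + 1 ≤ k
  hq : 1 ≤ q
  hav : av = Av.card + min 1 D.card
  bud : z + q + av ≤ r
  rho1 : cc X.card k z av ≤ (F \ Lf).card + cc X.card k z (av + q)
  rho2 : ((F \ Lf).card : ℝ) + cc X.card k z (av+q) ≤ cc X.card k z av + r * CC X.card k (z+2)

namespace Stg
variable {X : Finset ℕ} {k r : ℕ} {F Lf : Finset (Finset ℕ)} {Z0 Av D K : Finset ℕ} {κ0 c0 : ℕ} {ls : ℝ} {z q av : ℕ}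

lemma HX (h : Stg X k r F Lf Z0 Av D K κ0 c0 ls z q av) : F \ Lf ⊆ X.powersetCard k := Finset.sdiff_subset.trans h.t.opt.1

lemma CC_pos' (h : Stg X k r F Lf Z0 Av D K κ0 c0 ls z q av) : 0 < CC X.card k (z+1) := CC_pos h.hzk h.t.N.kn'

lemma stp (h : Stg X k r F Lf Z0 Av D K κ0 c0 ls z q av) (j : ℕ) : 72 * ((k + r) * CC X.card k (j+1)) ≤ CC X.card k j ∧ 
    72 * (k * r * CC X.card k (j+1)) ≤ CC X.card k j ∧ 72 * (r * CC X.card k (j+1)) ≤ CC X.card k j ∧ 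
    72 * (r^2 * CC X.card k (j+1)) ≤ CC X.card k j ∧ 72 * CC X.card k (j+1) ≤ CC X.card k j := by
  have h1 := h.t.N.step j
  have hk : (1:ℝ) ≤ k := by exact_mod_cast h.t.N.hk
  have hr : (1:ℝ) ≤ r := by exact_mod_cast h.t.N.hr
  have b0 := CC_nonneg X.card k (j+1)
  have hkr : 1 ≤ (k:ℝ) * r := by nlinarith
  have g : ∀ x : ℝ, x ≤ k * r * (k + r) → 72 * (x * CC X.card k (j+1)) ≤ CC X.card k j := by
    intro x hx
    have := mul_le_mul_of_nonneg_right hx b0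
    linarith
  have p0 : 0 ≤ ((k:ℝ) * r - 1) * (k + r) := mul_nonneg (by linarith) (by linarith)
  have p1 : 0 ≤ ((k:ℝ) * r) * (k + r - 1) := mul_nonneg (by linarith) (by linarith)
  have p2 : 0 ≤ ((k:ℝ) - 1) * r * r := mul_nonneg (mul_nonneg (by linarith) (by linarith)) (by linarith)
  have p3 : 0 ≤ (k:ℝ) * k * r := by positivity
  refine ⟨g _ (by linarith), g _ (by linarith), g _ (by linarith), g _ (by linarith), ?_⟩
  have := g 1 (by linarith)
  linarith

lemma rho_le (h : Stg X k r F Lf Z0 Av D K κ0 c0 ls z q av) : ((F \ Lf).card : ℝ) ≤ (q + 1/72) * CC X.card k (z+1) := by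
  have h0 := h.bud; have h1 := h.t.N.kn; have h9 := h.hzk
  have h2 := (pet_bounds (n := X.card) (k := k) (i := z) (j := av) (q := q) (by omega) (by omega)).1
  have h3 : (cc X.card k (z+1) av : ℝ) ≤ CC X.card k (z+1) := by unfold CC; exact_mod_cast cc_anti (Nat.zero_le _)
  have h4 := mul_le_mul_of_nonneg_left h3 (Nat.cast_nonneg (α := ℝ) q)
  have h5 := (h.stp (z+1)).2.2.1
  have h6 := h.rho2
  rw [show z + 1 + 1 = z + 2 by omega] at h5
  linarith

lemma krho (h : Stg X k r F Lf Z0 Av D K κ0 c0 ls z q av) : (k:ℝ) * (F \ Lf).card < 1/2 * CC X.card k (c0+1) := by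
  have h1 := h.rho_le
  have h2 := (h.stp (c0+1)).2.1
  have h3 : CC X.card k (z+1) ≤ CC X.card k (c0+1+1) := CC_anti h.t.N.kn' (by have := h.hz; omega)
  have hr : (1:ℝ) ≤ r := by exact_mod_cast h.t.N.hr
  have hqr : (q:ℝ) ≤ r := by exact_mod_cast (by have := h.bud; omega : q ≤ r)
  have h4 : ((q:ℝ) + 1/72) * CC X.card k (z+1) ≤ (2 * r) * CC X.card k (c0+1+1) :=
    mul_le_mul (by linarith) h3 (CC_nonneg _ _ _) (by linarith)
  have h5 : (k:ℝ) * (F \ Lf).card ≤ k * ((2 * r) * CC X.card k (c0+1+1)) := mul_le_mul_of_nonneg_left (h1.trans h4) (Nat.cast_nonneg _)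
  have h6 : 0 < CC X.card k (c0+1) := CC_pos (by have := h.hz; have := h.hzk; omega) h.t.N.kn'
  linarith

lemma dfc_nonneg (h : Stg X k r F Lf Z0 Av D K κ0 c0 ls z q av) : ∀ A ∈ F \ Lf, 0 ≤ ls - wt Lf A := by
  intro A hA
  have := CC_nonneg X.card k (c0+1); have := CC_nonneg X.card k (c0+2)
  rcases h.t.s2 A (h.HX hA) (Finset.mem_sdiff.1 hA).2 with h1 | h1 | h1
  · rw [(h.t.s1 A (h.HX hA) h1).2]; linarith
  · linarith [h1.2]
  · linarith

lemma wtF (h : Stg X k r F Lf Z0 Av D K κ0 c0 ls z q av) (A) : wt F A = wt Lf A + wt (F \ Lf) A := wt_sdiff h.t.Lsub A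

/-- comparison with typical families -/
lemma key (h : Stg X k r F Lf Z0 Av D K κ0 c0 ls z q av) {Y Zc P : Finset ℕ} {p : ℕ} (hY : Y ⊆ D) (hYc : Y.card = min 1 D.card)
    (hC : Z0 ∪ (D \ Y) ⊆ Zc) (hz : Zc.card = z) {G : Finset (Finset ℕ)}
    (h2 : G ⊆ pet X k Zc (Av ∪ Y) P ∪ npet X k Zc (Av ∪ Y) P p) (hG : G.card = (F \ Lf).card) :
    ip G G < ip (F \ Lf) (F \ Lf) - 2 * ∑ A ∈ F \ Lf, (ls - wt Lf A) := by
  have hGs := Cmp.sub_cyl h2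
  have hTI : ∀ A ∈ G, TI Z0 Av D A := fun A hA => by
    have := mem_cyl.1 (hGs hA)
    exact TI_of hY hYc (hC.trans this.2.1) this.2.2
  have hGX : G ⊆ X.powersetCard k := hGs.trans cyl_sub
  have dj : Disjoint Lf G := by
    rw [Finset.disjoint_right]; intro A hA
    exact (h.t.s1 A (hGX hA) (hTI A hA)).1
  obtain ⟨x, hx, hxL⟩ := h.t.com Zc (Finset.subset_union_left.trans hC) (by
    calc (D \ Zc).card ≤ Y.card := Finset.card_le_card (fun x hx => by
          have := Finset.mem_sdiff.1 hx
          by_contra hxY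
          exact this.2 (hC (Finset.mem_union_right _ (Finset.mem_sdiff.2 ⟨this.1, hxY⟩))))
      _ ≤ 1 := by rw [hYc]; exact min_le_left _ _) (by have := h.hz; omega)
  have := h.t.star (Lf ∪ G) (Finset.union_subset (h.t.Lsub.trans h.t.opt.1) hGX) (by
    rw [Finset.card_union_of_disjoint dj, hG, add_comm]; exact Finset.card_sdiff_add_card_eq_card h.t.Lsub) x (by
    intro A hA
    rcases Finset.mem_union.1 hA with h1 | h1
    · exact hxL A h1
    · exact (mem_cyl.1 (hGs h1)).2.1 hx)
  rw [ip_union_self dj, ip_sdiff_self h.t.Lsub] at this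
  have e1 : ip G Lf = (F \ Lf).card * ls := by
    unfold ip; rw [Finset.sum_congr rfl (fun A hA => (h.t.s1 A (hGX hA) (hTI A hA)).2)]; simp [hG]
  have e2 : ∑ A ∈ F \ Lf, (ls - wt Lf A) = (F \ Lf).card * ls - ip (F \ Lf) Lf := by
    rw [Finset.sum_sub_distrib]; simp [ip]
  rw [e2]; linarith

/-- supply of fresh elements -/
lemma fresh (h : Stg X k r F Lf Z0 Av D K κ0 c0 ls z q av) (Bad : Finset ℕ) (hB : Bad.card ≤ 10 * (k + r)) :
    ∃ P p, P ⊆ X ∧ Disjoint P Bad ∧ P.card = q ∧ p ∈ X ∧ p ∉ P ∧ p ∉ Bad := by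
  have h1 := h.t.N.big; have h0 := h.bud; have h2 := h.t.N.hk
  have h3 := Finset.le_card_sdiff Bad X
  obtain ⟨P', hP', hc⟩ := Finset.exists_subset_card_eq (s := X \ Bad) (n := q + 1) (by omega)
  obtain ⟨p, hp⟩ := Finset.card_pos.1 (show 0 < P'.card by omega)
  refine ⟨P'.erase p, p, ?_, ?_, ?_, ?_, ?_, ?_⟩
  · exact (Finset.erase_subset _ _).trans (hP'.trans Finset.sdiff_subset)
  · exact (Finset.sdiff_disjoint).mono_left ((Finset.erase_subset _ _).trans hP')
  · rw [Finset.card_erase_of_mem hp, hc]; omega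
  · exact (Finset.mem_sdiff.1 (hP' hp)).1
  · exact Finset.notMem_erase _ _
  · exact (Finset.mem_sdiff.1 (hP' hp)).2

lemma Zbig (h : Stg X k r F Lf Z0 Av D K κ0 c0 ls z q av) : (Z0 ∪ D).card = c0 + min 1 D.card := by
  rw [Finset.card_union_of_disjoint h.t.dZD, h.t.hc0]

lemma exY (D : Finset ℕ) : ∃ Y ⊆ D, Y.card = min 1 D.card := Finset.exists_subset_card_eq (min_le_right _ _)

lemma avY (h : Stg X k r F Lf Z0 Av D K κ0 c0 ls z q av) {Y} (hY : Y ⊆ D) (hYc : Y.card = min 1 D.card) : (Av ∪ Y).card = av := by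
  rw [Finset.card_union_of_disjoint (h.t.dAD.mono_right hY), hYc, h.hav]

lemma rho3 (h : Stg X k r F Lf Z0 Av D K κ0 c0 ls z q av) : (r:ℝ) * CC X.card k (z+2) ≤ cc X.card k (z+1) (av+q) := by
  have h0 := h.bud; have h1 := h.t.N.kn; have h9 := h.hzk
  have h4 := cc_ge (n := X.card) (k := k) (i := z+1) (j := av + q) (by omega)
  have h5 : CC X.card k (z+1) ≤ cc X.card k (z+1) (av + q) + (av + q : ℕ) * CC X.card k (z+2) := by
    unfold CC; exact_mod_cast h4
  have h6 : ((av + q : ℕ):ℝ) ≤ r := by exact_mod_cast (by omega : av + q ≤ r)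
  have h7 := mul_le_mul_of_nonneg_right h6 (CC_nonneg X.card k (z+2))
  have h8 := (h.stp (z+1)).2.2.1
  have : 0 ≤ r * CC X.card k (z+2) := mul_nonneg (Nat.cast_nonneg _) (CC_nonneg _ _ _)
  rw [show z + 1 + 1 = z + 2 by omega] at h8
  linarith

/-- the basic inequality -/
lemma basic (h : Stg X k r F Lf Z0 Av D K κ0 c0 ls z q av) :
    (z:ℝ) * ((F \ Lf).card:ℝ)^2 + (q - 1/36) * CC X.card k (z+1)^2 + 2 * ∑ A ∈ F \ Lf, (ls - wt Lf A) ≤ ip (F \ Lf) (F \ Lf) := by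
  obtain ⟨Y, hY, hYc⟩ := exY D
  have h1 := h.t.N.big; have h0 := h.bud; have h2 := h.t.N.hk; have hzk := h.hzk; have hz := h.hz
  have hav := h.avY hY hYc
  have hC0 : (Z0 ∪ (D \ Y)).card = c0 := by
    rw [Finset.card_union_of_disjoint (h.t.dZD.mono_right Finset.sdiff_subset), Finset.card_sdiff_of_subset hY, hYc]
    have := h.t.hc0; have := min_le_right 1 D.card; omega
  have hC0X : Z0 ∪ (D \ Y) ⊆ X := Finset.union_subset h.t.Z0X (Finset.sdiff_subset.trans h.t.DX)
  have dj0 : Disjoint (Z0 ∪ (D \ Y)) (Av ∪ Y) := by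
    rw [Finset.disjoint_union_left, Finset.disjoint_union_right, Finset.disjoint_union_right]
    exact ⟨⟨h.t.dZA, h.t.dZD.mono_right hY⟩, h.t.dAD.symm.mono_left Finset.sdiff_subset, Finset.sdiff_disjoint⟩
  obtain ⟨Zc, hZc1, hZc2, hZc3⟩ := Finset.exists_subsuperset_card_eq (s := Z0 ∪ (D \ Y)) (t := X \ (Av ∪ Y)) (n := z)
    (fun x hx => Finset.mem_sdiff.2 ⟨hC0X hx, Finset.disjoint_left.1 dj0 hx⟩) (by omega) (by
      have := Finset.le_card_sdiff (Av ∪ Y) X; omega)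
  obtain ⟨P, p, f1, f2, f3, f4, f5, f6⟩ := h.fresh (Zc ∪ (Av ∪ Y)) (by
    have := Finset.card_union_le Zc (Av ∪ Y); omega)
  rw [Finset.disjoint_union_right] at f2
  rw [Finset.mem_union, not_or] at f6
  have cm : Cmp X Zc (Av ∪ Y) P p := ⟨hZc2.trans Finset.sdiff_subset, Finset.union_subset h.t.AvX (hY.trans h.t.DX), f1, f4,
    f6.1, f6.2, f5, (Finset.sdiff_disjoint).mono_left hZc2, f2.1.symm, f2.2.symm⟩
  have pc := cm.card_pet (k := k)
  have nc := cm.card_npet (k := k)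
  rw [hZc3, hav, f3] at pc nc
  obtain ⟨G, g1, g2, g3⟩ := Cmp.exists (k := k) (X := X) (Z := Zc) (Av := Av ∪ Y) (P := P) (p := p) _ subset_rfl Finset.subset_union_left
    (s := (F \ Lf).card) (by have := h.rho1; omega) (by
      have r1 := h.rho2; have r2 := h.rho3
      rw [nc]
      have pcR : ((pet X k Zc (Av ∪ Y) P).card : ℝ) + cc X.card k z (av + q) = cc X.card k z av := by exact_mod_cast pc
      exact_mod_cast (by linarith : ((F \ Lf).card : ℝ) ≤ (pet X k Zc (Av ∪ Y) P).card + cc X.card k (z+1) (av + q)))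
  have hk := h.key hY hYc hZc1 hZc3 g2 g3
  obtain ⟨R, hR, e, -⟩ := cm.ip_ge g1 g2 (g2.trans EXH.pnsub)
  rw [e, hZc3, f3, hav, g3] at hk
  have ha : CC X.card k (z+1) - r * CC X.card k (z+2) ≤ cc X.card k (z+1) av := by
    have h4 := cc_ge (n := X.card) (k := k) (i := z+1) (j := av) (by omega)
    have h5 : CC X.card k (z+1) ≤ cc X.card k (z+1) av + av * CC X.card k (z+2) := by
      unfold CC; exact_mod_cast h4
    have h6 : (av:ℝ) ≤ r := by exact_mod_cast (by omega : av ≤ r)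
    have h7 := mul_le_mul_of_nonneg_right h6 (CC_nonneg X.card k (z+2))
    linarith
  have s1 := (h.stp (z+1)).2.2.1; have s2 := (h.stp (z+1)).2.2.2.1
  rw [show z + 1 + 1 = z + 2 by omega] at s1 s2
  have hC := h.CC_pos'
  have hqr : (q:ℝ) ≤ r := by exact_mod_cast (by omega : q ≤ r)
  have b0 := CC_nonneg X.card k (z+2)
  have q0 : (0:ℝ) ≤ q := Nat.cast_nonneg _
  have r0 : (0:ℝ) ≤ r := Nat.cast_nonneg _
  set C := CC X.card k (z+1)
  set b := CC X.card k (z+2)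
  set a : ℝ := (cc X.card k (z+1) av : ℝ)
  have fin : (q - 1/36) * C^2 ≤ q * a^2 := by
    have h1 : 0 ≤ C - r * b := by linarith
    have h2 : (C - r*b)^2 ≤ a^2 := by gcongr
    have h3 : C^2 - 2 * (r * b) * C ≤ a^2 := by have := sq_nonneg (r * b); linarith
    have h4 := mul_le_mul_of_nonneg_left h3 q0
    have h5 : (q:ℝ) * (r * b) ≤ r^2 * b := by
      have := mul_le_mul_of_nonneg_right hqr (mul_nonneg r0 b0); linarith
    have h6 : (q:ℝ) * (r * b) * C ≤ C/72 * C := mul_le_mul_of_nonneg_right (by linarith) hC.le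
    linarith
  linarith

lemma sth (h : Stg X k r F Lf Z0 Av D K κ0 c0 ls z q av) : STH X k r (z+1) q (F \ Lf) where
  N := h.t.N
  hi := by omega
  hir := by have := h.bud; have := h.hq; omega
  hik := h.hzk
  hq := h.hq
  hqr := by have := h.bud; omega
  hH := h.HX
  hρ := h.rho_le
  hS := by
    have := h.basic
    have h2 := Finset.sum_nonneg h.dfc_nonneg
    push_cast; linarith

end Stg
end SI

namespace SI
namespace Stg
variable {X : Finset ℕ} {k r : ℕ} {F Lf : Finset (Finset ℕ)} {Z0 Av D K : Finset ℕ} {κ0 c0 : ℕ} {ls : ℝ} {z q av : ℕ}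

lemma cardC0 (h : Stg X k r F Lf Z0 Av D K κ0 c0 ls z q av) {Y} (hY : Y ⊆ D) (hYc : Y.card = min 1 D.card) : 
    (Z0 ∪ (D \ Y)).card = c0 := by
  rw [Finset.card_union_of_disjoint (h.t.dZD.mono_right Finset.sdiff_subset), Finset.card_sdiff_of_subset hY, hYc]
  have := h.t.hc0; have := min_le_right 1 D.card; omega

lemma C0X (h : Stg X k r F Lf Z0 Av D K κ0 c0 ls z q av) (Y) : Z0 ∪ (D \ Y) ⊆ X := 
  Finset.union_subset h.t.Z0X (Finset.sdiff_subset.trans h.t.DX)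

lemma dj0 (h : Stg X k r F Lf Z0 Av D K κ0 c0 ls z q av) {Y} (hY : Y ⊆ D) : Disjoint (Z0 ∪ (D \ Y)) (Av ∪ Y) := by
  rw [Finset.disjoint_union_left, Finset.disjoint_union_right, Finset.disjoint_union_right]
  exact ⟨⟨h.t.dZA, h.t.dZD.mono_right hY⟩, h.t.dAD.symm.mono_left Finset.sdiff_subset, Finset.sdiff_disjoint⟩

lemma Dk (h : Stg X k r F Lf Z0 Av D K κ0 c0 ls z q av) : D.card ≤ k := by
  have := h.t.hc0; have := h.hz; have := h.hzk; have := min_le_left 1 D.card; omega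

lemma exB (h : Stg X k r F Lf Z0 Av D K κ0 c0 ls z q av) : ∃ B ∈ X.powersetCard k, TI Z0 Av D B ∧ B ∉ F := by
  obtain ⟨Y, hY, hYc⟩ := exY D
  by_contra hcon
  push Not at hcon
  have h1 : cyl X k (Z0 ∪ (D \ Y)) (Av ∪ Y) ⊆ F \ Lf := by
    intro B hB
    have hB' := mem_cyl.1 hB
    have hT := TI_of hY hYc hB'.2.1 hB'.2.2
    exact Finset.mem_sdiff.2 ⟨hcon B hB'.1 hT, (h.t.s1 B hB'.1 hT).1⟩
  have h2 := Finset.card_le_card h1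
  rw [card_cyl (h.C0X Y) (Finset.union_subset h.t.AvX (hY.trans h.t.DX)) (h.dj0 hY), h.cardC0 hY hYc, h.avY hY hYc] at h2
  have h0 := h.bud; have hn := h.t.N.kn; have hz := h.hz; have hzk := h.hzk
  have h3 := cc_ge (n := X.card) (k := k) (i := c0) (j := av) (by omega)
  have h4 : CC X.card k c0 ≤ cc X.card k c0 av + av * CC X.card k (c0+1) := by unfold CC; exact_mod_cast h3
  have h5 : (av:ℝ) ≤ r := by exact_mod_cast (by omega : av ≤ r)
  have h6 := mul_le_mul_of_nonneg_right h5 (CC_nonneg X.card k (c0+1))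
  have h7 := (h.stp c0).2.2.1
  have h8 := (h.stp c0).2.2.2.2
  have h9 := h.krho
  have hk : (1:ℝ) ≤ k := by exact_mod_cast h.t.N.hk
  have h10 : ((F \ Lf).card : ℝ) ≤ k * (F \ Lf).card := by
    have : (0:ℝ) ≤ (F \ Lf).card := Nat.cast_nonneg _
    nlinarith
  have h11 : (cc X.card k c0 av : ℝ) ≤ (F \ Lf).card := by exact_mod_cast h2
  have h12 : 0 < CC X.card k c0 := CC_pos (by omega) h.t.N.kn'
  linarith

lemma kinds (h : Stg X k r F Lf Z0 Av D K κ0 c0 ls z q av) : ∀ A ∈ F \ Lf, TI Z0 Av D A ∨ 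
    (κ0 + 2 ≤ (A ∩ K).card ∧ 9/10 * CC X.card k (z+1) ≤ ls - wt Lf A) := by
  intro A hA
  obtain ⟨B, hB, hBT, hBF⟩ := h.exB
  have hA' := Finset.mem_sdiff.1 hA
  rcases h.t.s2 A (h.HX hA) hA'.2 with h1 | h1 | h1
  · exact Or.inl h1
  · refine Or.inr ⟨h1.1, ?_⟩
    have : CC X.card k (z+1) ≤ CC X.card k (c0+2) := CC_anti h.t.N.kn' (by have := h.hz; omega)
    linarith [h1.2]
  · exfalso
    have h2 := h.t.opt.threshold hA'.1 hBF hB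
    rw [h.wtF, h.wtF, (h.t.s1 B hB hBT).2] at h2
    have h3 := wt_nonneg (F \ Lf) B
    have h4 : wt (F \ Lf) A ≤ k * (F \ Lf).card := wt_le (h.sth.crd A hA)
    have h5 := h.krho
    linarith

open Classical in
lemma fII (h : Stg X k r F Lf Z0 Av D K κ0 c0 ls z q av) : 
    ((((F \ Lf).filter (fun A => ¬ TI Z0 Av D A)).card : ℕ) : ℝ) ≤ (0.019 * q + 0.0235) * CC X.card k (z+1) := by
  have h1 := h.basic
  have h2 := ip_le_PP' (X := X) (i := z+1) (by omega) h.sth.sub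
  have h3 := h.sth.Ple
  have h4 := h.rho_le
  have hC := h.CC_pos'
  push_cast at h2
  have h5 : 9/10 * CC X.card k (z+1) * (((F \ Lf).filter (fun A => ¬ TI Z0 Av D A)).card : ℝ) ≤ ∑ A ∈ F \ Lf, (ls - wt Lf A) := by
    calc _ = ∑ A ∈ (F \ Lf).filter (fun A => ¬ TI Z0 Av D A), 9/10 * CC X.card k (z+1) := by
          rw [Finset.sum_const, nsmul_eq_mul]; ring
      _ ≤ ∑ A ∈ (F \ Lf).filter (fun A => ¬ TI Z0 Av D A), (ls - wt Lf A) := Finset.sum_le_sum fun A hA => by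
          have hA' := Finset.mem_filter.1 hA
          rcases h.kinds A hA'.1 with hk | hk
          · exact absurd hk hA'.2
          · exact hk.2
      _ ≤ _ := Finset.sum_le_sum_of_subset_of_nonneg (Finset.filter_subset _ _) (fun A hA _ => h.dfc_nonneg A hA)
  set C := CC X.card k (z+1)
  set f : ℝ := (((F \ Lf).filter (fun A => ¬ TI Z0 Av D A)).card : ℝ)
  have h6 := mul_le_mul_of_nonneg_right h4 hC.le
  have h7 : C * f ≤ C * ((0.019 * q + 0.0235) * C) := by
    have hq : (1:ℝ) ≤ q := by exact_mod_cast h.hq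
    have : 0 ≤ C * C := by positivity
    have : 0 ≤ (q - 1) * (C * C) := mul_nonneg (by linarith) this
    nlinarith
  exact le_of_mul_le_mul_left h7 hC

lemma cnt (h : Stg X k r F Lf Z0 Av D K κ0 c0 ls z q av) {H' : Finset (Finset ℕ)} (hH : H' ⊆ F \ Lf) {T S : Finset ℕ} (hT : T.card = z+1)
    (hS : ∀ A ∈ H', T ⊆ A → ∃ x ∈ S, x ∉ T ∧ x ∈ A) : deg H' T ≤ S.card * CC X.card k (z+2) := by
  classical
  have h1 : deg H' T ≤ ∑ x ∈ S \ T, deg H' (insert x T) := by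
    simp only [deg_eq_sum]
    rw [Finset.sum_comm]
    refine Finset.sum_le_sum fun A hA => ?_
    split_ifs with hc
    · obtain ⟨x, hx, hxT, hxA⟩ := hS A hA hc
      have : (1:ℝ) = (if insert x T ⊆ A then (1:ℝ) else 0) := by rw [if_pos (Finset.insert_subset hxA hc)]
      refine this.le.trans ?_
      exact Finset.single_le_sum (f := fun x => if insert x T ⊆ A then (1:ℝ) else 0) (fun T _ => by positivity) (Finset.mem_sdiff.2 ⟨hx, hxT⟩)
    · exact Finset.sum_nonneg fun T _ => by positivity
  refine h1.trans ?_
  have h2 : ∑ x ∈ S \ T, deg H' (insert x T) ≤ (S \ T).card • CC X.card k (z+2) := Finset.sum_le_card_nsmul _ _ _ fun x hx => by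
    apply deg_big (hH.trans h.HX) h.t.N.kn'
    rw [Finset.card_insert_of_notMem (Finset.mem_sdiff.1 hx).2, hT]
  refine h2.trans ?_
  rw [nsmul_eq_mul]
  have := CC_nonneg X.card k (z+2)
  gcongr
  exact Finset.sdiff_subset

open Classical in
lemma cntTI (h : Stg X k r F Lf Z0 Av D K κ0 c0 ls z q av) {T : Finset ℕ} (hT : T.card = z+1) (hn : ¬ TI Z0 Av D T) : 
    deg ((F \ Lf).filter (fun A => TI Z0 Av D A)) T ≤ k * CC X.card k (z+2) := by
  have b0 := CC_nonneg X.card k (z+2)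
  have fs := Finset.filter_subset (fun A => TI Z0 Av D A) (F \ Lf)
  by_cases h1 : Z0 ⊆ T
  · by_cases h2 : Disjoint Av T
    · refine (h.cnt fs (S := D) hT ?_).trans ?_
      · intro A hA hTA
        have hA' := (Finset.mem_filter.1 hA).2.2.2
        have h3 : (D \ T).card ≠ min 1 D.card := fun h3 => hn ⟨h1, h2, h3⟩
        have h4 : (D \ A).card ≤ (D \ T).card := Finset.card_le_card (Finset.sdiff_subset_sdiff subset_rfl hTA)
        have h5 : ¬ (D \ T ⊆ D \ A) := fun hs => by
          have := Finset.card_le_card hs; omega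
        obtain ⟨x, hx, hxA⟩ := Finset.not_subset.1 h5
        have hx' := Finset.mem_sdiff.1 hx
        refine ⟨x, hx'.1, hx'.2, ?_⟩
        by_contra hc; exact hxA (Finset.mem_sdiff.2 ⟨hx'.1, hc⟩)
      · have : (D.card:ℝ) ≤ k := by exact_mod_cast h.Dk
        gcongr
    · refine (h.cnt fs (S := ∅) hT ?_).trans (by simp; positivity)
      intro A hA hTA
      exact absurd ((Finset.mem_filter.1 hA).2.2.1.mono_right hTA) h2
  · obtain ⟨x, hx, hxT⟩ := Finset.not_subset.1 h1
    refine (h.cnt fs (S := {x}) hT ?_).trans ?_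
    · intro A hA hTA
      exact ⟨x, by simp, hxT, (Finset.mem_filter.1 hA).2.1 hx⟩
    · have : (1:ℝ) ≤ k := by exact_mod_cast h.t.N.hk
      simp; nlinarith

open Classical in
lemma cntII (h : Stg X k r F Lf Z0 Av D K κ0 c0 ls z q av) {T : Finset ℕ} (hT : T.card = z+1) (hn : (T ∩ K).card ≤ κ0 + 1) : 
    deg ((F \ Lf).filter (fun A => ¬ TI Z0 Av D A)) T ≤ (k + r) * CC X.card k (z+2) := by
  have b0 := CC_nonneg X.card k (z+2)
  refine (h.cnt (Finset.filter_subset _ _) (S := K) hT ?_).trans ?_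
  · intro A hA hTA
    have hA' := Finset.mem_filter.1 hA
    rcases h.kinds A hA'.1 with hk | hk
    · exact absurd hk hA'.2
    · have : ¬ (A ∩ K ⊆ T ∩ K) := fun hs => by have := Finset.card_le_card hs; omega
      obtain ⟨x, hx, hxT⟩ := Finset.not_subset.1 this
      rw [Finset.mem_inter] at hx hxT
      exact ⟨x, hx.2, fun hc => hxT ⟨hc, hx.2⟩, hx.1⟩
  · have : (K.card:ℝ) ≤ k + r := by exact_mod_cast h.t.Kc
    gcongr

lemma kindT (h : Stg X k r F Lf Z0 Av D K κ0 c0 ls z q av) {T : Finset ℕ} (hT : T ∈ TT X k (z+1) (F \ Lf)) : 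
    TI Z0 Av D T ∨ κ0 + 2 ≤ (T ∩ K).card := by
  classical
  by_contra hcon
  push Not at hcon
  have hT' := mem_TT.1 hT
  have h1 := h.cntTI hT'.1.2 hcon.1
  have h2 := h.cntII hT'.1.2 (by omega)
  have h3 : deg (F \ Lf) T = deg ((F \ Lf).filter (fun A => TI Z0 Av D A)) T + deg ((F \ Lf).filter (fun A => ¬ TI Z0 Av D A)) T := by
    simp only [deg_eq_sum]
    rw [Finset.sum_filter_add_sum_filter_not]
  have h4 := (h.stp (z+1)).1
  rw [show z + 1 + 1 = z + 2 by omega] at h4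
  have hC := h.CC_pos'
  have b0 : 0 ≤ (r:ℝ) * CC X.card k (z+2) := mul_nonneg (Nat.cast_nonneg _) (CC_nonneg _ _ _)
  linarith [hT'.2]

lemma allTI (h : Stg X k r F Lf Z0 Av D K κ0 c0 ls z q av) : ∀ T ∈ TT X k (z+1) (F \ Lf), TI Z0 Av D T := by
  classical
  by_contra hcon
  push Not at hcon
  obtain ⟨T0, hT0, hn0⟩ := hcon
  have h0 := (h.kindT hT0).resolve_left hn0
  have hall : ∀ T ∈ TT X k (z+1) (F \ Lf), ¬ TI Z0 Av D T := by
    intro T hT hTI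
    have h1 := h.t.s3 T hTI
    have h2 := h.sth.clique hT0 hT
    have h3 := (mem_TT.1 hT0).1.2
    have h4 : T0 ∩ K ⊆ (T ∩ K) ∪ (T0 \ T) := by
      intro x hx; rw [Finset.mem_inter] at hx
      by_cases hxT : x ∈ T
      · exact Finset.mem_union_left _ (Finset.mem_inter.2 ⟨hxT, hx.2⟩)
      · exact Finset.mem_union_right _ (Finset.mem_sdiff.2 ⟨hx.1, hxT⟩)
    have h5 := (Finset.card_le_card h4).trans (Finset.card_union_le _ _)
    have h6 := Finset.card_sdiff_add_card_inter T0 T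
    omega
  have h1 : ((NN X k (z+1) (F \ Lf)).card : ℝ) ≤ (((F \ Lf).filter (fun A => ¬ TI Z0 Av D A)).card : ℝ) + 
      ∑ T ∈ TT X k (z+1) (F \ Lf), deg ((F \ Lf).filter (fun A => TI Z0 Av D A)) T := by
    have : NN X k (z+1) (F \ Lf) ⊆ (F \ Lf).filter (fun A => ¬ TI Z0 Av D A) ∪ 
        (TT X k (z+1) (F \ Lf)).biUnion (fun T => ((F \ Lf).filter (fun A => TI Z0 Av D A)).filter (fun A => T ⊆ A)) := by
      intro A hA
      obtain ⟨hA, T, hT, hTA⟩ := mem_NN.1 hA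
      by_cases hTI : TI Z0 Av D A
      · exact Finset.mem_union_right _ (Finset.mem_biUnion.2 ⟨T, hT, Finset.mem_filter.2 ⟨Finset.mem_filter.2 ⟨hA, hTI⟩, hTA⟩⟩)
      · exact Finset.mem_union_left _ (Finset.mem_filter.2 ⟨hA, hTI⟩)
    have h2 := (Finset.card_le_card this).trans ((Finset.card_union_le _ _).trans (Nat.add_le_add_left Finset.card_biUnion_le _))
    unfold deg
    exact_mod_cast h2
  have h2 : ∑ T ∈ TT X k (z+1) (F \ Lf), deg ((F \ Lf).filter (fun A => TI Z0 Av D A)) T ≤ 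
      (TT X k (z+1) (F \ Lf)).card • (k * CC X.card k (z+2)) := Finset.sum_le_card_nsmul _ _ _ fun T hT => 
        h.cntTI (mem_TT.1 hT).1.2 (hall T hT)
  rw [nsmul_eq_mul] at h2
  have h3 := h.sth.skb
  rw [show z + 1 + 1 = z + 2 by omega] at h3
  have h4 := h.fII
  have h5 := h.sth.N_ge
  have hC := h.CC_pos'
  have hq : (1:ℝ) ≤ q := by exact_mod_cast h.hq
  have : 0 ≤ ((q:ℝ) - 1) * CC X.card k (z+1) := mul_nonneg (by linarith) hC.le
  linarith

lemma TI_up (h : Stg X k r F Lf Z0 Av D K κ0 c0 ls z q av) {T A : Finset ℕ} (hT : T ∈ TT X k (z+1) (F \ Lf)) 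
    (hA : A ∈ X.powersetCard k) (hL : A ∉ Lf) (hTA : T ⊆ A) : TI Z0 Av D A := by
  obtain ⟨h1, h2, h3⟩ := h.allTI T hT
  refine h.t.s4 A hA hL (h1.trans hTA) ?_
  have := Finset.card_le_card (Finset.sdiff_subset_sdiff (subset_refl D) hTA)
  have := min_le_left 1 D.card
  omega

lemma fullB (h : Stg X k r F Lf Z0 Av D K κ0 c0 ls z q av) (ho : (OO X k (z+1) (F \ Lf)).Nonempty) {T B : Finset ℕ} 
    (hT : T ∈ TT X k (z+1) (F \ Lf)) (hB : B ∈ X.powersetCard k) (hTB : T ⊆ B) (hL : B ∉ Lf) : B ∈ F \ Lf := by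
  refine Finset.mem_sdiff.2 ⟨?_, hL⟩
  have hI := h.TI_up hT hB hL hTB
  by_contra hBF
  have h1 := h.sth.full ho hT hTB
  have h2 : ∑ A ∈ OO X k (z+1) (F \ Lf), wt (F \ Lf) B ≤ ∑ A ∈ OO X k (z+1) (F \ Lf), wt (F \ Lf) A := by
    refine Finset.sum_le_sum fun A hA => ?_
    have hA' := OO_sub hA
    have h3 := h.t.opt.threshold (Finset.mem_sdiff.1 hA').1 hBF hB
    rw [h.wtF, h.wtF, (h.t.s1 B hB hI).2] at h3
    have := h.dfc_nonneg A hA'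
    linarith
  rw [Finset.sum_const, nsmul_eq_mul] at h2
  linarith

end Stg
end SI

namespace SI

lemma erase_of_sub {T W : Finset ℕ} (h : T ⊆ W) (hc : W.card = T.card + 1) : ∃ u ∈ W, T = W.erase u := by
  have h1 := Finset.card_sdiff_of_subset h
  obtain ⟨u, hu⟩ := Finset.card_eq_one.1 (show (W \ T).card = 1 by omega)
  have hu' : u ∈ W \ T := by rw [hu]; simp
  rw [Finset.mem_sdiff] at hu'
  refine ⟨u, hu'.1, Finset.eq_of_subset_of_card_le (fun x hx => Finset.mem_erase.2 ⟨fun e => hu'.2 (e ▸ hx), h hx⟩) ?_⟩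
  rw [Finset.card_erase_of_mem hu'.1]; omega

lemma erase_inj' {W : Finset ℕ} {u v : ℕ} (hu : u ∈ W) (h : W.erase u = W.erase v) : u = v := by
  by_contra hne
  have : u ∈ W.erase v := Finset.mem_erase.2 ⟨hne, hu⟩
  rw [← h] at this
  simp at this

/-- set of missing elements -/
noncomputable def UU (𝒯 : Finset (Finset ℕ)) (W : Finset ℕ) : Finset ℕ := W.filter (fun u => W.erase u ∈ 𝒯)

lemma mem_UU {𝒯 W u} : u ∈ UU 𝒯 W ↔ u ∈ W ∧ W.erase u ∈ 𝒯 := by unfold UU; rw [Finset.mem_filter]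

lemma card_UU {𝒯 : Finset (Finset ℕ)} {W : Finset ℕ} (h : ∀ T ∈ 𝒯, T ⊆ W ∧ W.card = T.card + 1) : (UU 𝒯 W).card = 𝒯.card := by
  have : 𝒯 = (UU 𝒯 W).image (fun u => W.erase u) := by
    ext T
    rw [Finset.mem_image]
    constructor
    · intro hT
      obtain ⟨u, hu, e⟩ := erase_of_sub (h T hT).1 (h T hT).2
      exact ⟨u, mem_UU.2 ⟨hu, e ▸ hT⟩, e.symm⟩
    · rintro ⟨u, hu, rfl⟩; exact (mem_UU.1 hu).2
  conv_rhs => rw [this]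
  rw [Finset.card_image_of_injOn]
  intro u hu v _ e
  exact erase_inj' (mem_UU.1 hu).1 e

namespace Stg
variable {X : Finset ℕ} {k r : ℕ} {F Lf : Finset (Finset ℕ)} {Z0 Av D K : Finset ℕ} {κ0 c0 : ℕ} {ls : ℝ} {z q av : ℕ}

lemma noEX (h : Stg X k r F Lf Z0 Av D K κ0 c0 ls z q av) {W AvM Zc Y : Finset ℕ} {ε : ℕ}
    (hWX : W ⊆ X) (hAM : AvM ⊆ X) (dWA : Disjoint W AvM) (hW : W.card = z + 2) (q2 : 2 ≤ q)
    (hT : ∀ T ∈ TT X k (z+1) (F \ Lf), T ⊆ W)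
    (hY : Y ⊆ D) (hYc : Y.card = min 1 D.card) (hC : Z0 ∪ (D \ Y) ⊆ Zc) (hZX : Zc ⊆ X) (hz : Zc.card = z) (dZ : Disjoint Zc (Av ∪ Y))
    (hε : ε ≤ 1) (hav : (Av ∪ Y).card + ε = AvM.card + 1)
    (hM : ∀ A ∈ X.powersetCard k, A ∉ Lf → ∀ u ∈ UU (TT X k (z+1) (F \ Lf)) W, W.erase u ⊆ A → A ∈ MM X k W (UU (TT X k (z+1) (F \ Lf)) W) AvM ε)
    (hM2 : ∀ A ∈ MM X k W (UU (TT X k (z+1) (F \ Lf)) W) AvM ε, A ∉ Lf)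
    (hd2 : q = 2 → ∀ A ∈ F \ Lf, 2 ≤ (UU (TT X k (z+1) (F \ Lf)) W \ A).card → ¬ TI Z0 Av D A) : False := by
  have st := h.sth
  have hUc : (UU (TT X k (z+1) (F \ Lf)) W).card = q := by
    rw [← st.s_eq]
    apply card_UU
    intro T hT'
    refine ⟨hT T hT', ?_⟩
    rw [(mem_TT.1 hT').1.2, hW]
  have hTu : ∀ T ∈ TT X k (z+1) (F \ Lf), ∃ u ∈ UU (TT X k (z+1) (F \ Lf)) W, T = W.erase u := by
    intro T hT'
    obtain ⟨u, hu, e⟩ := erase_of_sub (hT T hT') (by rw [(mem_TT.1 hT').1.2, hW])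
    exact ⟨u, mem_UU.2 ⟨hu, e ▸ hT'⟩, e⟩
  set U := UU (TT X k (z+1) (F \ Lf)) W with hU
  have h1 := h.t.N.big; have h0 := h.bud; have h2 := h.t.N.hk; have hzk := h.hzk
  have havc := h.avY hY hYc
  obtain ⟨P, p, f1, f2, f3, f4, f5, f6⟩ := h.fresh (Zc ∪ (Av ∪ Y)) (by
    have := Finset.card_union_le Zc (Av ∪ Y); omega)
  rw [Finset.disjoint_union_right] at f2
  rw [Finset.mem_union, not_or] at f6
  have cm : Cmp X Zc (Av ∪ Y) P p := ⟨hZX, Finset.union_subset h.t.AvX (hY.trans h.t.DX), f1, f4,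
    f6.1, f6.2, f5, dZ, f2.1.symm, f2.2.symm⟩
  have pc := cm.card_pet (k := k)
  rw [hz, havc, f3] at pc
  have ex : EXH X k r (z+1) q ε (F \ Lf) W U AvM Zc (Av ∪ Y) P p := 
    { st := st, m := ⟨hWX, Finset.filter_subset _ _, hAM, dWA⟩, cm := cm, hε := hε, hW := hW, hU := hUc, q2 := q2
      zc := by omega
      pc := f3, av := hav
      bud := by omega
      rho1 := by have := h.rho1; omega
      rho2 := by
        have := h.rho2
        have pcR : ((pet X k Zc (Av ∪ Y) P).card : ℝ) + cc X.card k z (av + q) = cc X.card k z av := by exact_mod_cast pc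
        rw [show z + 1 + 1 = z + 2 by omega]
        linarith }
  have hdn := Finset.sum_nonneg h.dfc_nonneg
  have hinM : ∀ A ∈ MM X k W U AvM ε, ∃ T ∈ TT X k (z+1) (F \ Lf), T ⊆ A := by
    intro A hA
    rcases mem_MM.1 hA with ⟨u, hu, hA⟩ | ⟨-, hA⟩
    · exact ⟨_, (mem_UU.1 hu).2, (mem_cyl.1 hA).2.1⟩
    · obtain ⟨u, hu⟩ := Finset.card_pos.1 (show 0 < U.card by omega)
      exact ⟨_, (mem_UU.1 hu).2, (Finset.erase_subset _ _).trans (mem_cyl.1 hA).2.1⟩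
  rcases (OO X k (z+1) (F \ Lf)).eq_empty_or_nonempty with ho | ho
  · obtain ⟨G, g1, g2, g3, g4⟩ := ex.case_empty (by
      intro A hA
      have hA' := Finset.mem_sdiff.1 hA
      have : A ∈ NN X k (z+1) (F \ Lf) := by unfold NN; rw [ho]; simpa using hA'
      obtain ⟨-, T, hT', hTA⟩ := mem_NN.1 this
      obtain ⟨u, hu, rfl⟩ := hTu T hT'
      exact hM A (h.HX hA) hA'.2 u hu hTA) (fun u hu => (mem_TT.1 (mem_UU.1 hu).2).2)
    have := h.key hY hYc hC hz g2 g3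
    linarith
  · obtain ⟨G, g1, g2, g3, g4⟩ := ex.case_full (by
      intro A hA
      obtain ⟨T, hT', hTA⟩ := hinM A hA
      exact h.fullB ho hT' (MM_sub hA) hTA (hM2 A hA)) (fun A => ls - wt Lf A) h.dfc_nonneg (by
      intro A hA u hu hs
      have hA' := Finset.mem_sdiff.1 hA
      exact hA'.2 (hM A (h.HX hA'.1) (Finset.mem_sdiff.1 hA'.1).2 u hu hs)) (by
      intro hq A hA hc
      have hA' := Finset.mem_sdiff.1 hA
      exact ((h.kinds A hA'.1).resolve_left (hd2 hq A hA'.1 hc)).2)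
    have := h.key hY hYc hC hz g2 g3
    linarith

lemma regular (h : Stg X k r F Lf Z0 Av D K κ0 c0 ls z q av) : 
    ∀ T1 ∈ TT X k (z+1) (F \ Lf), ∀ T2 ∈ TT X k (z+1) (F \ Lf), D \ T1 = D \ T2 := by
  intro T1 hT1 T2 hT2
  by_contra hne
  have st := h.sth
  have a1 := h.allTI T1 hT1; have a2 := h.allTI T2 hT2
  have hD : min 1 D.card = 1 := by
    by_contra hc
    have : D.card = 0 := by omega
    rw [Finset.card_eq_zero] at this
    subst this; simp at hne
  have key1 : ∀ T ∈ TT X k (z+1) (F \ Lf), ∃ y, y ∈ D ∧ y ∉ T ∧ D \ T = {y} := by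
    intro T hT
    obtain ⟨y, hy⟩ := Finset.card_eq_one.1 ((h.allTI T hT).2.2.trans hD)
    have : y ∈ D \ T := by rw [hy]; simp
    rw [Finset.mem_sdiff] at this
    exact ⟨y, this.1, this.2, hy⟩
  obtain ⟨y1, y1D, y1T, e1⟩ := key1 T1 hT1
  obtain ⟨y2, y2D, y2T, e2⟩ := key1 T2 hT2
  have hy : y1 ≠ y2 := by rintro rfl; exact hne (e1.trans e2.symm)
  have sing : ∀ {T : Finset ℕ} {y x}, D \ T = {y} → x ∈ D → x ≠ y → x ∈ T := by
    intro T y x e hx hxy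
    by_contra hc
    have : x ∈ D \ T := Finset.mem_sdiff.2 ⟨hx, hc⟩
    rw [e, Finset.mem_singleton] at this; exact hxy this
  have y1T2 : y1 ∈ T2 := sing e2 y1D hy
  have y2T1 : y2 ∈ T1 := sing e1 y2D hy.symm
  have c1 := (mem_TT.1 hT1).1.2; have c2 := (mem_TT.1 hT2).1.2
  have cl := st.clique hT1 hT2
  have hlt : (T1 ∩ T2).card < T1.card := Finset.card_lt_card ⟨Finset.inter_subset_left, fun hs => y2T (Finset.mem_inter.1 (hs y2T1)).2⟩
  have hu := Finset.card_union_add_card_inter T1 T2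
  set W := T1 ∪ T2 with hWdef
  have hW : W.card = z + 2 := by omega
  have hDW : D ⊆ W := by
    intro x hx
    by_cases hxy : x = y1
    · exact Finset.mem_union_right _ (hxy ▸ y1T2)
    · exact Finset.mem_union_left _ (sing e1 hx hxy)
  have hZW : Z0 ⊆ W := a1.1.trans Finset.subset_union_left
  have hWX : W ⊆ X := Finset.union_subset (mem_TT.1 hT1).1.1 (mem_TT.1 hT2).1.1
  have dWA : Disjoint W Av := by
    rw [hWdef, Finset.disjoint_union_left]; exact ⟨a1.2.1.symm, a2.2.1.symm⟩
  have hT : ∀ T ∈ TT X k (z+1) (F \ Lf), T ⊆ W := by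
    intro T hT3
    by_contra hns
    obtain ⟨x, hx, hxW⟩ := Finset.not_subset.1 hns
    have c3 := (mem_TT.1 hT3).1.2
    have l1 := st.clique hT3 hT1; have l2 := st.clique hT3 hT2
    have l3 : (T ∩ W).card < T.card := Finset.card_lt_card ⟨Finset.inter_subset_left, fun hs => hxW (Finset.mem_inter.1 (hs hx)).2⟩
    have m1 : T ∩ T1 = T ∩ W := Finset.eq_of_subset_of_card_le (Finset.inter_subset_inter_left Finset.subset_union_left) (by omega)
    have m2 : T ∩ T2 = T ∩ W := Finset.eq_of_subset_of_card_le (Finset.inter_subset_inter_left Finset.subset_union_right) (by omega)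
    obtain ⟨y3, y3D, y3T, e3⟩ := key1 T hT3
    have n1 : y1 ∉ T := fun hc => by
      have : y1 ∈ T ∩ T1 := by rw [m1]; exact Finset.mem_inter.2 ⟨hc, hDW y1D⟩
      exact y1T (Finset.mem_inter.1 this).2
    have n2 : y2 ∉ T := fun hc => by
      have : y2 ∈ T ∩ T2 := by rw [m2]; exact Finset.mem_inter.2 ⟨hc, hDW y2D⟩
      exact y2T (Finset.mem_inter.1 this).2
    by_cases hy3 : y1 = y3
    · exact n2 (sing e3 y2D (by rw [← hy3]; exact hy.symm))
    · exact n1 (sing e3 y1D hy3)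
  have hUD : UU (TT X k (z+1) (F \ Lf)) W ⊆ D := by
    intro u hu
    obtain ⟨hu1, hu2⟩ := mem_UU.1 hu
    obtain ⟨y3, y3D, y3T, e3⟩ := key1 _ hu2
    have : y3 = u := by
      by_contra hc; exact y3T (Finset.mem_erase.2 ⟨hc, hDW y3D⟩)
    exact this ▸ y3D
  have hUe : ∀ u ∈ UU (TT X k (z+1) (F \ Lf)) W, D \ (W.erase u) = {u} := by
    intro u hu
    ext x
    rw [Finset.mem_sdiff, Finset.mem_erase, Finset.mem_singleton]
    constructor
    · rintro ⟨a, b⟩; by_contra hc; exact b ⟨hc, hDW a⟩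
    · rintro rfl; exact ⟨hUD hu, fun hc => hc.1 rfl⟩
  have hq2 : 2 ≤ q := by
    rw [← st.s_eq]
    exact Finset.one_lt_card.2 ⟨T1, hT1, T2, hT2, fun e => hne (by rw [e])⟩
  have hZb := h.Zbig
  have hz := h.hz
  obtain ⟨v, hvW, hv⟩ := Finset.not_subset.1 (show ¬ W ⊆ Z0 ∪ D from fun hs => by have := Finset.card_le_card hs; omega)
  rw [Finset.mem_union, not_or] at hv
  have hy1W : y1 ∈ W := hDW y1D
  have hvy : v ≠ y1 := fun e => hv.2 (e ▸ y1D)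
  have y1Z : y1 ∉ Z0 := fun hc => Finset.disjoint_left.1 h.t.dZD hc y1D
  refine h.noEX (W := W) (AvM := Av) (Zc := (W.erase y1).erase v) (Y := {y1}) (ε := 0) hWX h.t.AvX dWA hW hq2 hT (by simpa using y1D)
    (by simp [hD]) ?_ ((Finset.erase_subset _ _).trans ((Finset.erase_subset _ _).trans hWX)) ?_ ?_ (by omega) ?_ ?_ ?_ ?_
  · intro x hx
    rw [Finset.mem_erase, Finset.mem_erase]
    rcases Finset.mem_union.1 hx with hx | hx
    · exact ⟨fun e => hv.1 (e ▸ hx), fun e => y1Z (e ▸ hx), hZW hx⟩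
    · rw [Finset.mem_sdiff, Finset.mem_singleton] at hx
      exact ⟨fun e => hv.2 (e ▸ hx.1), hx.2, hDW hx.1⟩
  · rw [Finset.card_erase_of_mem (Finset.mem_erase.2 ⟨hvy, hvW⟩), Finset.card_erase_of_mem hy1W]; omega
  · rw [Finset.disjoint_union_right]
    refine ⟨dWA.mono_left ((Finset.erase_subset _ _).trans (Finset.erase_subset _ _)), ?_⟩
    rw [Finset.disjoint_singleton_right]; simp
  · rw [Finset.card_union_of_disjoint (by rw [Finset.disjoint_singleton_right]; exact fun hc => Finset.disjoint_left.1 h.t.dAD hc y1D)]; simp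
  · intro A hA hL u hu huA
    have hI := h.TI_up (mem_UU.1 hu).2 hA hL huA
    refine mem_MM.2 (Or.inl ⟨u, hu, mem_cyl.2 ⟨hA, huA, ?_⟩⟩)
    rw [Finset.disjoint_insert_left]
    refine ⟨fun hc => ?_, hI.2.1⟩
    have : D \ A ⊆ D \ W.erase u := Finset.sdiff_subset_sdiff subset_rfl huA
    rw [hUe u hu] at this
    have e := Finset.eq_of_subset_of_card_le this (by rw [hI.2.2, hD]; simp)
    have : u ∈ D \ A := by rw [e]; simp
    exact (Finset.mem_sdiff.1 this).2 hc
  · intro A hA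
    rcases mem_MM.1 hA with ⟨u, hu, hA⟩ | ⟨hc, -⟩
    · obtain ⟨b1, b2, b3⟩ := mem_cyl.1 hA
      refine (h.t.s1 A b1 (TI_of (Y := {u}) (by simpa using hUD hu) (by simp [hD]) ?_ ?_)).1
      · refine (Finset.union_subset (h.allTI _ (mem_UU.1 hu).2).1 ?_).trans b2
        intro x hx
        rw [Finset.mem_sdiff, Finset.mem_singleton] at hx
        exact Finset.mem_erase.2 ⟨hx.2, hDW hx.1⟩
      · rw [Finset.disjoint_insert_left] at b3
        rw [Finset.disjoint_union_left, Finset.disjoint_singleton_left]; exact ⟨b3.2, b3.1⟩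
    · omega
  · intro _ A _ hc hI
    have := Finset.card_le_card (Finset.sdiff_subset_sdiff hUD (subset_refl A))
    have := hI.2.2
    omega

lemma center (h : Stg X k r F Lf Z0 Av D K κ0 c0 ls z q av) : 
    ∃ Z : Finset ℕ, Z.card = z ∧ ∀ T ∈ TT X k (z+1) (F \ Lf), Z ⊆ T := by
  have st := h.sth
  rcases st.structure_thm with ⟨Z, hZ, hT⟩ | ⟨h3, W, hW, hT⟩
  · exact ⟨Z, by omega, hT⟩
  exfalso
  have hUc : (UU (TT X k (z+1) (F \ Lf)) W).card = q := by
    rw [← st.s_eq]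
    apply card_UU
    intro T hT'
    refine ⟨hT T hT', ?_⟩
    rw [(mem_TT.1 hT').1.2, hW]
  rw [st.s_eq] at h3
  obtain ⟨u1, hu1, u2, hu2, hne⟩ := Finset.one_lt_card.1 (show 1 < (UU (TT X k (z+1) (F \ Lf)) W).card by omega)
  have a1 := mem_UU.1 hu1; have a2 := mem_UU.1 hu2
  set Y := D \ W.erase u1 with hYd
  have hY : ∀ T ∈ TT X k (z+1) (F \ Lf), D \ T = Y := fun T hT => h.regular T hT _ a1.2
  have hYD : Y ⊆ D := Finset.sdiff_subset
  have hYc : Y.card = min 1 D.card := (h.allTI _ a1.2).2.2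
  have hC0 : ∀ T ∈ TT X k (z+1) (F \ Lf), Z0 ∪ (D \ Y) ⊆ T := by
    intro T hT
    refine Finset.union_subset (h.allTI T hT).1 ?_
    rw [← hY T hT]; intro x hx; rw [Finset.mem_sdiff, Finset.mem_sdiff] at hx; tauto
  have hdA : ∀ T ∈ TT X k (z+1) (F \ Lf), Disjoint T (Av ∪ Y) := by
    intro T hT
    rw [Finset.disjoint_union_right]
    refine ⟨(h.allTI T hT).2.1.symm, ?_⟩
    rw [← hY T hT]; exact Finset.disjoint_sdiff
  have hWe : ∀ x ∈ W, x ∈ W.erase u1 ∨ x ∈ W.erase u2 := by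
    intro x hx
    by_cases e : x = u1
    · right; exact Finset.mem_erase.2 ⟨by rw [e]; exact hne, hx⟩
    · left; exact Finset.mem_erase.2 ⟨e, hx⟩
  refine h.noEX (W := W) (AvM := Av ∪ Y) (Zc := (W.erase u1).erase u2) (Y := Y) (ε := 1) ?_ ?_ ?_ hW (by omega) hT hYD
    hYc ?_ ?_ ?_ ?_ (by omega) rfl ?_ ?_ ?_
  · intro x hx
    rcases hWe x hx with h1 | h1
    · exact (mem_TT.1 a1.2).1.1 h1
    · exact (mem_TT.1 a2.2).1.1 h1
  · exact Finset.union_subset h.t.AvX (hYD.trans h.t.DX)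
  · rw [Finset.disjoint_left]; intro x hx
    rcases hWe x hx with h1 | h1
    · exact Finset.disjoint_left.1 (hdA _ a1.2) h1
    · exact Finset.disjoint_left.1 (hdA _ a2.2) h1
  · intro x hx
    exact Finset.mem_erase.2 ⟨(Finset.mem_erase.1 (hC0 _ a2.2 hx)).1, hC0 _ a1.2 hx⟩
  · exact (Finset.erase_subset _ _).trans (mem_TT.1 a1.2).1.1
  · rw [Finset.card_erase_of_mem (Finset.mem_erase.2 ⟨hne.symm, a2.1⟩), Finset.card_erase_of_mem a1.1]; omega
  · exact (hdA _ a1.2).mono_left (Finset.erase_subset _ _)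
  · intro A hA hL u hu huA
    have hI := h.TI_up (mem_UU.1 hu).2 hA hL huA
    have hdAA : Disjoint (Av ∪ Y) A := by
      rw [Finset.disjoint_union_left]; refine ⟨hI.2.1, ?_⟩
      have : D \ A ⊆ D \ W.erase u := Finset.sdiff_subset_sdiff subset_rfl huA
      rw [hY _ (mem_UU.1 hu).2] at this
      rw [← Finset.eq_of_subset_of_card_le this (by rw [hI.2.2, hYc])]
      exact Finset.sdiff_disjoint
    rw [mem_MM]
    by_cases huu : u ∈ A
    · right; refine ⟨rfl, mem_cyl.2 ⟨hA, ?_, hdAA⟩⟩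
      intro x hx
      by_cases e : x = u
      · exact e ▸ huu
      · exact huA (Finset.mem_erase.2 ⟨e, hx⟩)
    · left; refine ⟨u, hu, mem_cyl.2 ⟨hA, huA, ?_⟩⟩
      rw [Finset.disjoint_insert_left]; exact ⟨huu, hdAA⟩
  · intro A hA
    have : ∃ u ∈ UU (TT X k (z+1) (F \ Lf)) W, A ∈ X.powersetCard k ∧ W.erase u ⊆ A ∧ Disjoint (Av ∪ Y) A := by
      rcases mem_MM.1 hA with ⟨u, hu, hA⟩ | ⟨-, hA⟩
      · obtain ⟨b1, b2, b3⟩ := mem_cyl.1 hA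
        exact ⟨u, hu, b1, b2, b3.mono_left (Finset.subset_insert _ _)⟩
      · obtain ⟨b1, b2, b3⟩ := mem_cyl.1 hA
        exact ⟨u1, hu1, b1, (Finset.erase_subset _ _).trans b2, b3⟩
    obtain ⟨u, hu, b1, b2, b3⟩ := this
    exact (h.t.s1 A b1 (TI_of hYD hYc ((hC0 _ (mem_UU.1 hu).2).trans b2) b3)).1
  · intro hq; omega

end Stg
end SI

namespace SI
namespace Stg
variable {X : Finset ℕ} {k r : ℕ} {F Lf : Finset (Finset ℕ)} {Z0 Av D K : Finset ℕ} {κ0 c0 : ℕ} {ls : ℝ} {z q av : ℕ}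

lemma center' (h : Stg X k r F Lf Z0 Av D K κ0 c0 ls z q av) : 
    ∃ Y Zc : Finset ℕ, Y ⊆ D ∧ Y.card = min 1 D.card ∧ Z0 ∪ (D \ Y) ⊆ Zc ∧ Zc.card = z ∧ 
      ∀ T ∈ TT X k (z+1) (F \ Lf), Zc ⊆ T ∧ Disjoint T (Av ∪ Y) := by
  have st := h.sth
  obtain ⟨Z, hZ, hT⟩ := h.center
  have hs := st.s_eq
  obtain ⟨T0, hT0⟩ := Finset.card_pos.1 (show 0 < (TT X k (z+1) (F \ Lf)).card by rw [hs]; exact h.hq)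
  have hYc := (h.allTI _ hT0).2.2
  set Y := D \ T0 with hYd
  have hY : ∀ T ∈ TT X k (z+1) (F \ Lf), D \ T = Y := fun T hT => h.regular T hT _ hT0
  have hYD : Y ⊆ D := Finset.sdiff_subset
  have hC0 : ∀ T ∈ TT X k (z+1) (F \ Lf), Z0 ∪ (D \ Y) ⊆ T := by
    intro T hT
    refine Finset.union_subset (h.allTI T hT).1 ?_
    rw [← hY T hT]; intro x hx; rw [Finset.mem_sdiff, Finset.mem_sdiff] at hx; tauto
  have hdA : ∀ T ∈ TT X k (z+1) (F \ Lf), Disjoint T (Av ∪ Y) := by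
    intro T hT
    rw [Finset.disjoint_union_right]
    refine ⟨(h.allTI T hT).2.1.symm, ?_⟩
    rw [← hY T hT]; exact Finset.disjoint_sdiff
  by_cases hq : 2 ≤ q
  · obtain ⟨T1, hT1, T2, hT2, hne⟩ := Finset.one_lt_card.1 (show 1 < (TT X k (z+1) (F \ Lf)).card by omega)
    have c1 := (mem_TT.1 hT1).1.2; have c2 := (mem_TT.1 hT2).1.2
    have hlt : (T1 ∩ T2).card < T1.card := Finset.card_lt_card ⟨Finset.inter_subset_left, fun hs => hne 
      (Finset.eq_of_subset_of_card_le (fun x hx => (Finset.mem_inter.1 (hs hx)).2) (by omega))⟩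
    have e : Z = T1 ∩ T2 := Finset.eq_of_subset_of_card_le (Finset.subset_inter (hT _ hT1) (hT _ hT2)) (by omega)
    refine ⟨Y, Z, hYD, hYc, ?_, hZ, fun T h' => ⟨hT T h', hdA T h'⟩⟩
    rw [e]; exact Finset.subset_inter (hC0 _ hT1) (hC0 _ hT2)
  · have hone : (TT X k (z+1) (F \ Lf)).card = 1 := by have := h.hq; omega
    obtain ⟨T', hT'⟩ := Finset.card_eq_one.1 hone
    have hc := h.cardC0 hYD hYc
    have c0' := (mem_TT.1 hT0).1.2
    obtain ⟨p, hp, hpC⟩ := Finset.not_subset.1 (show ¬ T0 ⊆ Z0 ∪ (D \ Y) from fun hs => by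
      have := Finset.card_le_card hs; have := h.hz; omega)
    refine ⟨Y, T0.erase p, hYD, hYc, fun x hx => Finset.mem_erase.2 ⟨fun e => hpC (e ▸ hx), hC0 _ hT0 hx⟩, ?_, fun T h' => ⟨?_, hdA T h'⟩⟩
    · rw [Finset.card_erase_of_mem hp]; omega
    · have : T = T0 := by
        rw [hT', Finset.mem_singleton] at h' hT0; rw [h', hT0]
      rw [this]; exact Finset.erase_subset _ _

theorem out (h : Stg X k r F Lf Z0 Av D K κ0 c0 ls z q av) : (∀ A ∈ F \ Lf, TI Z0 Av D A) ∧ 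
    ∃ Y Zc P : Finset ℕ, Y ⊆ D ∧ Y.card = min 1 D.card ∧ Z0 ∪ (D \ Y) ⊆ Zc ∧ Zc ⊆ X ∧ Zc.card = z ∧ P ⊆ X ∧ P.card = q ∧ 
      Disjoint Zc P ∧ Disjoint Zc (Av ∪ Y) ∧ Disjoint P (Av ∪ Y) ∧ 
      ∀ A ∈ X.powersetCard k, A ∉ Lf → ∀ p ∈ P, insert p Zc ⊆ A → A ∈ F := by
  have st := h.sth
  obtain ⟨Y, Zc, hY, hYc, hC, hz, hT⟩ := h.center'
  have hs := st.s_eq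
  obtain ⟨T0, hT0⟩ := Finset.card_pos.1 (show 0 < (TT X k (z+1) (F \ Lf)).card by rw [hs]; exact h.hq)
  obtain ⟨P, hP⟩ : ∃ P : Finset ℕ, P = X.filter (fun p => p ∉ Zc ∧ insert p Zc ∈ TT X k (z+1) (F \ Lf)) := ⟨_, rfl⟩
  have mP : ∀ {p}, p ∈ P ↔ p ∈ X ∧ p ∉ Zc ∧ insert p Zc ∈ TT X k (z+1) (F \ Lf) := by
    intro p; rw [hP, Finset.mem_filter]
  have hTP : ∀ T ∈ TT X k (z+1) (F \ Lf), ∃ p ∈ P, T = insert p Zc := by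
    intro T hT'
    have c := (mem_TT.1 hT').1
    obtain ⟨p, hp⟩ := Finset.card_eq_one.1 (show (T \ Zc).card = 1 by rw [Finset.card_sdiff_of_subset (hT T hT').1]; omega)
    have hp' : p ∈ T \ Zc := by rw [hp]; simp
    rw [Finset.mem_sdiff] at hp'
    have e : insert p Zc = T := Finset.eq_of_subset_of_card_le (Finset.insert_subset hp'.1 (hT T hT').1) (by
      rw [Finset.card_insert_of_notMem hp'.2]; omega)
    exact ⟨p, mP.2 ⟨c.1 hp'.1, hp'.2, e ▸ hT'⟩, e.symm⟩
  have hPc : P.card = q := by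
    rw [← hs]
    have : TT X k (z+1) (F \ Lf) = P.image (fun p => insert p Zc) := by
      ext T; rw [Finset.mem_image]
      constructor
      · intro h'; obtain ⟨p, hp, e⟩ := hTP T h'; exact ⟨p, hp, e.symm⟩
      · rintro ⟨p, hp, rfl⟩; exact (mP.1 hp).2.2
    rw [this, Finset.card_image_of_injOn]
    intro p hp p' hp' e
    have e' : insert p Zc = insert p' Zc := e
    have : p ∈ insert p' Zc := by rw [← e']; simp
    rw [Finset.mem_insert] at this
    exact this.resolve_right (mP.1 hp).2.1
  have hZX : Zc ⊆ X := (hT T0 hT0).1.trans (mem_TT.1 hT0).1.1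
  have hPX : P ⊆ X := fun p hp => (mP.1 hp).1
  have dZP : Disjoint Zc P := by
    rw [Finset.disjoint_right]; exact fun p hp => (mP.1 hp).2.1
  have dZA : Disjoint Zc (Av ∪ Y) := (hT T0 hT0).2.mono_left (hT T0 hT0).1
  have dPA : Disjoint P (Av ∪ Y) := by
    rw [Finset.disjoint_left]; intro p hp
    exact Finset.disjoint_left.1 (hT _ (mP.1 hp).2.2).2 (Finset.mem_insert_self _ _)
  have h0 := h.bud; have hzk := h.hzk; have hzz := h.hz; have hn := h.t.N.kn
  rcases (OO X k (z+1) (F \ Lf)).eq_empty_or_nonempty with ho | ho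
  · exfalso
    have hH : ∀ A ∈ F \ Lf, Zc ⊆ A := by
      intro A hA
      have : A ∈ NN X k (z+1) (F \ Lf) := by unfold NN; rw [ho]; simpa using hA
      obtain ⟨-, T, hT', hTA⟩ := mem_NN.1 this
      exact (hT T hT').1.trans hTA
    obtain ⟨x, hx, hxL⟩ := h.t.com Zc (Finset.subset_union_left.trans hC) (by
      calc (D \ Zc).card ≤ Y.card := Finset.card_le_card (fun x hx => by
            have := Finset.mem_sdiff.1 hx
            by_contra hxY
            exact this.2 (hC (Finset.mem_union_right _ (Finset.mem_sdiff.2 ⟨this.1, hxY⟩))))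
        _ ≤ 1 := by rw [hYc]; exact min_le_left _ _) (by omega)
    exact lt_irrefl _ (h.t.star F h.t.opt.1 rfl x (fun A hA => by
      by_cases hL : A ∈ Lf
      · exact hxL A hL
      · exact hH A (Finset.mem_sdiff.2 ⟨hA, hL⟩) hx))
  have hfull : ∀ A ∈ X.powersetCard k, A ∉ Lf → ∀ p ∈ P, insert p Zc ⊆ A → A ∈ F := by
    intro A hA hL p hp hs
    exact (Finset.mem_sdiff.1 (h.fullB ho (mP.1 hp).2.2 hA hs hL)).1
  refine ⟨?_, Y, Zc, P, hY, hYc, hC, hZX, hz, hPX, hPc, dZP, dZA, dPA, hfull⟩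
  intro A hA
  by_contra hI
  have hII := (h.kinds A hA).resolve_left hI
  have hav := h.avY hY hYc
  have hAvX : Av ∪ Y ⊆ X := Finset.union_subset h.t.AvX (hY.trans h.t.DX)
  have hTIc : ∀ B ∈ cyl X k Zc (Av ∪ Y), TI Z0 Av D B := fun B hB => by
    obtain ⟨b1, b2, b3⟩ := mem_cyl.1 hB
    exact TI_of hY hYc (hC.trans b2) b3
  have hpet : pet X k Zc (Av ∪ Y) P ⊆ NN X k (z+1) (F \ Lf) := by
    intro B hB
    obtain ⟨b1, b2, b3, p, hp, hpB⟩ := mem_pet.1 hB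
    have hL := (h.t.s1 B b1 (hTIc B (mem_cyl.2 ⟨b1, b2, b3⟩))).1
    have hs := Finset.insert_subset hpB b2
    exact mem_NN.2 ⟨Finset.mem_sdiff.2 ⟨hfull B b1 hL p hp hs, hL⟩, _, (mP.1 hp).2.2, hs⟩
  have pc : (pet X k Zc (Av ∪ Y) P).card + cc X.card k z (av + q) = cc X.card k z av := by
    unfold pet
    rw [Finset.card_sdiff_of_subset (cyl_anti Finset.subset_union_left), card_cyl hZX hAvX dZA, card_cyl hZX (Finset.union_subset hAvX hPX) 
      (by rw [Finset.disjoint_union_right]; exact ⟨dZA, dZP⟩), Finset.card_union_of_disjoint dPA.symm, hav, hPc, hz]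
    have : cc X.card k z (av + q) ≤ cc X.card k z av := cc_anti (by omega)
    omega
  have pcR : ((pet X k Zc (Av ∪ Y) P).card : ℝ) + cc X.card k z (av + q) = cc X.card k z av := by exact_mod_cast pc
  have hpc : ((pet X k Zc (Av ∪ Y) P).card : ℝ) ≤ (NN X k (z+1) (F \ Lf)).card := by exact_mod_cast Finset.card_le_card hpet
  have csp := STH.card_split (X := X) (k := k) (i := z+1) (H := F \ Lf)
  have r2 := h.rho2
  have orb : ((OO X k (z+1) (F \ Lf)).card : ℝ) ≤ r * CC X.card k (z+2) := by linarith
  have hAO : A ∈ OO X k (z+1) (F \ Lf) := by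
    rw [mem_OO]; refine ⟨hA, fun T hT' hTA => hI ?_⟩
    exact h.TI_up hT' (h.HX hA) (Finset.mem_sdiff.1 hA).2 hTA
  -- find B
  have hexB : ∃ B ∈ cyl X k Zc (Av ∪ Y ∪ P), B ∉ F \ Lf := by
    by_contra hcon
    push Not at hcon
    have hsub : cyl X k Zc (Av ∪ Y ∪ P) ⊆ OO X k (z+1) (F \ Lf) := by
      intro B hB
      rw [mem_OO]; refine ⟨hcon B hB, fun T hT' hTB => ?_⟩
      obtain ⟨p, hp, rfl⟩ := hTP T hT'
      have := (mem_cyl.1 hB).2.2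
      exact Finset.disjoint_left.1 this (Finset.mem_union_right _ hp) (hTB (Finset.mem_insert_self _ _))
    have h1 := Finset.card_le_card hsub
    rw [card_cyl hZX (Finset.union_subset hAvX hPX) (by rw [Finset.disjoint_union_right]; exact ⟨dZA, dZP⟩), 
      Finset.card_union_of_disjoint dPA.symm, hav, hPc, hz] at h1
    have h2 := cc_pascal (n := X.card) (k := k) (i := z) (j := av + q) (by omega)
    have h3 : 0 < cc X.card k z (av + q + 1) := cc_pos (by omega) (by omega)
    have h4 := h.rho3
    have h5 : cc X.card k (z+1) (av+q) < (OO X k (z+1) (F \ Lf)).card := by omega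
    have h6 : (cc X.card k (z+1) (av+q) : ℝ) < (OO X k (z+1) (F \ Lf)).card := by exact_mod_cast h5
    linarith
  obtain ⟨B, hB, hBH⟩ := hexB
  have hB' := mem_cyl.1 hB
  have hBI := hTIc B (cyl_anti Finset.subset_union_left hB)
  have hBs := h.t.s1 B hB'.1 hBI
  have hBF : B ∉ F := fun hc => hBH (Finset.mem_sdiff.2 ⟨hc, hBs.1⟩)
  have thr := h.t.opt.threshold (Finset.mem_sdiff.1 hA).1 hBF hB'.1
  rw [h.wtF, h.wtF, hBs.2] at thr
  obtain ⟨τ, hτ, -⟩ := st.exists_tau T0 hT0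
  have hsplit : wt (F \ Lf) A = wt (NN X k (z+1) (F \ Lf)) A + wt (OO X k (z+1) (F \ Lf)) A := by
    rw [wt_sdiff (NN_sub : NN X k (z+1) (F \ Lf) ⊆ F \ Lf), STH.OO_eq]
  have u1 := st.wt_tau NN_sub hτ (st.crd A hA)
  have u2 := st.skb
  have u3 : ∑ B ∈ NN X k (z+1) (F \ Lf), ((A ∩ τ B).card : ℝ) ≤ (NN X k (z+1) (F \ Lf)).card • (z:ℝ) := 
    Finset.sum_le_card_nsmul _ _ _ fun C hC => by
      have h2 := inter_le_ind (A := A) (i := z+1) (by omega) (mem_TT.1 (hτ C hC).1).1.2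
      rw [if_neg ((mem_OO.1 hAO).2 _ (hτ C hC).1)] at h2
      push_cast at h2; linarith
  rw [nsmul_eq_mul] at u3
  have u4 : wt (OO X k (z+1) (F \ Lf)) A ≤ k * (OO X k (z+1) (F \ Lf)).card := wt_le (st.crd A hA)
  have u5 : (k:ℝ) * (OO X k (z+1) (F \ Lf)).card ≤ k * (r * CC X.card k (z+2)) := by gcongr
  have u6 := (h.stp (z+1)).2.1
  rw [show z + 1 + 1 = z + 2 by omega] at u6
  have l1 : ((NN X k (z+1) (F \ Lf)).card : ℝ) * z ≤ wt (F \ Lf) B := by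
    refine le_trans ?_ (wt_mono (NN_sub : NN X k (z+1) (F \ Lf) ⊆ F \ Lf) B)
    unfold wt
    rw [← nsmul_eq_mul]
    apply Finset.card_nsmul_le_sum
    intro C hC
    have : Zc ⊆ B ∩ C := Finset.subset_inter hB'.2.1 ((hT _ (hτ C hC).1).1.trans (hτ C hC).2)
    have := Finset.card_le_card this
    rw [hz] at this
    exact_mod_cast this
  have hC' := h.CC_pos'
  linarith [hII.2]

end Stg
end SI

namespace SI

lemma cc_shift' {n k c a : ℕ} (hc : c ≤ k) (e j : ℕ) : cc (n - c - a) (k - c) e j = cc n k (c + e) (a + j) := by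
  unfold cc
  have : (e ≤ k - c) ↔ (c + e ≤ k) := by omega
  simp only [this]
  split_ifs with h
  · congr 1 <;> omega
  · rfl

def Lft (n k r c0 av ρ : ℕ) : Prop := c0 + av ≤ r ∧ c0 ≤ k ∧ (∃ V, Good (n - c0 - av) (k - c0) ρ (r - c0 - av) V) ∧ ρ < cc n k (c0+1) av

variable {X : Finset ℕ} {k r : ℕ} {F Lf : Finset (Finset ℕ)} {Z0 Av D K : Finset ℕ} {κ0 c0 : ℕ} {ls : ℝ}

lemma Stt.next (h : Stt X k r F Lf Z0 Av D K κ0 c0 ls) {av : ℕ} (hav : av = Av.card + min 1 D.card)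
    (hl : Lft X.card k r c0 av (F \ Lf).card) (hp : 0 < (F \ Lf).card) :
    ∃ z q ρ', Stg X k r F Lf Z0 Av D K κ0 c0 ls z q av ∧ (F \ Lf).card + cc X.card k z (av+q) = cc X.card k z av + ρ' ∧
      Lft X.card k r z (av+q) ρ' := by
  obtain ⟨h1, h2, ⟨V, h3⟩, h4⟩ := hl
  have hkn := h.N.kn
  obtain ⟨e, q, ρ, V', a1, a2, a3, a4, a5, a6, a7⟩ := DL h3 (by omega) hp
  rw [cc_shift' h2, cc_shift' h2] at a4
  rw [cc_shift' h2] at a6 a7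
  have he : 1 ≤ e := a7.2 (by simpa using h4)
  rw [show X.card - c0 - av - e - q = X.card - (c0+e) - (av+q) by omega, show k - c0 - e = k - (c0+e) by omega,
    show r - c0 - av - e - q = r - (c0 + e) - (av+q) by omega] at a5
  rw [Nat.add_zero] at a4
  have hzk : c0 + e ≤ k := by omega
  have b := good_lt a5 (by rw [cc_shift' hzk]; simpa [add_assoc] using a6)
  rw [cc_shift' hzk, Nat.add_zero] at b
  have b2 : ρ ≤ r * cc X.card k (c0 + e + 2) 0 := 
    b.trans (Nat.mul_le_mul (by omega) (cc_anti (Nat.zero_le _)))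
  have b3 : (ρ : ℝ) ≤ r * CC X.card k (c0+e+2) := by unfold CC; exact_mod_cast b2
  refine ⟨c0 + e, q, ρ, ⟨h, by omega, by omega, a1, hav, by omega, by omega, ?_⟩, a4, by omega, hzk, ⟨V', a5⟩, by simpa [add_assoc] using a6⟩
  have : (((F \ Lf).card + cc X.card k (c0+e) (av+q) : ℕ) : ℝ) = ((cc X.card k (c0+e) av + ρ : ℕ) : ℝ) := by rw [a4]
  push_cast at this
  linarith

lemma Stt.no_star (h : Stt X k r F Lf Z0 Av D K κ0 c0 ls) {x : ℕ} (hx : ∀ A ∈ F, x ∈ A) : False :=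
  absurd (h.star F h.opt.1 rfl x hx) (lt_irrefl _)

lemma Stt.finish (h : Stt X k r F Lf Z0 Av D K κ0 c0 ls) {x : ℕ} (hx : x ∈ Z0) (hxl : ∀ A ∈ Lf, x ∈ A) {av : ℕ} (hav : av = Av.card + min 1 D.card)
    (hl : Lft X.card k r c0 av (F \ Lf).card) : False := by
  have : ∀ A ∈ F \ Lf, x ∈ A := by
    intro A hA
    obtain ⟨z, q, ρ, hs, -⟩ := h.next hav hl (Finset.card_pos.2 ⟨A, hA⟩)
    exact (hs.out.1 A hA).1 hx
  refine h.no_star (x := x) fun A hA => ?_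
  by_cases hL : A ∈ Lf
  · exact hxl A hL
  · exact this A (Finset.mem_sdiff.2 ⟨hA, hL⟩)

lemma Num.stp {n k r : ℕ} (h : Num n k r) (j : ℕ) : 72 * ((k + r) * CC n k (j+1)) ≤ CC n k j ∧ 
    72 * (k * r * CC n k (j+1)) ≤ CC n k j ∧ 72 * (r * CC n k (j+1)) ≤ CC n k j ∧ 
    72 * (r^2 * CC n k (j+1)) ≤ CC n k j ∧ 72 * CC n k (j+1) ≤ CC n k j := by
  have h1 := h.step j
  have hk : (1:ℝ) ≤ k := by exact_mod_cast h.hk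
  have hr : (1:ℝ) ≤ r := by exact_mod_cast h.hr
  have b0 := CC_nonneg n k (j+1)
  have hkr : 1 ≤ (k:ℝ) * r := by nlinarith
  have g : ∀ x : ℝ, x ≤ k * r * (k + r) → 72 * (x * CC n k (j+1)) ≤ CC n k j := by
    intro x hx
    have := mul_le_mul_of_nonneg_right hx b0
    linarith
  have p0 : 0 ≤ ((k:ℝ) * r - 1) * (k + r) := mul_nonneg (by linarith) (by linarith)
  have p1 : 0 ≤ ((k:ℝ) * r) * (k + r - 1) := mul_nonneg (by linarith) (by linarith)
  have p2 : 0 ≤ ((k:ℝ) - 1) * r * r := mul_nonneg (mul_nonneg (by linarith) (by linarith)) (by linarith)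
  have p3 : 0 ≤ (k:ℝ) * k * r := by positivity
  refine ⟨g _ (by linarith), g _ (by linarith), g _ (by linarith), g _ (by linarith), ?_⟩
  have := g 1 (by linarith)
  linarith

/-- `cc i j` close to `CC i` for `j ≤ k + r` -/
lemma Num.ccb {n k r : ℕ} (h : Num n k r) {i j : ℕ} (hj : j ≤ k + r) (hij : i + j ≤ n) :
    71/72 * CC n k i ≤ cc n k i j ∧ (cc n k i j : ℝ) ≤ CC n k i := by
  constructor
  · have h1 : CC n k i ≤ cc n k i j + j * CC n k (i+1) := by unfold CC; exact_mod_cast cc_ge hij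
    have h2 := (h.stp i).1
    have h3 : (j:ℝ) * CC n k (i+1) ≤ (k + r) * CC n k (i+1) :=
      mul_le_mul_of_nonneg_right (by exact_mod_cast hj) (CC_nonneg _ _ _)
    linarith
  · unfold CC; exact_mod_cast cc_anti (Nat.zero_le _)

end SI

namespace SI

lemma wt_pet {X : Finset ℕ} {k : ℕ} {Z Yv P : Finset ℕ} (hZ : Z ⊆ X) (hY : Yv ⊆ X) (hP : P ⊆ X) (dZY : Disjoint Z Yv) (dZP : Disjoint Z P)
    (dYP : Disjoint Yv P) {A : Finset ℕ} (hA : A ∈ X.powersetCard k) :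
    wt (pet X k Z Yv P) A = (A ∩ Z).card * ((cc X.card k Z.card Yv.card : ℝ) - cc X.card k Z.card (Yv.card + P.card)) +
      ((k:ℝ) - (A ∩ Z).card - (A ∩ Yv).card) * ((cc X.card k (Z.card+1) Yv.card : ℝ) - cc X.card k (Z.card+1) (Yv.card + P.card)) +
      (A ∩ P).card * cc X.card k (Z.card+1) (Yv.card + P.card) := by
  rw [Finset.mem_powersetCard] at hA
  have h1 : wt (cyl X k Z Yv) A = wt (cyl X k Z (Yv ∪ P)) A + wt (pet X k Z Yv P) A := wt_sdiff (cyl_anti Finset.subset_union_left) A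
  rw [wt_cyl hZ hY dZY hA.1, wt_cyl hZ (Finset.union_subset hY hP) (Finset.disjoint_union_right.2 ⟨dZY, dZP⟩) hA.1,
    Finset.card_union_of_disjoint dYP] at h1
  have c1 : ((A \ (Z ∪ Yv)).card : ℝ) = k - (A ∩ Z).card - (A ∩ Yv).card := by
    have := Finset.card_sdiff_add_card_inter A (Z ∪ Yv)
    rw [Finset.inter_union_distrib_left, Finset.card_union_of_disjoint (dZY.mono Finset.inter_subset_right Finset.inter_subset_right), hA.2] at this
    have : (((A \ (Z ∪ Yv)).card + ((A ∩ Z).card + (A ∩ Yv).card) : ℕ) : ℝ) = k := by rw [this]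
    push_cast at this; linarith
  have c2 : ((A \ (Z ∪ (Yv ∪ P))).card : ℝ) = k - (A ∩ Z).card - (A ∩ Yv).card - (A ∩ P).card := by
    have := Finset.card_sdiff_add_card_inter A (Z ∪ (Yv ∪ P))
    rw [Finset.inter_union_distrib_left, Finset.card_union_of_disjoint 
      ((Finset.disjoint_union_right.2 ⟨dZY, dZP⟩).mono Finset.inter_subset_right Finset.inter_subset_right), Finset.inter_union_distrib_left,
      Finset.card_union_of_disjoint (dYP.mono Finset.inter_subset_right Finset.inter_subset_right), hA.2] at this
    have : (((A \ (Z ∪ (Yv ∪ P))).card + ((A ∩ Z).card + ((A ∩ Yv).card + (A ∩ P).card)) : ℕ) : ℝ) = k := by rw [this]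
    push_cast at this; linarith
  rw [c1, c2] at h1
  linear_combination -h1

lemma M_bound {n k z v q : ℕ} (hq : 2 ≤ q) (h : z + v + q ≤ n) : 
    cc n k z (v+q) + cc n k (z+1) v + cc n k (z+1) (v+1) + (q - 2) * cc n k (z+1) (v+q) ≤ cc n k z v := by
  rw [cc_sum h]
  obtain ⟨q', rfl⟩ := Nat.exists_eq_add_of_le hq
  have : ∑ l ∈ Finset.range (2 + q'), cc n k (z+1) (v+l) = ∑ l ∈ Finset.range q', cc n k (z+1) (v+(l+1+1)) + cc n k (z+1) (v+1) + cc n k (z+1) v := by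
    rw [add_comm 2 q', Finset.sum_range_succ', Finset.sum_range_succ']; simp
  rw [this]
  have h2 : (2 + q' - 2) * cc n k (z+1) (v+(2+q')) ≤ ∑ l ∈ Finset.range q', cc n k (z+1) (v+(l+1+1)) := by
    rw [show 2 + q' - 2 = (Finset.range q').card by simp, ← smul_eq_mul]
    refine Finset.card_nsmul_le_sum _ _ _ fun l hl => cc_anti ?_
    have := Finset.mem_range.1 hl; omega
  omega

lemma pet_state {X : Finset ℕ} {k r : ℕ} {F L0 : Finset (Finset ℕ)} {Z Yv P : Finset ℕ} {ls0 : ℝ} (N : Num X.card k r) (opt : Opt X k F)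
    (star : ∀ G ⊆ X.powersetCard k, G.card = F.card → ∀ x, (∀ A ∈ G, x ∈ A) → ip G G < ip F F)
    (hZ : Z ⊆ X) (hY : Yv ⊆ X) (hP : P ⊆ X) (dZY : Disjoint Z Yv) (dZP : Disjoint Z P)
    (dYP : Disjoint Yv P) (hzk : Z.card + 1 ≤ k) (hq : 2 ≤ P.card) (hr : P.card + Yv.card ≤ r) (hL : L0 ∪ pet X k Z Yv P ⊆ F)
    (H1 : ∀ A ∈ cyl X k Z Yv, A ∉ L0 ∧ wt L0 A = ls0)
    (H2 : ∀ A ∈ X.powersetCard k, A ∉ L0 → wt L0 A = ls0 ∨ wt L0 A + 1/2 * CC X.card k Z.card ≤ ls0)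
    (H3 : ∀ A ∈ X.powersetCard k, A ∉ L0 → Z ⊆ A → Disjoint Yv A)
    (H4 : ∃ x ∈ Z, ∀ A ∈ L0, x ∈ A) :
    ∃ ls, Stt X k r F (L0 ∪ pet X k Z Yv P) Z (P ∪ Yv) ∅ P 0 Z.card ls := by
  have hkn := N.kn
  have hdis : Disjoint L0 (pet X k Z Yv P) := by
    rw [Finset.disjoint_right]; intro A hA
    exact (H1 A (Finset.mem_sdiff.1 hA).1).1
  obtain ⟨M, hM⟩ : ∃ M : ℝ, M = (cc X.card k Z.card Yv.card : ℝ) - cc X.card k Z.card (Yv.card + P.card) := ⟨_, rfl⟩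
  obtain ⟨a', ha'⟩ : ∃ a' : ℝ, a' = cc X.card k (Z.card+1) (Yv.card + P.card) := ⟨_, rfl⟩
  obtain ⟨a, ha⟩ : ∃ a : ℝ, a = cc X.card k (Z.card+1) Yv.card := ⟨_, rfl⟩
  have W : ∀ A ∈ X.powersetCard k, wt (L0 ∪ pet X k Z Yv P) A = wt L0 A + ((A ∩ Z).card * M + ((k:ℝ) - (A ∩ Z).card - (A ∩ Yv).card) * (a - a') + 
      (A ∩ P).card * a') := by
    intro A hA
    rw [wt_union hdis, wt_pet hZ hY hP dZY dZP dYP hA, hM, ha, ha']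
  have mT : ∀ {A}, TI Z (P ∪ Yv) ∅ A ↔ Z ⊆ A ∧ Disjoint P A ∧ Disjoint Yv A := by
    intro A; unfold TI; rw [Finset.disjoint_union_left]; simp
  have TIof : ∀ A ∈ X.powersetCard k, A ∉ L0 ∪ pet X k Z Yv P → Z ⊆ A → TI Z (P ∪ Yv) ∅ A := by
    intro A hA hAL hZA
    rw [Finset.mem_union, not_or] at hAL
    have h3 := H3 A hA hAL.1 hZA
    refine mT.2 ⟨hZA, ?_, h3⟩
    rw [Finset.disjoint_left]; intro p hp hpA
    exact hAL.2 (mem_pet.2 ⟨hA, hZA, h3, p, hp, hpA⟩)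
  obtain ⟨b1, b2⟩ := N.ccb (i := Z.card + 1) (j := Yv.card + 1) (by omega) (by omega)
  obtain ⟨b3, b4⟩ := N.ccb (i := Z.card + 2) (j := Yv.card + 1) (by omega) (by omega)
  obtain ⟨b5, b6⟩ := N.ccb (i := Z.card + 1) (j := Yv.card + P.card) (by omega) (by omega)
  rw [← ha'] at b5 b6
  have b7 : a' + cc X.card k (Z.card+2) (Yv.card+1) ≤ cc X.card k (Z.card+1) (Yv.card+1) := by
    rw [ha', cc_pascal (n := X.card) (k := k) (i := Z.card+1) (j := Yv.card+1) (by omega)]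
    push_cast
    have : (cc X.card k (Z.card+1) (Yv.card + P.card) : ℝ) ≤ cc X.card k (Z.card+1) (Yv.card+1+1) := by
      exact_mod_cast cc_anti (by omega)
    linarith
  have b8 : a' ≤ a := by rw [ha, ha']; exact_mod_cast cc_anti (by omega)
  have b9 : a + cc X.card k (Z.card+1) (Yv.card+1) + ((P.card:ℝ) - 2) * a' ≤ M := by
    have := M_bound (n := X.card) (k := k) (z := Z.card) (v := Yv.card) hq (by omega)
    have h2 : ((cc X.card k Z.card (Yv.card+P.card) + cc X.card k (Z.card+1) Yv.card + cc X.card k (Z.card+1) (Yv.card+1) + (P.card - 2) * cc X.card k (Z.card+1) (Yv.card+P.card) : ℕ) : ℝ) ≤ (cc X.card k Z.card Yv.card : ℕ) := by exact_mod_cast this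
    push_cast [Nat.cast_sub hq] at h2
    rw [hM, ha, ha']; linarith
  have a0 : 0 ≤ a' := by rw [ha']; positivity
  have c1 := CC_nonneg X.card k (Z.card+1)
  have c2 := CC_nonneg X.card k (Z.card+2)
  have q2 : (2:ℝ) ≤ P.card := by exact_mod_cast hq
  have q0 : 0 ≤ ((P.card:ℝ) - 2) * a' := mul_nonneg (by linarith) a0
  have Mla : a - a' ≤ M := by linarith
  have hZk : (A : Finset ℕ) → (A ∩ Z).card ≤ Z.card := fun A => Finset.card_le_card Finset.inter_subset_right
  refine ⟨ls0 + Z.card * M + ((k:ℝ) - Z.card) * (a - a'), N, opt, hL, hZ, Finset.union_subset hP hY, by simp, 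
    Finset.disjoint_union_right.2 ⟨dZP, dZY⟩, by simp, by simp, by omega, by simp, ?_, ?_, ?_, ?_, ?_, star⟩
  · intro A hA hT
    obtain ⟨t1, t2, t3⟩ := mT.1 hT
    have h1 := H1 A (mem_cyl.2 ⟨hA, t1, t3⟩)
    constructor
    · rw [Finset.mem_union, not_or]
      refine ⟨h1.1, fun h => ?_⟩
      obtain ⟨-, -, -, p, hp, hpA⟩ := mem_pet.1 h
      exact Finset.disjoint_left.1 t2 hp hpA
    · rw [W A hA, h1.2, Finset.inter_eq_right.2 t1, Finset.disjoint_iff_inter_eq_empty.1 t2.symm, Finset.disjoint_iff_inter_eq_empty.1 t3.symm]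
      simp; ring
  · intro A hA hAL
    by_cases hZA : Z ⊆ A
    · left; exact TIof A hA hAL hZA
    right
    rw [W A hA]
    have hs : (A ∩ Z).card < Z.card := Finset.card_lt_card ⟨Finset.inter_subset_right, fun h => hZA (h.trans Finset.inter_subset_left)⟩
    have hs' : ((A ∩ Z).card : ℝ) + 1 ≤ Z.card := by exact_mod_cast hs
    have e1 : 0 ≤ ((Z.card:ℝ) - (A ∩ Z).card - 1) * (M - (a - a')) := mul_nonneg (by linarith) (by linarith)
    have e2 : 0 ≤ ((A ∩ Yv).card : ℝ) * (a - a') := mul_nonneg (Nat.cast_nonneg _) (by linarith)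
    rw [Finset.mem_union, not_or] at hAL
    rcases H2 A hA hAL.1 with h2 | h2
    · by_cases hp : 2 ≤ (A ∩ P).card
      · left
        refine ⟨by simpa using hp, ?_⟩
        have hpq : ((A ∩ P).card : ℝ) ≤ P.card := by exact_mod_cast Finset.card_le_card Finset.inter_subset_right
        have e3 : 0 ≤ ((P.card : ℝ) - (A ∩ P).card) * a' := mul_nonneg (by linarith) a0
        rw [h2]
        linarith
      · right
        have hp1 : ((A ∩ P).card : ℝ) ≤ 1 := by exact_mod_cast (by omega : (A ∩ P).card ≤ 1)
        have e3 : 0 ≤ (1 - ((A ∩ P).card : ℝ)) * a' := mul_nonneg (by linarith) a0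
        rw [h2]
        linarith
    · right
      have hp1 : ((A ∩ P).card : ℝ) ≤ k := by
        rw [← (Finset.mem_powersetCard.1 hA).2]; exact_mod_cast Finset.card_le_card Finset.inter_subset_left
      have e3 : ((A ∩ P).card : ℝ) * a' ≤ k * CC X.card k (Z.card+1) := mul_le_mul hp1 b6 a0 (Nat.cast_nonneg _)
      have e4 := (N.stp Z.card).1
      have e5 : 0 ≤ (r:ℝ) * CC X.card k (Z.card + 1) := mul_nonneg (Nat.cast_nonneg _) c1
      have e6 := (N.stp Z.card).2.2.2.2
      have e7 : 0 ≤ (k:ℝ) * CC X.card k (Z.card + 1) := mul_nonneg (Nat.cast_nonneg _) c1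
      linarith
  · intro T hT
    rw [Finset.disjoint_iff_inter_eq_empty.1 (mT.1 hT).2.1.symm]; simp
  · intro A hA hAL hZA _
    exact TIof A hA hAL hZA
  · intro Zc hZc _ _
    obtain ⟨x, hx, hx2⟩ := H4
    refine ⟨x, hZc hx, fun A hA => ?_⟩
    rcases Finset.mem_union.1 hA with h | h
    · exact hx2 A h
    · exact (mem_pet.1 h).2.1 hx

end SI

namespace SI

lemma wt_cyl0 {X : Finset ℕ} {k : ℕ} {T A : Finset ℕ} (hT : T ⊆ X) (hA : A ∈ X.powersetCard k) :
    wt (cyl X k T ∅) A = (A ∩ T).card * (CC X.card k T.card - CC X.card k (T.card+1)) + k * CC X.card k (T.card+1) := by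
  rw [Finset.mem_powersetCard] at hA
  rw [wt_cyl hT (Finset.empty_subset _) (by simp) hA.1]
  have : ((A \ (T ∪ ∅)).card : ℝ) = k - (A ∩ T).card := by
    rw [Finset.union_empty]
    have := Finset.card_sdiff_add_card_inter A T
    rw [hA.2] at this
    have : (((A \ T).card + (A ∩ T).card : ℕ) : ℝ) = k := by rw [this]
    push_cast at this; linarith
  rw [this]; unfold CC; simp; ring

lemma wt_cyl1 {X : Finset ℕ} {k : ℕ} {T A : Finset ℕ} {y : ℕ} (hT : T ⊆ X) (hy : y ∈ X) (hyT : y ∉ T) (hA : A ∈ X.powersetCard k) :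
    wt (cyl X k T {y}) A = (A ∩ T).card * ((cc X.card k T.card 1 : ℝ) - cc X.card k (T.card+1) 1) + k * cc X.card k (T.card+1) 1 -
      (A ∩ {y}).card * cc X.card k (T.card+1) 1 := by
  rw [Finset.mem_powersetCard] at hA
  have hd : Disjoint T {y} := by simpa using hyT
  rw [wt_cyl hT (by simpa using hy) hd hA.1]
  have : ((A \ (T ∪ {y})).card : ℝ) = k - (A ∩ T).card - (A ∩ {y}).card := by
    have := Finset.card_sdiff_add_card_inter A (T ∪ {y})
    rw [Finset.inter_union_distrib_left, Finset.card_union_of_disjoint (hd.mono Finset.inter_subset_right Finset.inter_subset_right), hA.2] at this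
    have : (((A \ (T ∪ {y})).card + ((A ∩ T).card + (A ∩ {y}).card) : ℕ) : ℝ) = k := by rw [this]
    push_cast at this; linarith
  rw [this, Finset.card_singleton]; ring

variable {X : Finset ℕ} {k r : ℕ} {F : Finset (Finset ℕ)}

lemma state0 (N : Num X.card k r) (opt : Opt X k F)
    (star : ∀ G ⊆ X.powersetCard k, G.card = F.card → ∀ x, (∀ A ∈ G, x ∈ A) → ip G G < ip F F) :
    Stt X k r F ∅ ∅ ∅ ∅ ∅ 0 0 0 := by
  refine ⟨N, opt, by simp, by simp, by simp, by simp, by simp, by simp, by simp, by simp, by simp, ?_, ?_, ?_, ?_, ?_, star⟩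
  · intro A _ _; simp [wt]
  · intro A _ _; left; simp [TI]
  · intro T _; simp
  · intro A _ _ _ _; simp [TI]
  · intro Z _ _ h
    obtain ⟨x, hx⟩ := Finset.card_pos.1 h
    exact ⟨x, hx, by simp⟩

lemma state1 {T : Finset ℕ} (N : Num X.card k r) (opt : Opt X k F)
    (star : ∀ G ⊆ X.powersetCard k, G.card = F.card → ∀ x, (∀ A ∈ G, x ∈ A) → ip G G < ip F F)
    (hT : T ⊆ X) {c : ℕ} (ht : T.card = c + 1) (hc : 1 ≤ c) (hL : cyl X k T ∅ ⊆ F) :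
    Stt X k r F (cyl X k T ∅) ∅ ∅ T ∅ 0 c (c * (CC X.card k (c+1) - CC X.card k (c+1+1)) + k * CC X.card k (c+1+1)) := by
  have mn : ∀ A ∈ X.powersetCard k, (A ∉ cyl X k T ∅ ↔ 1 ≤ (T \ A).card) := by
    intro A hA
    rw [mem_cyl, Nat.one_le_iff_ne_zero, Ne, Finset.card_eq_zero, Finset.sdiff_eq_empty_iff_subset]; simp [hA]
  have mT : ∀ A, TI ∅ ∅ T A ↔ (T \ A).card = 1 := by
    intro A; unfold TI; simp; omega
  have cd : ∀ A : Finset ℕ, (T \ A).card + (A ∩ T).card = c + 1 := by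
    intro A; rw [← ht, Finset.inter_comm]; exact Finset.card_sdiff_add_card_inter T A
  refine ⟨N, opt, hL, by simp, by simp, hT, by simp, by simp, by simp, by simp, by simp; omega, ?_, ?_, ?_, ?_, ?_, star⟩
  · intro A hA h
    rw [mT] at h
    refine ⟨(mn A hA).2 h.ge, ?_⟩
    rw [wt_cyl0 hT hA, ht, show (A ∩ T).card = c by have := cd A; omega]
  · intro A hA h
    rw [mn A hA] at h
    rcases h.eq_or_lt with h1 | h1
    · left; exact (mT A).2 h1.symm
    · right; right
      rw [wt_cyl0 hT hA, ht]
      have h2 : ((A ∩ T).card : ℝ) + 1 ≤ c := by exact_mod_cast (by have := cd A; omega : (A ∩ T).card + 1 ≤ c)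
      have h3 := (N.stp (c+1)).2.2.2.2
      have h4 := CC_nonneg X.card k (c+1+1)
      have h5 : 0 ≤ ((c:ℝ) - (A ∩ T).card - 1) * (CC X.card k (c+1) - CC X.card k (c+1+1)) := mul_nonneg (by linarith) (by linarith)
      linarith
  · intro T _; simp
  · intro A hA h _ h2
    exact (mT A).2 (le_antisymm h2 ((mn A hA).1 h))
  · intro Zc _ h _
    obtain ⟨x, hx⟩ := Finset.card_pos.1 (by have := cd Zc; omega : 0 < (Zc ∩ T).card)
    rw [Finset.mem_inter] at hx
    exact ⟨x, hx.1, fun A hA => (mem_cyl.1 hA).2.1 hx.2⟩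

lemma stateA {T T' : Finset ℕ} {y : ℕ} (N : Num X.card k r) (opt : Opt X k F)
    (star : ∀ G ⊆ X.powersetCard k, G.card = F.card → ∀ x, (∀ A ∈ G, x ∈ A) → ip G G < ip F F)
    (hT : T ⊆ X) (hT' : T' ⊆ X) (hy : y ∈ T) (hy' : y ∉ T') (hZ : T.erase y ⊆ T') (h2 : 2 ≤ T.card) {z : ℕ} (htz : T'.card = z + 1)
    (hTT : T.card ≤ z) (hzk : z + 1 ≤ k) (hL : cyl X k T ∅ ∪ cyl X k T' {y} ⊆ F) :
    ∃ ls, Stt X k r F (cyl X k T ∅ ∪ cyl X k T' {y}) (T.erase y) {y} (T' \ T.erase y) (insert y (T' \ T.erase y)) ((T' \ T.erase y).card - 1) z ls := by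
  have hkn := N.kn
  have hr := N.hr
  obtain ⟨Z, hZd⟩ : ∃ Z, Z = T.erase y := ⟨_, rfl⟩
  obtain ⟨D, hD⟩ : ∃ D, D = T' \ Z := ⟨_, rfl⟩
  have cZ : Z.card + 1 = T.card := by rw [hZd]; exact Finset.card_erase_add_one hy
  rw [← hZd] at hZ ⊢
  rw [← hD]
  have cD : Z.card + D.card = z + 1 := by
    rw [hD, Finset.card_sdiff_of_subset hZ, htz]; have := Finset.card_le_card hZ; omega
  have hyD : y ∉ D := by rw [hD]; simp [hy']
  have hyZ : y ∉ Z := fun h => hy' (hZ h)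
  have hTi : T = insert y Z := by rw [hZd, Finset.insert_erase hy]
  have hTu : T' = Z ∪ D := by rw [hD, Finset.union_sdiff_of_subset hZ]
  have dZD : Disjoint Z D := by rw [hD]; exact Finset.disjoint_sdiff
  have sT : ∀ A, T ⊆ A ↔ y ∈ A ∧ Z ⊆ A := by intro A; rw [hTi, Finset.insert_subset_iff]
  have sT' : ∀ A, T' ⊆ A ↔ Z ⊆ A ∧ D ⊆ A := by intro A; rw [hTu, Finset.union_subset_iff]
  have mn : ∀ A ∈ X.powersetCard k, (A ∉ cyl X k T ∅ ∪ cyl X k T' {y} ↔ ¬ T ⊆ A ∧ ¬ (T' ⊆ A ∧ y ∉ A)) := by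
    intro A hA
    rw [Finset.mem_union, mem_cyl, mem_cyl, not_or]; simp [hA]
  have mT : ∀ A, TI Z {y} D A ↔ Z ⊆ A ∧ y ∉ A ∧ (D \ A).card = 1 := by
    intro A; unfold TI; rw [Finset.disjoint_singleton_left, show min 1 D.card = 1 by omega]
  have cd : ∀ S A : Finset ℕ, (S \ A).card + (A ∩ S).card = S.card := by
    intro S A; rw [Finset.inter_comm]; exact Finset.card_sdiff_add_card_inter S A
  have cAT : ∀ A : Finset ℕ, (A ∩ T).card = (A ∩ Z).card + (A ∩ {y}).card := by
    intro A
    rw [hTi, Finset.insert_eq, Finset.union_comm, Finset.inter_union_distrib_left, Finset.card_union_of_disjoint]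
    exact (by simpa using hyZ : Disjoint Z {y}).mono Finset.inter_subset_right Finset.inter_subset_right
  have cAT' : ∀ A : Finset ℕ, (A ∩ T').card = (A ∩ Z).card + (A ∩ D).card := by
    intro A
    rw [hTu, Finset.inter_union_distrib_left, Finset.card_union_of_disjoint]
    exact dZD.mono Finset.inter_subset_right Finset.inter_subset_right
  have cs : ∀ S A : Finset ℕ, S ⊆ A ↔ (A ∩ S).card = S.card := by
    intro S A
    rw [← Finset.sdiff_eq_empty_iff_subset, ← Finset.card_eq_zero]; have := cd S A; omega
  have cy : ∀ A : Finset ℕ, (y ∈ A ∧ (A ∩ {y}).card = 1) ∨ (y ∉ A ∧ (A ∩ {y}).card = 0) := by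
    intro A
    by_cases h : y ∈ A
    · left; refine ⟨h, ?_⟩; rw [Finset.inter_singleton_of_mem h]; simp
    · right; refine ⟨h, ?_⟩; rw [Finset.inter_singleton_of_notMem h]; simp
  have cK : ∀ A : Finset ℕ, (A ∩ insert y D).card = (A ∩ D).card + (A ∩ {y}).card := by
    intro A
    rw [Finset.insert_eq, Finset.union_comm, Finset.inter_union_distrib_left, Finset.card_union_of_disjoint]
    exact (by simpa using hyD : Disjoint D {y}).mono Finset.inter_subset_right Finset.inter_subset_right
  have hdis : Disjoint (cyl X k T ∅) (cyl X k T' {y}) := by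
    rw [Finset.disjoint_left]; intro A hA hA'
    have := (mem_cyl.1 hA').2.2
    rw [Finset.disjoint_singleton_left] at this
    exact this ((mem_cyl.1 hA).2.1 hy)
  obtain ⟨B, hB⟩ : ∃ B, B = CC X.card k T.card - CC X.card k (T.card+1) := ⟨_, rfl⟩
  obtain ⟨b, hb⟩ : ∃ b : ℝ, b = cc X.card k (T'.card+1) 1 := ⟨_, rfl⟩
  obtain ⟨B2, hB2⟩ : ∃ B2, B2 = (cc X.card k T'.card 1 : ℝ) - b := ⟨_, rfl⟩
  have W : ∀ A ∈ X.powersetCard k, wt (cyl X k T ∅ ∪ cyl X k T' {y}) A = (A ∩ T).card * B + k * CC X.card k (T.card+1) + 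
      ((A ∩ T').card * B2 + k * b - (A ∩ {y}).card * b) := by
    intro A hA
    rw [wt_union hdis, wt_cyl0 hT hA, wt_cyl1 hT' (hT hy) hy' hA, hB, hB2, hb]
  have n1 := N.ccb (i := z+1) (j := 1) (by omega) (by omega)
  have n2 := N.ccb (i := z+2) (j := 1) (by omega) (by omega)
  have n3 := (N.stp T.card).2.2.2.2
  have n4 := (N.stp (z+1)).2.2.2.2
  have n5 : CC X.card k (z+1) ≤ CC X.card k (T.card+1) := CC_anti N.kn' (by omega)
  have n6 := CC_nonneg X.card k (z+1)
  have n7 := CC_nonneg X.card k (z+2)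
  rw [htz] at hb hB2
  rw [show z + 1 + 1 = z + 2 by omega] at hb n4
  rw [← hb] at n2
  have B2le : B2 ≤ CC X.card k (z+1) := by linarith [n1.2, n2.1]
  have B2ge : 1/2 * CC X.card k (z+1) ≤ B2 := by linarith [n1.1, n2.2]
  have Bge : 2 * CC X.card k (z+1) ≤ B := by linarith
  have b0 : 0 ≤ b := by rw [hb]; positivity
  refine ⟨((T.card:ℝ) - 1) * B + k * CC X.card k (T.card+1) + (z * B2 + k * b), N, opt, hL, ?_, ?_, ?_, ?_, ?_, ?_, ?_, ?_, ?_, ?_, ?_, ?_, ?_, star⟩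
  · exact hZ.trans hT'
  · simpa using hT hy
  · rw [hD]; exact Finset.sdiff_subset.trans hT'
  · simpa using hyZ
  · exact dZD
  · simpa using hyD
  · rw [Finset.card_insert_of_notMem hyD]; omega
  · omega
  · intro A hA h
    obtain ⟨t1, t2, t3⟩ := (mT A).1 h
    have hn : ¬ D ⊆ A := by rw [← Finset.sdiff_eq_empty_iff_subset, ← Finset.card_eq_zero]; omega
    refine ⟨(mn A hA).2 ⟨fun h => t2 (h hy), fun h => hn ((sT' A).1 h.1).2⟩, ?_⟩
    rw [W A hA]
    have e1 := cAT A; have e2 := cAT' A; have e3 := (cs Z A).1 t1; have e4 := cd D A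
    have e5 : (A ∩ {y}).card = 0 := by rcases cy A with h | h; exact absurd h.1 t2; exact h.2
    have e6 : ((A ∩ T).card : ℝ) = T.card - 1 := by
      rw [← cZ, e1, e3, e5]; push_cast; ring
    rw [e6, e5, show (A ∩ T').card = z by omega]; push_cast; ring
  · intro A hA h
    obtain ⟨h1, h3⟩ := (mn A hA).1 h
    rw [sT, cs] at h1
    rw [sT', cs, cs] at h3
    have e1 := cAT A; have e2 := cAT' A; have e4 := cd D A; have e5 := cd Z A; have e6 := cd T A; have e7 := cd T' A
    have e8 := cK A
    rw [mT, cs, W A hA, e8]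
    have w1 : 0 ≤ B := by linarith
    have w2 : 0 ≤ B2 := by linarith
    have w3 : 0 ≤ ((A ∩ {y}).card : ℝ) * b := mul_nonneg (Nat.cast_nonneg _) b0
    have f1 : ((A ∩ T').card : ℝ) ≤ z + 1 := by exact_mod_cast (by omega : (A ∩ T').card ≤ z + 1)
    by_cases g : (A ∩ T).card + 2 ≤ T.card
    · right; right
      have f2 : ((A ∩ T).card : ℝ) + 2 ≤ T.card := by exact_mod_cast g
      have f3 : 0 ≤ ((T.card:ℝ) - (A ∩ T).card - 2) * B := mul_nonneg (by linarith) w1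
      have f4 : 0 ≤ ((z:ℝ) + 1 - (A ∩ T').card) * B2 := mul_nonneg (by linarith) w2
      linarith
    · have gT : (A ∩ T).card + 1 = T.card := by
        rcases cy A with ⟨y1, y2⟩ | ⟨y1, y2⟩
        · have : (A ∩ Z).card ≠ Z.card := fun h => h1 ⟨y1, h⟩
          omega
        · omega
      have gT' : ((A ∩ T).card : ℝ) = T.card - 1 := by rw [← gT]; push_cast; ring
      have g2 : (A ∩ T').card + 1 ≤ z + 1 := by
        by_contra hh
        rcases cy A with ⟨y1, y2⟩ | ⟨y1, y2⟩
        · exact h1 ⟨y1, by omega⟩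
        · exact h3 ⟨⟨by omega, by omega⟩, y1⟩
      by_cases g3 : (A ∩ T').card + 2 ≤ z + 1
      · right; right
        have f2 : ((A ∩ T').card : ℝ) + 1 ≤ z := by exact_mod_cast (by omega : (A ∩ T').card + 1 ≤ z)
        have f4 : 0 ≤ ((z:ℝ) - 1 - (A ∩ T').card) * B2 := mul_nonneg (by linarith) w2
        rw [gT']
        linarith
      · have g4 : (A ∩ T').card = z := by omega
        rcases cy A with ⟨y1, y2⟩ | ⟨y1, y2⟩
        · right; left
          refine ⟨by omega, ?_⟩
          rw [gT', g4, y2]; push_cast; linarith [n2.1]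
        · left; exact ⟨by omega, y1, by omega⟩
  · intro S hS
    obtain ⟨t1, t2, t3⟩ := (mT S).1 hS
    have e4 := cd D S
    rw [cK]
    rcases cy S with ⟨y1, y2⟩ | ⟨y1, y2⟩
    · exact absurd y1 t2
    · omega
  · intro A hA h hZA hDA
    obtain ⟨h1, h3⟩ := (mn A hA).1 h
    have yA : y ∉ A := fun hh => h1 ((sT A).2 ⟨hh, hZA⟩)
    refine (mT A).2 ⟨hZA, yA, le_antisymm hDA ?_⟩
    rw [Nat.one_le_iff_ne_zero, Ne, Finset.card_eq_zero, Finset.sdiff_eq_empty_iff_subset]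
    exact fun hh => h3 ⟨(sT' A).2 ⟨hZA, hh⟩, yA⟩
  · intro Zc hZc _ _
    obtain ⟨x, hx⟩ := Finset.card_pos.1 (by omega : 0 < Z.card)
    refine ⟨x, hZc hx, fun A hA => ?_⟩
    rcases Finset.mem_union.1 hA with h | h
    · exact ((sT A).1 (mem_cyl.1 h).2.1).2 hx
    · exact ((sT' A).1 (mem_cyl.1 h).2.1).1 hx

end SI

namespace SI

lemma card_rest {F L0 G : Finset (Finset ℕ)} (h : L0 ∪ G ⊆ F) (hd : Disjoint L0 G) : (F \ (L0 ∪ G)).card + G.card = (F \ L0).card := by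
  have h1 := Finset.card_sdiff_add_card_eq_card h
  have h2 := Finset.card_sdiff_add_card_eq_card (Finset.subset_union_left.trans h : L0 ⊆ F)
  rw [Finset.card_union_of_disjoint hd] at h1
  omega

theorem claim1 {X : Finset ℕ} {k r m : ℕ} {F : Finset (Finset ℕ)} {V : ℝ} (N : Num X.card k r) (opt : Opt X k F)
    (star : ∀ G ⊆ X.powersetCard k, G.card = F.card → ∀ x, (∀ A ∈ G, x ∈ A) → ip G G < ip F F)
    (hF : F.card = m) (hG : Good X.card k m r V) (hm0 : 0 < m) (hm : m < cc X.card k 1 0) : False := by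
  have hkn := N.kn
  have s0 := state0 N opt star
  have l0 : Lft X.card k r 0 0 (F \ ∅).card := by
    refine ⟨by omega, by omega, ⟨V, ?_⟩, ?_⟩
    · simpa [hF] using hG
    · simpa [hF] using hm
  obtain ⟨z, q, ρ, sg, hρ, hl⟩ := s0.next (av := 0) (by simp) l0 (by simpa [hF] using hm0)
  obtain ⟨-, Y, Zc, P, hY, -, -, hZX, hz, hPX, hPq, dZP, -, -, full⟩ := sg.out
  have hz1 := sg.hz; have hzk := sg.hzk; have hq := sg.hq; have bud := sg.bud
  rw [Finset.sdiff_empty] at hρ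
  simp only [Nat.zero_add] at hρ hl
  by_cases hq2 : 2 ≤ q
  · obtain ⟨x, hx⟩ := Finset.card_pos.1 (by omega : 0 < Zc.card)
    have hsub : ∅ ∪ pet X k Zc ∅ P ⊆ F := by
      intro A hA
      rw [Finset.empty_union] at hA
      obtain ⟨a1, a2, -, p, hp, hpA⟩ := mem_pet.1 hA
      exact full A a1 (by simp) p hp (Finset.insert_subset hpA a2)
    obtain ⟨ls, st⟩ := pet_state (L0 := ∅) (Z := Zc) (Yv := ∅) (P := P) (ls0 := 0) N opt star hZX (by simp) hPX (by simp) dZP (by simp) (by omega)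
      (by omega) (by simp; omega) hsub (by intro A _; simp [wt]) (by intro A _ _; left; simp [wt]) (by intro A _ _ _; simp) ⟨x, hx, by simp⟩
    refine st.finish hx ?_ (av := q) (by simp [hPq]) ?_
    · intro A hA
      rw [Finset.empty_union] at hA
      exact (mem_pet.1 hA).2.1 hx
    · have h1 := card_rest hsub (by simp)
      rw [Finset.sdiff_empty] at h1
      have h2 := pet_card (k := k) hZX (by simp) hPX (by simp) dZP (by simp : Disjoint ∅ P)
      rw [hz, hPq, Finset.card_empty, Nat.zero_add] at h2
      rw [hz, show (F \ (∅ ∪ pet X k Zc ∅ P)).card = ρ by omega]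
      exact hl
  · obtain rfl : q = 1 := by omega
    obtain ⟨p, rfl⟩ := Finset.card_eq_one.1 hPq
    have hpX : p ∈ X := by simpa using hPX
    have hpZ : p ∉ Zc := by simpa using dZP
    obtain ⟨T, hTd⟩ : ∃ T, T = insert p Zc := ⟨_, rfl⟩
    have hTX : T ⊆ X := by rw [hTd]; exact Finset.insert_subset hpX hZX
    have hTc : T.card = z + 1 := by rw [hTd, Finset.card_insert_of_notMem hpZ, hz]
    have hLF : cyl X k T ∅ ⊆ F := by
      intro A hA
      obtain ⟨a1, a2, -⟩ := mem_cyl.1 hA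
      exact full A a1 (by simp) p (by simp) (hTd ▸ a2)
    have s1 := state1 N opt star hTX hTc (by omega) hLF
    have cL : (cyl X k T ∅).card = cc X.card k (z+1) 0 := by
      rw [card_cyl hTX (by simp) (by simp), hTc]; simp
    have c1 : (F \ cyl X k T ∅).card = ρ := by
      have h1 := Finset.card_sdiff_add_card_eq_card hLF
      have h2 := cc_pascal (n := X.card) (k := k) (i := z) (j := 0) (by omega)
      rw [Nat.zero_add] at h2
      omega
    rw [← c1] at hl
    rcases Nat.eq_zero_or_pos (F \ cyl X k T ∅).card with h0 | h0
    · obtain ⟨x, hx⟩ := Finset.card_pos.1 (by omega : 0 < T.card)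
      refine s1.no_star (x := x) fun A hA => ?_
      by_contra hxA
      rw [Finset.card_eq_zero, Finset.sdiff_eq_empty_iff_subset] at h0
      exact hxA ((mem_cyl.1 (h0 hA)).2.1 hx)
    obtain ⟨z2, q2, ρ2, sg2, hρ2, hl2⟩ := s1.next (av := 1) (by rw [Finset.card_empty]; omega) hl h0
    obtain ⟨-, Y2, Z2, P2, hY2, hY2c, hZs, hZX2, hz2, hPX2, hPq2, dZP2, dZY2, dPY2, full2⟩ := sg2.out
    have gz1 := sg2.hz; have gzk := sg2.hzk; have gq := sg2.hq; have gbud := sg2.bud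
    rw [show min 1 T.card = 1 by omega] at hY2c
    obtain ⟨y, rfl⟩ := Finset.card_eq_one.1 hY2c
    have hyT : y ∈ T := by simpa using hY2
    rw [Finset.empty_union] at hZs dZY2 dPY2
    rw [Finset.sdiff_singleton_eq_erase] at hZs
    have hyZ2 : y ∉ Z2 := by simpa using dZY2
    have hyP2 : y ∉ P2 := by simpa using dPY2
    by_cases hq2' : 2 ≤ q2
    · have hdis : Disjoint (cyl X k T ∅) (pet X k Z2 {y} P2) := by
        rw [Finset.disjoint_left]; intro A hA hA'
        have := (mem_pet.1 hA').2.2.1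
        rw [Finset.disjoint_singleton_left] at this
        exact this ((mem_cyl.1 hA).2.1 hyT)
      have hsub : cyl X k T ∅ ∪ pet X k Z2 {y} P2 ⊆ F := by
        intro A hA
        rcases Finset.mem_union.1 hA with h | h
        · exact hLF h
        · obtain ⟨a1, a2, -, p, hp, hpA⟩ := mem_pet.1 h
          exact full2 A a1 (fun h' => Finset.disjoint_left.1 hdis h' h) p hp (Finset.insert_subset hpA a2)
      have er : (T.erase y).card + 1 = T.card := Finset.card_erase_add_one hyT
      obtain ⟨x, hx⟩ := Finset.card_pos.1 (by omega : 0 < (T.erase y).card)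
      have hxT := Finset.mem_of_mem_erase hx
      have ci : ∀ A : Finset ℕ, (T \ A).card + (A ∩ T).card = z + 1 := by
        intro A; rw [Finset.inter_comm, ← hTc]; exact Finset.card_sdiff_add_card_inter T A
      have hn : ∀ A ∈ X.powersetCard k, A ∉ cyl X k T ∅ → 1 ≤ (T \ A).card := by
        intro A hA h
        rw [Nat.one_le_iff_ne_zero, Ne, Finset.card_eq_zero, Finset.sdiff_eq_empty_iff_subset]
        intro h'; exact h (mem_cyl.2 ⟨hA, h', by simp⟩)
      have H1 : ∀ A ∈ cyl X k Z2 {y}, A ∉ cyl X k T ∅ ∧ wt (cyl X k T ∅) A = (z * (CC X.card k (z+1) - CC X.card k (z+1+1)) + k * CC X.card k (z+1+1)) := by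
        intro A hA
        obtain ⟨a1, a2, a3⟩ := mem_cyl.1 hA
        rw [Finset.disjoint_singleton_left] at a3
        refine ⟨fun h => a3 ((mem_cyl.1 h).2.1 hyT), ?_⟩
        have : A ∩ T = T.erase y := by
          ext u; rw [Finset.mem_inter, Finset.mem_erase]
          constructor
          · rintro ⟨u1, u2⟩; exact ⟨fun h => a3 (h ▸ u1), u2⟩
          · rintro ⟨u1, u2⟩; exact ⟨a2 (hZs (Finset.mem_erase.2 ⟨u1, u2⟩)), u2⟩
        rw [wt_cyl0 hTX a1, this, show (T.erase y).card = z by omega, hTc]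
      have H2 : ∀ A ∈ X.powersetCard k, A ∉ cyl X k T ∅ → wt (cyl X k T ∅) A = (z * (CC X.card k (z+1) - CC X.card k (z+1+1)) + k * CC X.card k (z+1+1)) ∨ wt (cyl X k T ∅) A + 1/2 * CC X.card k Z2.card ≤ (z * (CC X.card k (z+1) - CC X.card k (z+1+1)) + k * CC X.card k (z+1+1)) := by
        intro A hA hAL
        have h1 := hn A hA hAL
        have h2 := ci A
        rw [wt_cyl0 hTX hA, hTc]
        rcases h1.eq_or_lt with h3 | h3
        · left; rw [show (A ∩ T).card = z by omega]
        · right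
          have f2 : ((A ∩ T).card : ℝ) + 1 ≤ z := by exact_mod_cast (by omega : (A ∩ T).card + 1 ≤ z)
          have n1 := (N.stp (z+1)).2.2.2.2
          have n2 := CC_nonneg X.card k (z+1+1)
          have n3 : CC X.card k Z2.card ≤ CC X.card k (z+1) := CC_anti N.kn' (by omega)
          have f4 : 0 ≤ ((z:ℝ) - 1 - (A ∩ T).card) * (CC X.card k (z+1) - CC X.card k (z+1+1)) := mul_nonneg (by linarith) (by linarith)
          linarith
      have H3 : ∀ A ∈ X.powersetCard k, A ∉ cyl X k T ∅ → Z2 ⊆ A → Disjoint {y} A := by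
        intro A hA hAL hZA
        rw [Finset.disjoint_singleton_left]; intro hyA
        refine hAL (mem_cyl.2 ⟨hA, fun u hu => ?_, by simp⟩)
        by_cases huy : u = y
        · exact huy ▸ hyA
        · exact hZA (hZs (Finset.mem_erase.2 ⟨huy, hu⟩))
      obtain ⟨ls, st⟩ := pet_state (L0 := cyl X k T ∅) (Z := Z2) (Yv := {y}) (P := P2) 
        (ls0 := z * (CC X.card k (z+1) - CC X.card k (z+1+1)) + k * CC X.card k (z+1+1)) N opt star hZX2 (by simpa using hTX hyT) hPX2 
        (by simpa using hyZ2) dZP2 (by simpa using hyP2) (by omega)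
        (by omega) (by simp; omega) hsub H1 H2 H3 ⟨x, hZs hx, fun A hA => (mem_cyl.1 hA).2.1 hxT⟩
      refine st.finish (hZs hx) ?_ (av := 1 + q2) ?_ ?_
      · intro A hA
        rcases Finset.mem_union.1 hA with h | h
        · exact (mem_cyl.1 h).2.1 hxT
        · exact (mem_pet.1 h).2.1 (hZs hx)
      · rw [Finset.card_union_of_disjoint (by simpa using hyP2), hPq2]; simp; omega
      · have h1 := card_rest hsub hdis
        have h2 := pet_card (k := k) hZX2 (by simpa using hTX hyT : {y} ⊆ X) hPX2 (by simpa using hyZ2) dZP2 (by simpa using hyP2)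
        rw [hz2, hPq2, Finset.card_singleton] at h2
        rw [hz2, show (F \ (cyl X k T ∅ ∪ pet X k Z2 {y} P2)).card = ρ2 by omega]
        exact hl2
    · obtain rfl : q2 = 1 := by omega
      obtain ⟨p2, rfl⟩ := Finset.card_eq_one.1 hPq2
      have hpX : p2 ∈ X := by simpa using hPX2
      have hpZ : p2 ∉ Z2 := by simpa using dZP2
      have hyp : y ≠ p2 := by simpa using hyP2
      obtain ⟨T', hTd'⟩ : ∃ T', T' = insert p2 Z2 := ⟨_, rfl⟩
      have hTX' : T' ⊆ X := by rw [hTd']; exact Finset.insert_subset hpX hZX2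
      have hTc' : T'.card = z2 + 1 := by rw [hTd', Finset.card_insert_of_notMem hpZ, hz2]
      have hyT' : y ∉ T' := by rw [hTd', Finset.mem_insert, not_or]; exact ⟨hyp, hyZ2⟩
      have hdis : Disjoint (cyl X k T ∅) (cyl X k T' {y}) := by
        rw [Finset.disjoint_left]; intro A hA hA'
        have := (mem_cyl.1 hA').2.2
        rw [Finset.disjoint_singleton_left] at this
        exact this ((mem_cyl.1 hA).2.1 hyT)
      have hsub : cyl X k T ∅ ∪ cyl X k T' {y} ⊆ F := by
        intro A hA
        rcases Finset.mem_union.1 hA with h | h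
        · exact hLF h
        · obtain ⟨a1, a2, -⟩ := mem_cyl.1 h
          exact full2 A a1 (fun h' => Finset.disjoint_left.1 hdis h' h) p2 (by simp) (hTd' ▸ a2)
      have er : (T.erase y).card + 1 = T.card := Finset.card_erase_add_one hyT
      obtain ⟨x, hx⟩ := Finset.card_pos.1 (by omega : 0 < (T.erase y).card)
      have hxT := Finset.mem_of_mem_erase hx
      have hZT' : T.erase y ⊆ T' := hZs.trans (by rw [hTd']; exact Finset.subset_insert _ _)
      obtain ⟨ls, st⟩ := stateA N opt star hTX hTX' hyT hyT' hZT' (by omega) hTc' (by omega) gzk hsub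
      refine st.finish hx ?_ (av := 1 + 1) ?_ ?_
      · intro A hA
        rcases Finset.mem_union.1 hA with h | h
        · exact (mem_cyl.1 h).2.1 hxT
        · exact (mem_cyl.1 h).2.1 (hZT' hx)
      · have := Finset.card_sdiff_of_subset hZT'
        rw [Finset.card_singleton, show min 1 (T' \ T.erase y).card = 1 by omega]
      · have h1 := card_rest hsub hdis
        have h2 := card_cyl (k := k) hTX' (by simpa using hTX hyT : {y} ⊆ X) (by simpa using hyT')
        rw [hTc', Finset.card_singleton] at h2
        have h3 := cc_pascal (n := X.card) (k := k) (i := z2) (j := 1) (by omega)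
        rw [show (F \ (cyl X k T ∅ ∪ cyl X k T' {y})).card = ρ2 by omega]
        exact hl2

end SI

namespace SI

theorem claim2 {X : Finset ℕ} {k r m : ℕ} {F : Finset (Finset ℕ)} {V : ℝ} (N : Num X.card k r) (opt : Opt X k F)
    (hF : F.card = m) (hG : Good X.card k m r V) (hm : cc X.card k 1 0 ≤ m) : ∃ x ∈ X, cyl X k {x} ∅ ⊆ F := by
  have hkn := N.kn
  have hk := N.hk
  have hm0 : 0 < m := lt_of_lt_of_le (cc_pos hk (by omega)) hm
  obtain ⟨e, q, ρ, V', a1, a2, a3, a4, a5, a6, a7⟩ := DL hG (by omega) hm0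
  obtain rfl : e = 0 := by
    by_contra h
    have := a7.1 (by omega)
    omega
  simp only [Nat.zero_add, Nat.sub_zero] at a2 a4 a5 a6
  have sh : ∀ i, cc (X.card - q) k i 0 = cc X.card k i q := by
    intro i; have := cc_shift' (n := X.card) (k := k) (c := 0) (a := q) (by omega) i 0
    simpa using this
  have b := good_lt a5 (by rw [sh]; exact a6)
  rw [sh] at b
  have b2 : ρ ≤ r * cc X.card k 2 0 := b.trans (Nat.mul_le_mul (by omega) (cc_anti (Nat.zero_le _)))
  have b3 : (ρ : ℝ) ≤ r * CC X.card k 2 := by unfold CC; exact_mod_cast b2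
  have C0 := CC_nonneg X.card k 1
  have st : STH X k r 1 q F := by
    refine ⟨N, le_rfl, N.hr, hk, a1, by omega, opt.1, ?_, ?_⟩
    · have h2 := (pet_bounds (n := X.card) (k := k) (i := 0) (j := 0) (q := q) (by omega) (by omega)).1
      have h3 := (N.stp 1).2.2.1
      have h4 : ((m + cc X.card k 0 q : ℕ) : ℝ) = ((cc X.card k 0 0 + ρ : ℕ) : ℝ) := by rw [a4]
      push_cast at h4
      simp only [Nat.zero_add] at h2
      rw [hF]
      change (cc X.card k 0 0 : ℝ) - cc X.card k 0 q ≤ q * CC X.card k 1 at h2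
      linarith
    · obtain ⟨P, hPX, hPq⟩ := Finset.exists_subset_card_eq (by omega : q ≤ X.card)
      have h2 := pet_card (k := k) (by simp : (∅ : Finset ℕ) ⊆ X) (by simp : (∅ : Finset ℕ) ⊆ X) hPX (by simp) (by simp) (by simp : Disjoint ∅ P)
      rw [hPq, Finset.card_empty, Nat.zero_add] at h2
      obtain ⟨G, g1, g2, g3⟩ := Finset.exists_subsuperset_card_eq (s := pet X k ∅ ∅ P) (t := X.powersetCard k) (n := m) 
        (fun A hA => (mem_pet.1 hA).1) (by omega) (by rw [← hF]; exact Finset.card_le_card opt.1)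
      have h3 := opt.2 G g2 (by rw [g3, hF])
      have h4 : (q:ℝ) * CC X.card k 1 ^ 2 ≤ ip G G := by
        rw [ip_eq_sum_deg (X := X) (fun A hA => (Finset.mem_powersetCard.1 (g2 hA)).1)]
        calc (q:ℝ) * CC X.card k 1 ^ 2 = ∑ x ∈ P, CC X.card k 1 ^ 2 := by rw [Finset.sum_const, hPq]; simp
          _ ≤ ∑ x ∈ P, deg G {x} * deg G {x} := by
            refine Finset.sum_le_sum fun x hx => ?_
            have hd : CC X.card k 1 ≤ deg G {x} := by
              have := star_deg_self (k := k) (hPX hx)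
              change _ = CC X.card k 1 at this
              rw [← this]
              refine deg_mono (fun A hA => g1 ?_) _
              obtain ⟨u1, u2, -⟩ := mem_cyl.1 hA
              exact mem_pet.2 ⟨u1, by simp, by simp, x, hx, u2 (by simp)⟩
            rw [sq]; exact mul_le_mul hd hd C0 (C0.trans hd)
          _ ≤ _ := Finset.sum_le_sum_of_subset_of_nonneg hPX fun x _ _ => mul_nonneg (deg_nonneg _ _) (deg_nonneg _ _)
      have h5 := sq_nonneg (CC X.card k 1)
      push_cast
      linarith
  have hs := st.s_eq
  obtain ⟨T0, hT0⟩ := Finset.card_pos.1 (by omega : 0 < (TT X k 1 F).card)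
  obtain ⟨⟨t1, t2⟩, -⟩ := mem_TT.1 hT0
  obtain ⟨x, rfl⟩ := Finset.card_eq_one.1 t2
  refine ⟨x, by simpa using t1, ?_⟩
  rcases (OO X k 1 F).eq_empty_or_nonempty with ho | ho
  · obtain ⟨P, hP⟩ : ∃ P : Finset ℕ, P = X.filter (fun p => {p} ∈ TT X k 1 F) := ⟨_, rfl⟩
    have hPX : P ⊆ X := by rw [hP]; exact Finset.filter_subset _ _
    have hTP : TT X k 1 F = P.image (fun p => {p}) := by
      ext T; rw [Finset.mem_image]
      constructor
      · intro h
        obtain ⟨⟨u1, u2⟩, -⟩ := mem_TT.1 h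
        obtain ⟨p, rfl⟩ := Finset.card_eq_one.1 u2
        exact ⟨p, by rw [hP, Finset.mem_filter]; exact ⟨by simpa using u1, h⟩, rfl⟩
      · rintro ⟨p, hp, rfl⟩
        rw [hP, Finset.mem_filter] at hp; exact hp.2
    have hPq : P.card = q := by
      rw [← hs, hTP, Finset.card_image_of_injective _ Finset.singleton_injective]
    have h2 := pet_card (k := k) (by simp : (∅ : Finset ℕ) ⊆ X) (by simp : (∅ : Finset ℕ) ⊆ X) hPX (by simp) (by simp) (by simp : Disjoint ∅ P)
    rw [hPq, Finset.card_empty, Nat.zero_add] at h2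
    have hsub : F ⊆ pet X k ∅ ∅ P := by
      intro A hA
      have hn : A ∈ NN X k 1 F := by
        unfold NN; rw [ho, Finset.sdiff_empty]; exact hA
      obtain ⟨-, T, hT, hTA⟩ := mem_NN.1 hn
      rw [hTP, Finset.mem_image] at hT
      obtain ⟨p, hp, rfl⟩ := hT
      exact mem_pet.2 ⟨opt.1 hA, by simp, by simp, p, hp, by simpa using hTA⟩
    rw [Finset.eq_of_subset_of_card_le hsub (by omega)]
    intro A hA
    obtain ⟨u1, u2, -⟩ := mem_cyl.1 hA
    refine mem_pet.2 ⟨u1, by simp, by simp, x, ?_, u2 (by simp)⟩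
    rw [hP, Finset.mem_filter]; exact ⟨by simpa using t1, hT0⟩
  · intro B hB
    obtain ⟨u1, u2, -⟩ := mem_cyl.1 hB
    by_contra hBF
    have h1 := st.full ho hT0 u2
    have h2 : (OO X k 1 F).card * wt F B ≤ ∑ A ∈ OO X k 1 F, wt F A := by
      rw [← nsmul_eq_mul]
      exact Finset.card_nsmul_le_sum _ _ _ fun A hA => (opt.threshold (OO_sub hA) hBF u1).le
    linarith

lemma good_nonneg {n k m r : ℕ} {V : ℝ} (h : Good n k m r V) : 0 ≤ V := by
  induction h with
  | zero => exact le_rfl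
  | @star n k m r V hk h ih => have := CC_nonneg (n+1) k 2; positivity
  | link hm h ih => positivity

theorem main {n k m r : ℕ} {V : ℝ} (h : Good n k m r V) : ∀ X : Finset ℕ, X.card = n → 72 * k^2 * r * (k + r) < n →
    ∀ F ⊆ X.powersetCard k, F.card = m → ip F F ≤ V := by
  induction h with
  | zero n k r =>
    intro X _ _ F _ hF
    rw [Finset.card_eq_zero] at hF; subst hF; simp [ip]
  | @star n k m r V hk h ih =>
    intro X hX hN F hF hFc
    have N : Num X.card k (r+1) := ⟨hk, by omega, by rw [hX]; exact hN⟩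
    obtain ⟨G, g1, g2, g3⟩ := exists_opt X k F hF
    refine g3.trans ?_
    have hg := Good.star hk h
    rw [← hX] at hg
    rw [hFc] at g2
    obtain ⟨x, hx, hxG⟩ := claim2 N g1 (by rw [g2, ← hX]) hg (by omega)
    have hE : (X.erase x).card = n := by rw [Finset.card_erase_of_mem hx, hX]; rfl
    have hcc : (cyl X k {x} ∅).card = cc (n+1) k 1 0 := by
      rw [card_cyl (by simpa using hx) (by simp) (by simp), hX]; simp
    have hsub : G \ cyl X k {x} ∅ ⊆ (X.erase x).powersetCard k := by
      intro A hA
      rw [Finset.mem_sdiff] at hA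
      have h1 := Finset.mem_powersetCard.1 (g1.1 hA.1)
      refine Finset.mem_powersetCard.2 ⟨fun u hu => Finset.mem_erase.2 ⟨?_, h1.1 hu⟩, h1.2⟩
      rintro rfl
      exact hA.2 (mem_cyl.2 ⟨g1.1 hA.1, by simpa using hu, by simp⟩)
    have hc : (G \ cyl X k {x} ∅).card = m := by
      have := Finset.card_sdiff_add_card_eq_card hxG; omega
    have hip : ip (G \ cyl X k {x} ∅) (G \ cyl X k {x} ∅) ≤ V := by
      refine ih (X.erase x) hE ?_ _ hsub hc
      have : 72 * k^2 * r * (k + r) + 1 ≤ 72 * k^2 * (r+1) * (k + (r+1)) := by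
        have : 1 ≤ k^2 := Nat.one_le_iff_ne_zero.2 (by positivity)
        nlinarith [Nat.zero_le (k^2*r), Nat.zero_le (k^2*k)]
      omega
    have e := ip_star_union hx hsub
    rw [Finset.union_sdiff_of_subset hxG, hc, hX] at e
    rw [e]; push_cast; linarith
  | @link n k m r V hm h ih =>
    intro X hX hN F hF hFc
    rcases Nat.eq_zero_or_pos m with rfl | hm0
    · rw [Finset.card_eq_zero] at hFc; subst hFc
      have := good_nonneg h
      simp [ip, this]
    have N : Num X.card (k+1) (r+1) := ⟨by omega, by omega, by rw [hX]; exact hN⟩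
    obtain ⟨G, g1, g2, g3⟩ := exists_opt X (k+1) F hF
    refine g3.trans ?_
    have hg := Good.link hm h
    rw [← hX] at hg
    rw [hFc] at g2
    by_cases hs : ∃ S ⊆ X.powersetCard (k+1), S.card = G.card ∧ ∃ x, (∀ A ∈ S, x ∈ A) ∧ ip G G ≤ ip S S
    · obtain ⟨S, s1, s2, x, s3, s4⟩ := hs
      refine s4.trans ?_
      obtain ⟨A, hA⟩ := Finset.card_pos.1 (by omega : 0 < S.card)
      have hx : x ∈ X := (Finset.mem_powersetCard.1 (s1 hA)).1 (s3 A hA)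
      have hE : (X.erase x).card = n := by rw [Finset.card_erase_of_mem hx, hX]; rfl
      rw [ip_lnk s3, s2, g2]
      have := ih (X.erase x) hE ?_ (lnk x S) (lnk_sub s1 s3) (by rw [lnk_card s3, s2, g2])
      · linarith
      have h1 : 72 * k^2 * r * (k + r) + 1 ≤ 72 * (k+1)^2 * (r+1) * (k + 1 + (r+1)) := by
        have e1 : 72 * k^2 * r * (k + r) ≤ 72 * (k+1)^2 * (r+1) * (k + r) := by gcongr <;> omega
        have e2 : 1 ≤ 72 * (k+1)^2 * (r+1) * 2 := Nat.one_le_iff_ne_zero.2 (by positivity)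
        calc _ ≤ 72 * (k+1)^2 * (r+1) * (k + r) + 72 * (k+1)^2 * (r+1) * 2 := by omega
          _ = _ := by ring
      omega
    · push Not at hs
      exact (claim1 N g1 (fun S a b x c => hs S a b x c) g2 hg hm0 (by rw [hX, cc_shift]; simpa [cc] using hm)).elim

theorem final (n r k m : ℕ) (hn : 0 < n) (hr : 0 < r) (hk : 0 < k)
    (hbig : 36 * k * (2 * k + 1) * (k + r) * r < n) (hm1 : m < n.choose k)
    (hcas : CascadeEndLe n k m r) (F : Finset (Finset ℕ)) (hFsub : F ⊆ (Finset.Icc 1 n).powersetCard k)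
    (hFcard : F.card = m) (L : Finset (Finset ℕ)) (hL : IsInitSeg n k m L) : omegaF F ≤ omegaF L := by
  obtain ⟨V, hV⟩ := good_of_cascade hm1 hcas
  have h1 := main hV (Finset.Icc 1 n) (by simp) (by
    have : 36 * k * (2 * k + 1) * (k + r) * r = 72 * k^2 * r * (k + r) + 36 * k * (k + r) * r := by ring
    omega) F hFsub hFcard
  have h2 := lex_value hV (Finset.Icc 1 n) L (by simp) hL.1 hL.2.1 hL.2.2
  rw [two_omega (fun A hA => (Finset.mem_powersetCard.1 (hFsub hA)).2), hFcard] at h1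
  rw [two_omega (fun A hA => (Finset.mem_powersetCard.1 (hL.1 hA)).2), hL.2.1] at h2
  have : (omegaF F : ℝ) ≤ omegaF L := by linarith
  exact_mod_cast this

end SI

theorem sum_intersections_le_initSeg
    (n r k m : ℕ) (hn : 0 < n) (hr : 0 < r) (hk : 0 < k)
    (hbig : 36 * k * (2 * k + 1) * (k + r) * r < n)
    (hm0 : 0 < m) (hm1 : m < n.choose k)
    (hcas : CascadeEndLe n k m r)
    (F : Finset (Finset ℕ)) (hFsub : F ⊆ (Finset.Icc 1 n).powersetCard k)
    (hFcard : F.card = m)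
    (L : Finset (Finset ℕ)) (hL : IsInitSeg n k m L) :
    omegaF F ≤ omegaF L := by
  exact SI.final n r k m hn hr hk hbig hm1 hcas F hFsub hFcard L hL
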